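/- arXiv:1308.5522 — 10 statements merged into one kernel-verified Lean document; each statement's English description precedes it below -/
import Mathlib

section
/- Every unavoidable convex body K ⊂ ℝⁿ contains an unavoidable polytope: there exists a finite set S ⊂ K whose convex hull has nonempty interior and intersects every integer hyperplane. -/
/-- Simultaneous Dirichlet approximation along a ray: nonnegative multiples of a nonzero real vector
come arbitrarily close to nonzero integer vectors. -/
theorem exists_int_vector_near_ray {ι : Type*} [Fintype ι] (u : ι → ℝ) (hu : u ≠ 0)
    {ε : ℝ} (hε : 0 < ε) :
    ∃ (m : ι → ℤ) (t : ℝ), m ≠ 0 ∧ 0 ≤ t ∧ ∀ i, |(m i : ℝ) - t * u i| < ε := by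
  obtain ⟨j, hj⟩ : ∃ j, u j ≠ 0 := Function.ne_iff.mp hu
  have hj' : 0 < |u j| := abs_pos.mpr hj
  let v : ℕ → ι → ℝ := fun k i => Int.fract (k * (|u j|⁻¹ * u i))
  have hv : ∀ k, v k ∈ Set.Icc (0 : ι → ℝ) 1 := fun k =>
    ⟨fun i => Int.fract_nonneg _, fun i => (Int.fract_lt_one _).le⟩
  obtain ⟨a, -, φ, hφ, hlim⟩ := isCompact_Icc.tendsto_subseq hv
  obtain ⟨N, hN⟩ := Metric.cauchySeq_iff.mp hlim.cauchySeq (min ε 1) (by positivity)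
  have hd : dist (v (φ (N + 1))) (v (φ N)) < min ε 1 := hN (N + 1) (by lia) N le_rfl
  have hlt : φ N < φ (N + 1) := hφ (by lia)
  generalize φ N = k at hd hlt
  generalize φ (N + 1) = l at hd hlt
  have hkl : (k : ℝ) + 1 ≤ l := by exact_mod_cast hlt
  let m : ι → ℤ := fun i => ⌊(l : ℝ) * (|u j|⁻¹ * u i)⌋ - ⌊(k : ℝ) * (|u j|⁻¹ * u i)⌋
  have hm : ∀ i, |(m i : ℝ) - (l - k) * |u j|⁻¹ * u i| < min ε 1 := by
    intro i
    have h := (dist_le_pi_dist _ _ i).trans_lt hd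
    rw [Real.dist_eq, abs_sub_comm] at h
    have heq : (m i : ℝ) - (l - k) * |u j|⁻¹ * u i = v k i - v l i := by
      simp only [m, v, Int.fract]
      push_cast
      ring
    rwa [heq]
  refine ⟨m, (l - k) * |u j|⁻¹, ?_, ?_, fun i => (hm i).trans_le (min_le_left _ _)⟩
  · intro h0
    have h := (hm j).trans_le (min_le_right _ _)
    rw [h0, Pi.zero_apply, Int.cast_zero, zero_sub, abs_neg, abs_mul, abs_mul, abs_inv, abs_abs,
      mul_assoc, inv_mul_cancel₀ hj'.ne', mul_one, abs_of_nonneg (by linarith)] at h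
    linarith
  · exact mul_nonneg (by linarith) (by positivity)

/-- An unavoidable convex body contains the origin in its interior. -/
theorem zero_mem_interior_of_unavoidable {ι : Type*} [Fintype ι] {K : Set (ι → ℝ)}
    (hK_bdd : Bornology.IsBounded K) (hK_convex : Convex ℝ K) (hK_int : (interior K).Nonempty)
    (hK : ∀ m : ι → ℤ, m ≠ 0 → ∃ x ∈ K, ∑ i, (m i : ℝ) * x i = 1) :
    0 ∈ interior K := by
  classical
  by_contra h0
  obtain ⟨f, hf⟩ := geometric_hahn_banach_open_point hK_convex.interior isOpen_interior h0
  rw [map_zero] at hf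
  have hfK : ∀ x ∈ K, f x ≤ 0 := by
    intro x hx
    have hx' : x ∈ closure (interior K) := by
      rw [hK_convex.closure_interior_eq_closure_of_nonempty_interior hK_int]
      exact subset_closure hx
    exact closure_minimal (fun y hy => (hf y hy).le)
      (isClosed_le f.continuous continuous_const) hx'
  let u : ι → ℝ := fun i => f (Pi.single i 1)
  have hfu : ∀ x, f x = ∑ i, u i * x i := by
    intro x
    conv_lhs => rw [pi_eq_sum_univ' x]
    simp only [map_sum, map_smul, smul_eq_mul, u, mul_comm]
  have hu : u ≠ 0 := by
    rintro hu
    obtain ⟨y, hy⟩ := hK_int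
    have := hf y hy
    simp [hfu, hu] at this
  obtain ⟨R, hR0, hR⟩ := hK_bdd.exists_pos_norm_le
  have hD : 0 < (Fintype.card ι + 1) * R := by positivity
  obtain ⟨m, t, hm0, ht, hm⟩ := exists_int_vector_near_ray u hu (inv_pos.mpr hD)
  obtain ⟨x, hx, hx1⟩ := hK m hm0
  have hsplit : ∑ i, (m i : ℝ) * x i = t * f x + ∑ i, ((m i : ℝ) - t * u i) * x i := by
    rw [hfu, Finset.mul_sum, ← Finset.sum_add_distrib]
    exact Finset.sum_congr rfl fun i _ => by ring
  have hsum : ∑ i, ((m i : ℝ) - t * u i) * x i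
      ≤ Fintype.card ι * ((((Fintype.card ι : ℝ) + 1) * R)⁻¹ * R) := by
    rw [← nsmul_eq_mul, ← Finset.card_univ]
    refine Finset.sum_le_card_nsmul _ _ _ fun i _ => ?_
    refine (le_abs_self _).trans ?_
    rw [abs_mul]
    exact mul_le_mul (hm i).le ((norm_le_pi_norm x i).trans (hR x hx)) (abs_nonneg _)
      (inv_pos.mpr hD).le
  have hlt : Fintype.card ι * ((((Fintype.card ι : ℝ) + 1) * R)⁻¹ * R) < 1 := by
    have : Fintype.card ι * ((((Fintype.card ι : ℝ) + 1) * R)⁻¹ * R)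
        = Fintype.card ι / ((Fintype.card ι : ℝ) + 1) := by
      field_simp
    rw [this, div_lt_one (by positivity)]
    linarith
  have := mul_nonpos_of_nonneg_of_nonpos ht (hfK x hx)
  linarith


/-- Every unavoidable convex body `K ⊆ ℝⁿ` contains an unavoidable polytope:
a finite set `S ⊆ K` whose convex hull has nonempty interior and meets every integer
hyperplane. -/
theorem stmt_4 (n : ℕ) (K : Set (Fin n → ℝ))
    (hK_compact : IsCompact K) (hK_convex : Convex ℝ K)
    (hK_int : (interior K).Nonempty)
    (hK_unavoidable : ∀ m : Fin n → ℤ, m ≠ 0 →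
      ∃ x ∈ K, ∑ i, (m i : ℝ) * x i = 1) :
    ∃ S : Finset (Fin n → ℝ), ↑S ⊆ K ∧
      (interior (convexHull ℝ (↑S : Set (Fin n → ℝ)))).Nonempty ∧
      (∀ m : Fin n → ℤ, m ≠ 0 →
        ∃ x ∈ convexHull ℝ (↑S : Set (Fin n → ℝ)), ∑ i, (m i : ℝ) * x i = 1) := by
  classical
  have h0 := zero_mem_interior_of_unavoidable hK_compact.isBounded hK_convex hK_int hK_unavoidable
  obtain ⟨b, hb0, hbK⟩ := exists_mem_interior_convexHull_affineBasis (mem_interior_iff_mem_nhds.mp h0)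
  obtain ⟨r, hr, hball⟩ :=
    Metric.nhds_basis_closedBall.mem_iff.mp (mem_interior_iff_mem_nhds.mp hb0)
  obtain ⟨N, hN⟩ := exists_nat_ge r⁻¹
  choose w hwK hw using hK_unavoidable
  let p : (Fin n → ℤ) → (Fin n → ℝ) := fun m => if hm : m = 0 then 0 else w m hm
  let S : Finset (Fin n → ℝ) :=
    Finset.univ.image b ∪ (Finset.Icc (fun _ => -(N : ℤ)) (fun _ => (N : ℤ))).image p
  have hbS : convexHull ℝ (Set.range b) ⊆ convexHull ℝ (S : Set (Fin n → ℝ)) :=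
    convexHull_mono (by simp [S])
  refine ⟨S, ?_, ⟨0, interior_mono hbS hb0⟩, fun m hm => ?_⟩
  · intro x hx
    rcases Finset.mem_union.mp hx with hx | hx
    · obtain ⟨i, -, rfl⟩ := Finset.mem_image.mp hx
      exact hbK (subset_convexHull ℝ _ ⟨i, rfl⟩)
    · obtain ⟨m, -, rfl⟩ := Finset.mem_image.mp hx
      by_cases hm : m = 0
      · simpa [p, hm] using interior_subset h0
      · simpa [p, hm] using hwK m hm
  by_cases hmN : ∀ i, |m i| ≤ N
  · refine ⟨p m, subset_convexHull ℝ _ ?_, by simpa [p, hm] using hw m hm⟩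
    refine Finset.mem_union_right _ (Finset.mem_image_of_mem _ (Finset.mem_Icc.mpr ⟨?_, ?_⟩))
    · exact fun i => (abs_le.mp (hmN i)).1
    · exact fun i => (abs_le.mp (hmN i)).2
  · push Not at hmN
    obtain ⟨j, hj⟩ := hmN
    have hj' : (N : ℝ) < |(m j : ℝ)| := by exact_mod_cast hj
    have hrj : r⁻¹ < |(m j : ℝ)| := hN.trans_lt hj'
    have hpos : 0 < |(m j : ℝ)| := (inv_pos.mpr hr).trans hrj
    refine ⟨Pi.single j (m j : ℝ)⁻¹, hbS (hball ?_), ?_⟩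
    · rw [mem_closedBall_zero_iff, Pi.norm_single, Real.norm_eq_abs, abs_inv]
      exact inv_le_of_inv_le₀ hr hrj.le
    · simp [Pi.single_apply, mul_inv_cancel₀ (abs_pos.mp hpos)]
end

section
/- A convex body K ⊂ ℝⁿ contains the origin in its interior if and only if the set of m ∈ ℤⁿ \ {0} for which the integer hyperplane {x ∈ ℝⁿ : m₁x₁ + ⋯ + mₙxₙ = 1} does not intersect K is finite. In particular, every unavoidable convex body contains the origin in its interior. -/
/-- If a neighbourhood of the origin is contained in `K`, only finitely many integer hyperplanes
miss `K`. -/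
lemma finite_integer_hyperplanes_missing {n : ℕ} {K : Set (Fin n → ℝ)}
    (h : (0 : Fin n → ℝ) ∈ interior K) :
    {m : Fin n → ℤ | m ≠ 0 ∧ ¬ ∃ x ∈ K, ∑ i, (m i : ℝ) * x i = 1}.Finite := by
  obtain ⟨r, hr, hball⟩ := Metric.mem_nhds_iff.1 (mem_interior_iff_mem_nhds.1 h)
  obtain ⟨N, hN⟩ := exists_nat_gt (1 / r)
  refine (Set.finite_Icc (fun _ : Fin n => -(N : ℤ)) (fun _ => (N : ℤ))).subset ?_
  rintro m ⟨-, hm⟩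
  have key : ∀ i, |m i| ≤ (N : ℤ) := by
    intro i
    by_contra! hi
    have hi' : (N : ℝ) < |(m i : ℝ)| := by exact_mod_cast hi
    have hlt : 1 / r < |(m i : ℝ)| := hN.trans hi'
    have hpos : 0 < |(m i : ℝ)| := lt_trans (by positivity) hlt
    refine hm ⟨Pi.single i (m i : ℝ)⁻¹, hball ?_, ?_⟩
    · rw [mem_ball_zero_iff, Pi.norm_single, norm_inv, Real.norm_eq_abs]
      rw [one_div] at hlt
      exact inv_lt_of_inv_lt₀ hr hlt
    · simp [Pi.single_apply, abs_pos.1 hpos]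
  exact ⟨fun i => (abs_le.1 (key i)).1, fun i => (abs_le.1 (key i)).2⟩

/-- Simultaneous approximation: integer multiples of a real vector come arbitrarily close to
integer vectors, for arbitrarily large multipliers. -/
lemma exists_large_multiple_near_integer_vector {n : ℕ} (u : Fin n → ℝ) {ε : ℝ} (hε : 0 < ε)
    (B : ℝ) : ∃ (q : ℝ) (m : Fin n → ℤ), B ≤ q ∧ 0 ≤ q ∧ ∀ i, |m i - q * u i| ≤ ε := by
  let a : ℕ → Fin n → ℝ := fun k i => Int.fract ((k : ℝ) * u i)
  have ha : ∀ k, a k ∈ Set.Icc (0 : Fin n → ℝ) 1 := fun k =>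
    ⟨fun i => Int.fract_nonneg _, fun i => (Int.fract_lt_one _).le⟩
  obtain ⟨l, -, φ, hφ, hl⟩ := isCompact_Icc.tendsto_subseq ha
  obtain ⟨N, hN⟩ := Metric.cauchySeq_iff'.1 hl.cauchySeq ε hε
  obtain ⟨M, hM⟩ := exists_nat_ge (B + φ N)
  let k := max N M
  have hk : (M : ℝ) ≤ φ k := by exact_mod_cast (le_max_right N M).trans (hφ.id_le k)
  have hNk : (φ N : ℝ) ≤ φ k := by exact_mod_cast hφ.monotone (le_max_left N M)
  refine ⟨φ k - φ N, fun i => ⌊(φ k : ℝ) * u i⌋ - ⌊(φ N : ℝ) * u i⌋,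
    by linarith, by linarith, fun i => ?_⟩
  have hd := (dist_le_pi_dist (a (φ k)) (a (φ N)) i).trans (hN k (le_max_left N M)).le
  rw [Real.dist_eq, abs_sub_comm] at hd
  refine le_of_eq_of_le (congrArg _ ?_) hd
  simp only [a, Int.fract]
  push_cast
  ring

/-- A nonzero linear functional that is nonpositive on a bounded set yields infinitely many integer
hyperplanes missing that set. -/
lemma infinite_integer_hyperplanes_missing {n : ℕ} {K : Set (Fin n → ℝ)}
    (hK : Bornology.IsBounded K) {u : Fin n → ℝ} (hu : u ≠ 0)
    (huK : ∀ x ∈ K, ∑ i, u i * x i ≤ 0) :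
    {m : Fin n → ℤ | m ≠ 0 ∧ ¬ ∃ x ∈ K, ∑ i, (m i : ℝ) * x i = 1}.Infinite := by
  intro hfin
  obtain ⟨R, hR, hKR⟩ := hK.exists_pos_norm_le
  obtain ⟨j, hj⟩ := Function.ne_iff.1 hu
  have hj' : 0 < |u j| := abs_pos.2 hj
  obtain ⟨C, hC⟩ := ((hfin.insert 0).image fun m => |(m j : ℝ)|).bddAbove
  have hε : 0 < 1 / (n * R + 1) := by positivity
  obtain ⟨q, m, hq, hq0, hm⟩ := exists_large_multiple_near_integer_vector u hε
    ((C + 1 / (n * R + 1) + 1) / |u j|)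
  have hmiss : ¬ ∃ x ∈ K, ∑ i, (m i : ℝ) * x i = 1 := by
    rintro ⟨x, hx, hsum⟩
    have hle : ∑ i, (m i - q * u i) * x i ≤ n * (1 / (n * R + 1) * R) := by
      calc ∑ i, (m i - q * u i) * x i ≤ ∑ _i : Fin n, 1 / (n * R + 1) * R := by
            refine Finset.sum_le_sum fun i _ => (le_abs_self _).trans ?_
            rw [abs_mul]
            exact mul_le_mul (hm i) ((norm_le_pi_norm x i).trans (hKR x hx)) (abs_nonneg _) hε.le
        _ = n * (1 / (n * R + 1) * R) := by simp
    have hlt : n * (1 / (n * R + 1) * R) < 1 := by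
      rw [show n * (1 / (n * R + 1) * R) = n * R / (n * R + 1) by ring, div_lt_one (by positivity)]
      linarith
    have hsplit : ∑ i, (m i - q * u i) * x i = 1 - q * ∑ i, u i * x i := by
      rw [← hsum, Finset.mul_sum, ← Finset.sum_sub_distrib]
      exact Finset.sum_congr rfl fun i _ => by ring
    nlinarith [mul_nonneg hq0 (neg_nonneg.2 (huK x hx))]
  have hmem : m ∈ insert 0 {m : Fin n → ℤ | m ≠ 0 ∧ ¬ ∃ x ∈ K, ∑ i, (m i : ℝ) * x i = 1} := by
    by_cases h0 : m = 0
    · exact Or.inl h0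
    · exact Or.inr ⟨h0, hmiss⟩
  have hCm : |(m j : ℝ)| ≤ C := hC (Set.mem_image_of_mem _ hmem)
  rw [div_le_iff₀ hj'] at hq
  have htri := abs_sub_abs_le_abs_sub (q * u j) (m j)
  rw [abs_sub_comm, abs_mul, abs_of_nonneg hq0] at htri
  linarith [hm j]

/-- A convex body whose interior does not contain the origin lies in a closed half-space bounded by
a hyperplane through the origin. -/
lemma exists_ne_zero_forall_sum_mul_nonpos {n : ℕ} {K : Set (Fin n → ℝ)}
    (hK_convex : Convex ℝ K) (hK_int : (interior K).Nonempty)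
    (h : (0 : Fin n → ℝ) ∉ interior K) :
    ∃ u : Fin n → ℝ, u ≠ 0 ∧ ∀ x ∈ K, ∑ i, u i * x i ≤ 0 := by
  obtain ⟨f, hf⟩ := geometric_hahn_banach_open_point hK_convex.interior isOpen_interior h
  rw [map_zero] at hf
  have hsum : ∀ x, ∑ i, f (Pi.single i 1) * x i = f x := by
    intro x
    conv_rhs => rw [pi_eq_sum_univ' x, map_sum]
    refine Finset.sum_congr rfl fun i _ => ?_
    rw [map_smul, smul_eq_mul, mul_comm]
  refine ⟨fun i => f (Pi.single i 1), fun h0 => ?_, fun x hx => ?_⟩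
  · obtain ⟨x, hx⟩ := hK_int
    have hfx := hf x hx
    rw [← hsum x] at hfx
    simp [fun i => congrFun h0 i] at hfx
  · rw [hsum]
    have hx' : x ∈ closure (interior K) := by
      rw [hK_convex.closure_interior_eq_closure_of_nonempty_interior hK_int]
      exact subset_closure hx
    exact closure_minimal (fun y hy => (hf y hy).le)
      (isClosed_le f.continuous continuous_const) hx'


/-- A convex body contains the origin in its interior iff only finitely many
integer hyperplanes miss it; in particular an unavoidable convex body contains the origin
in its interior. -/
theorem stmt_5 (n : ℕ) (K : Set (Fin n → ℝ))
    (hK_compact : IsCompact K) (hK_convex : Convex ℝ K)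
    (hK_int : (interior K).Nonempty) :
    ((0 : Fin n → ℝ) ∈ interior K ↔
      {m : Fin n → ℤ | m ≠ 0 ∧ ¬ ∃ x ∈ K, ∑ i, (m i : ℝ) * x i = 1}.Finite) ∧
    ((∀ m : Fin n → ℤ, m ≠ 0 → ∃ x ∈ K, ∑ i, (m i : ℝ) * x i = 1) →
      (0 : Fin n → ℝ) ∈ interior K) := by
  have hfin : {m : Fin n → ℤ | m ≠ 0 ∧ ¬ ∃ x ∈ K, ∑ i, (m i : ℝ) * x i = 1}.Finite →
      (0 : Fin n → ℝ) ∈ interior K := by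
    contrapose
    intro h
    obtain ⟨u, hu, huK⟩ := exists_ne_zero_forall_sum_mul_nonpos hK_convex hK_int h
    exact infinite_integer_hyperplanes_missing hK_compact.isBounded hu huK
  refine ⟨⟨finite_integer_hyperplanes_missing, hfin⟩, fun hall => hfin ?_⟩
  convert Set.finite_empty
  exact Set.eq_empty_of_forall_notMem fun m hm => hm.2 (hall m hm.1)
end

section
/- Let K ⊂ ℝⁿ be a convex body containing the origin in its interior and let A : ℝⁿ → ℝⁿ be an invertible linear map. If the lattice A(ℤⁿ) intersects the interior of K* only at the origin, then A(ℤⁿ) intersects the interior of ((K − K)/2)* only at the origin. Consequently, the critical determinants satisfy 2ⁿ · Δ((K − K)*) ≤ Δ(K*). -/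
open MeasureTheory Pointwise

/-- The dual (polar) body of `K ⊆ ℝⁿ`: all `ξ` with `⟨ξ, x⟩ ≤ 1` for every `x ∈ K`. -/
def polarBody (n : ℕ) (K : Set (Fin n → ℝ)) : Set (Fin n → ℝ) :=
  {ξ : Fin n → ℝ | ∀ x ∈ K, ∑ i, ξ i * x i ≤ 1}

/-- The critical determinant of `L ⊆ ℝⁿ`: the infimum of `|det A|` over invertible linear
maps `A` such that the lattice `A(ℤⁿ)` meets the interior of `L` only at the origin. -/
noncomputable def critDet (n : ℕ) (L : Set (Fin n → ℝ)) : ℝ :=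
  sInf {d : ℝ | ∃ A : (Fin n → ℝ) →ₗ[ℝ] (Fin n → ℝ), Function.Bijective A ∧
    (∀ m : Fin n → ℤ, A (fun i => (m i : ℝ)) ∈ interior L → m = 0) ∧
    d = |LinearMap.det A|}

/-- A vector whose pairing with every point of a compact set is less than `1` lies in the interior
of the polar body. -/
theorem mem_interior_polarBody {n : ℕ} {K : Set (Fin n → ℝ)} (hK : IsCompact K)
    {ξ : Fin n → ℝ} (h : ∀ x ∈ K, ∑ i, ξ i * x i < 1) : ξ ∈ interior (polarBody n K) := by
  rw [mem_interior_iff_mem_nhds]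
  have hev := hK.eventually_forall_of_forall_eventually (x₀ := ξ)
    (P := fun η x => ∑ i, η i * x i < 1) fun x hx => by
      have hc : Continuous fun z : (Fin n → ℝ) × (Fin n → ℝ) => ∑ i, z.1 i * z.2 i := by
        fun_prop
      exact (hc.tendsto (ξ, x)).eventually_lt_const (h x hx)
  filter_upwards [hev] with η hη x hx using (hη x hx).le

/-- On a set `S`, the pairing with an interior point of the polar body is bounded by a constant
less than `1`. -/
theorem exists_lt_one_of_mem_interior_polarBody {n : ℕ} {S : Set (Fin n → ℝ)}
    {ξ : Fin n → ℝ} (h : ξ ∈ interior (polarBody n S)) :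
    ∃ c < (1 : ℝ), ∀ x ∈ S, ∑ i, ξ i * x i ≤ c := by
  have hc : Filter.Tendsto (fun t : ℝ => t • ξ) (nhdsWithin 1 (Set.Ioi 1)) (nhds ξ) := by
    have hcont : Continuous fun t : ℝ => t • ξ := by fun_prop
    simpa using (hcont.tendsto 1).mono_left nhdsWithin_le_nhds
  obtain ⟨t, ht, ht1⟩ :=
    ((hc.eventually (mem_interior_iff_mem_nhds.mp h)).and self_mem_nhdsWithin).exists
  have ht1 : 1 < t := ht1
  refine ⟨t⁻¹, inv_lt_one_of_one_lt₀ ht1, fun x hx => ?_⟩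
  have hx' : ∑ i, (t • ξ) i * x i ≤ 1 := ht x hx
  simp only [Pi.smul_apply, smul_eq_mul, mul_assoc, ← Finset.mul_sum] at hx'
  rw [← one_div, le_div_iff₀ (by linarith)]
  linarith

/-- If `ξ` has width less than `2` on `K`, then `ξ` or `-ξ` is interior to the polar body. -/
theorem mem_or_neg_mem_interior_polarBody {n : ℕ} {K : Set (Fin n → ℝ)} (hK : IsCompact K)
    {ξ : Fin n → ℝ} {c : ℝ} (hc : c < 1)
    (h : ∀ x ∈ K, ∀ y ∈ K, ∑ i, ξ i * x i - ∑ i, ξ i * y i ≤ 2 * c) :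
    ξ ∈ interior (polarBody n K) ∨ -ξ ∈ interior (polarBody n K) := by
  by_cases hx : ∀ x ∈ K, ∑ i, ξ i * x i < 1
  · exact Or.inl (mem_interior_polarBody hK hx)
  · push Not at hx
    obtain ⟨x, hxK, hx⟩ := hx
    refine Or.inr (mem_interior_polarBody hK fun y hy => ?_)
    simp only [Pi.neg_apply, neg_mul, Finset.sum_neg_distrib]
    linarith [h x hxK y hy]

/-- A lattice meeting the interior of `K*` only at the origin contains no other vector of width
less than `2` on `K`. -/
theorem eq_zero_of_width_lt_two {n : ℕ} {K : Set (Fin n → ℝ)} (hK : IsCompact K)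
    {A : (Fin n → ℝ) →ₗ[ℝ] (Fin n → ℝ)}
    (hadm : ∀ m : Fin n → ℤ, A (fun i => (m i : ℝ)) ∈ interior (polarBody n K) → m = 0)
    {m : Fin n → ℤ} {c : ℝ} (hc : c < 1)
    (h : ∀ x ∈ K, ∀ y ∈ K, ∑ i, A (fun i => (m i : ℝ)) i * x i
      - ∑ i, A (fun i => (m i : ℝ)) i * y i ≤ 2 * c) : m = 0 := by
  rcases mem_or_neg_mem_interior_polarBody hK hc h with h' | h'
  · exact hadm m h'
  · refine neg_eq_zero.mp (hadm (-m) ?_)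
    rw [← map_neg] at h'
    convert h' using 2
    ext i
    simp

/-- If the lattice `A(ℤⁿ)` meets the interior of `K*` only at the origin,
then it meets the interior of `((K - K)/2)*` only at the origin; consequently
`2ⁿ Δ((K-K)*) ≤ Δ(K*)`. -/
theorem stmt_7 (n : ℕ) (K : Set (Fin n → ℝ))
    (hK_compact : IsCompact K) (hK_convex : Convex ℝ K)
    (h0 : (0 : Fin n → ℝ) ∈ interior K)
    (A : (Fin n → ℝ) →ₗ[ℝ] (Fin n → ℝ)) (hA : Function.Bijective A)
    (hadm : ∀ m : Fin n → ℤ, A (fun i => (m i : ℝ)) ∈ interior (polarBody n K) → m = 0) :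
    (∀ m : Fin n → ℤ,
      A (fun i => (m i : ℝ)) ∈ interior (polarBody n ((2⁻¹ : ℝ) • (K - K))) → m = 0) ∧
    2 ^ n * critDet n (polarBody n (K - K)) ≤ critDet n (polarBody n K) := by
  constructor
  · intro m hm
    obtain ⟨c, hc, hle⟩ := exists_lt_one_of_mem_interior_polarBody hm
    refine eq_zero_of_width_lt_two hK_compact hadm hc fun x hx y hy => ?_
    have hxy := hle _ (Set.smul_mem_smul_set (a := (2⁻¹ : ℝ)) (Set.sub_mem_sub hx hy))
    simp only [Pi.smul_apply, Pi.sub_apply, smul_eq_mul, mul_left_comm _ (2⁻¹ : ℝ), mul_sub,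
      Finset.sum_sub_distrib, ← Finset.mul_sum] at hxy
    linarith
  · refine le_csInf ⟨_, A, hA, hadm, rfl⟩ ?_
    rintro _ ⟨B, hB, hBadm, rfl⟩
    have hle : critDet n (polarBody n (K - K)) ≤ |LinearMap.det ((2⁻¹ : ℝ) • B)| := by
      refine csInf_le ⟨0, ?_⟩ ⟨(2⁻¹ : ℝ) • B, ?_, fun m hm => ?_, rfl⟩
      · rintro _ ⟨_, _, _, rfl⟩
        exact abs_nonneg _
      · exact (MulAction.bijective (Units.mk0 (2⁻¹ : ℝ) (by norm_num))).comp hB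
      · obtain ⟨c, hc, hle⟩ := exists_lt_one_of_mem_interior_polarBody hm
        refine eq_zero_of_width_lt_two hK_compact hBadm hc fun x hx y hy => ?_
        have hxy := hle _ (Set.sub_mem_sub hx hy)
        simp only [LinearMap.smul_apply, Pi.smul_apply, Pi.sub_apply, smul_eq_mul, mul_assoc,
          mul_sub, Finset.sum_sub_distrib, ← Finset.mul_sum] at hxy
        linarith
    rw [LinearMap.det_smul, Module.finrank_fin_fun, abs_mul, abs_of_pos (by positivity)] at hle
    calc 2 ^ n * critDet n (polarBody n (K - K))
        ≤ 2 ^ n * ((2⁻¹ : ℝ) ^ n * |LinearMap.det B|) := by gcongr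
      _ = |LinearMap.det B| := by rw [← mul_assoc, ← mul_pow]; norm_num
end

section
/- If a convex body K ⊂ ℝⁿ intersects every integer hyperplane {x ∈ ℝⁿ : m₁x₁ + ⋯ + mₙxₙ = 1}, m ∈ ℤⁿ \ {0}, then the set (1/2)K + ℤⁿ = {x/2 + m : x ∈ K, m ∈ ℤⁿ} intersects every affine hyperplane of ℝⁿ, i.e., for every ξ ∈ ℝⁿ \ {0} and every c ∈ ℝ there exist x ∈ K and m ∈ ℤⁿ with ⟨ξ, x/2 + m⟩ = c. -/
/-- The subgroup of values of `∑ ξ i * m i` at integer vectors `m`. -/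
def integerValues {n : ℕ} (ξ : Fin n → ℝ) : AddSubgroup ℝ where
  carrier := {y | ∃ m : Fin n → ℤ, ∑ i, ξ i * (m i : ℝ) = y}
  zero_mem' := ⟨0, by simp⟩
  add_mem' := by
    rintro _ _ ⟨m, rfl⟩ ⟨k, rfl⟩
    exact ⟨m + k, by simp [mul_add, Finset.sum_add_distrib]⟩
  neg_mem' := by
    rintro _ ⟨m, rfl⟩
    exact ⟨-m, by simp⟩

theorem apply_mem_integerValues {n : ℕ} (ξ : Fin n → ℝ) (i : Fin n) :
    ξ i ∈ integerValues ξ :=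
  ⟨Pi.single i 1, by simp [Pi.single_apply]⟩

/-- If `K` has nonempty interior, `ξ ≠ 0` and `A ⊆ ℝ` is dense, then every real number is the sum
of a value of `∑ ξ i * (x i / 2)` on `K` and an element of `A`. -/
theorem exists_sum_mul_add_eq_of_dense {n : ℕ} {K : Set (Fin n → ℝ)} (hK : (interior K).Nonempty)
    {ξ : Fin n → ℝ} (hξ : ξ ≠ 0) {A : Set ℝ} (hA : Dense A) (c : ℝ) :
    ∃ x ∈ K, ∃ a ∈ A, ∑ i, ξ i * (x i / 2) + a = c := by
  obtain ⟨i, hi⟩ := Function.ne_iff.mp hξ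
  let f : (Fin n → ℝ) →ₗ[ℝ] ℝ := Fintype.linearCombination ℝ (fun i => ξ i / 2)
  have hf (x : Fin n → ℝ) : f x = ∑ i, ξ i * (x i / 2) := by
    simp only [f, Fintype.linearCombination_apply, smul_eq_mul]
    exact Finset.sum_congr rfl fun _ _ => by ring
  have hsurj : Function.Surjective f := by
    refine LinearMap.surjective fun h => hi ?_
    have := LinearMap.congr_fun h (Pi.single i 1)
    simpa [f, Fintype.linearCombination_apply, Pi.single_apply] using this
  have hopen : IsOpen ((fun y => c - y) ⁻¹' (f '' interior K)) :=
    (f.isOpenMap_of_finiteDimensional hsurj _ isOpen_interior).preimage (by fun_prop)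
  have hne : ((fun y => c - y) ⁻¹' (f '' interior K)).Nonempty := by
    obtain ⟨p, hp⟩ := hK
    exact ⟨c - f p, p, hp, by ring⟩
  obtain ⟨a, ⟨x, hx, hxa⟩, ha⟩ := hA.inter_open_nonempty _ hopen hne
  exact ⟨x, interior_subset hx, a, ha, by rw [← hf, hxa]; ring⟩

/-- A convex set meeting every integer hyperplane also meets the hyperplanes
`∑ m i * x i = r` for `|r| ≤ 1`. -/
theorem exists_sum_int_mul_eq_of_abs_le_one {n : ℕ} {K : Set (Fin n → ℝ)} (hK : Convex ℝ K)
    (h : ∀ m : Fin n → ℤ, m ≠ 0 → ∃ x ∈ K, ∑ i, (m i : ℝ) * x i = 1)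
    {m : Fin n → ℤ} (hm : m ≠ 0) {r : ℝ} (hr : |r| ≤ 1) :
    ∃ x ∈ K, ∑ i, (m i : ℝ) * x i = r := by
  obtain ⟨x, hx, hx1⟩ := h m hm
  obtain ⟨y, hy, hy1⟩ := h (-m) (neg_ne_zero.mpr hm)
  have hy2 : ∑ i, (m i : ℝ) * y i = -1 := by
    simp only [Pi.neg_apply, Int.cast_neg, neg_mul, Finset.sum_neg_distrib] at hy1
    linarith
  obtain ⟨h1, h2⟩ := abs_le.mp hr
  refine ⟨((1 + r) / 2) • x + ((1 - r) / 2) • y,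
    hK hx hy (by linarith) (by linarith) (by ring), ?_⟩
  have : ∑ i, (m i : ℝ) * (((1 + r) / 2) • x + ((1 - r) / 2) • y) i =
      (1 + r) / 2 * ∑ i, (m i : ℝ) * x i + (1 - r) / 2 * ∑ i, (m i : ℝ) * y i := by
    rw [Finset.mul_sum, Finset.mul_sum, ← Finset.sum_add_distrib]
    refine Finset.sum_congr rfl fun i _ => ?_
    simp only [Pi.add_apply, Pi.smul_apply, smul_eq_mul]
    ring
  rw [this, hx1, hy2]
  ring

/-- If a convex body `K ⊆ ℝⁿ` intersects every integer hyperplane, then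
`(1/2)K + ℤⁿ` intersects every affine hyperplane of `ℝⁿ`. -/
theorem stmt_9 (n : ℕ) (K : Set (Fin n → ℝ))
    (hK_compact : IsCompact K) (hK_convex : Convex ℝ K)
    (hK_int : (interior K).Nonempty)
    (hK_unavoidable : ∀ m : Fin n → ℤ, m ≠ 0 →
      ∃ x ∈ K, ∑ i, (m i : ℝ) * x i = 1) :
    ∀ ξ : Fin n → ℝ, ξ ≠ 0 → ∀ c : ℝ,
      ∃ x ∈ K, ∃ m : Fin n → ℤ, ∑ i, ξ i * (x i / 2 + (m i : ℝ)) = c := by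
  intro ξ hξ c
  suffices ∃ x ∈ K, ∃ a ∈ integerValues ξ, ∑ i, ξ i * (x i / 2) + a = c by
    obtain ⟨x, hx, _, ⟨m, rfl⟩, h⟩ := this
    exact ⟨x, hx, m, by simpa only [mul_add, Finset.sum_add_distrib] using h⟩
  rcases AddSubgroup.dense_or_cyclic (integerValues ξ) with hd | ⟨a, ha⟩
  · exact exists_sum_mul_add_eq_of_dense hK_int hξ hd c
  · have hmul (i : Fin n) : ∃ k : ℤ, k • a = ξ i := by
      rw [← AddSubgroup.mem_closure_singleton, ← ha]
      exact apply_mem_integerValues ξ i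
    choose m hm using hmul
    have ha0 : a ≠ 0 := by
      rintro rfl
      exact hξ (funext fun i => by simp [← hm i])
    have hm0 : m ≠ 0 := by
      rintro rfl
      exact hξ (funext fun i => by simp [← hm i])
    have hr : |2 * (c / a - round (c / a))| ≤ 1 := by
      rw [abs_mul, abs_two]
      linarith [abs_sub_round (c / a)]
    obtain ⟨x, hx, hxr⟩ := exists_sum_int_mul_eq_of_abs_le_one hK_convex hK_unavoidable hm0 hr
    refine ⟨x, hx, round (c / a) • a, ?_, ?_⟩
    · rw [ha]
      exact AddSubgroup.mem_closure_singleton.mpr ⟨_, rfl⟩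
    · have : ∑ i, ξ i * (x i / 2) = a / 2 * ∑ i, (m i : ℝ) * x i := by
        rw [Finset.mul_sum]
        refine Finset.sum_congr rfl fun i _ => ?_
        rw [← hm i, zsmul_eq_mul]
        ring
      rw [this, hxr, zsmul_eq_mul]
      field_simp
      ring
end

section
/- Let B ⊂ ℝ² be a convex body that is symmetric about the origin (B = −B) and intersects every integer line {x ∈ ℝ² : m₁x₁ + m₂x₂ = 1} with (m₁,m₂) ∈ ℤ² \ {0}. Then the area of B is at least 2, and equality holds only if B is a parallelogram. -/
open MeasureTheory Pointwise

namespace IntegerLines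

/-- The determinant of a pair of vectors of the plane. -/
def cross (p q : Fin 2 → ℝ) : ℝ := p 0 * q 1 - p 1 * q 0

/-- The linear map sending the standard basis to `u, w`. -/
noncomputable def ofColumns (u w : Fin 2 → ℝ) : (Fin 2 → ℝ) →ₗ[ℝ] (Fin 2 → ℝ) :=
  Matrix.toLin' !![u 0, w 0; u 1, w 1]

lemma ofColumns_apply (u w x : Fin 2 → ℝ) : ofColumns u w x = x 0 • u + x 1 • w := by
  ext i
  fin_cases i <;> simp [ofColumns, Matrix.mulVec, dotProduct, Fin.sum_univ_two] <;> ring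

lemma det_ofColumns (u w : Fin 2 → ℝ) : LinearMap.det (ofColumns u w) = cross u w := by
  simp [ofColumns, LinearMap.det_toLin', Matrix.det_fin_two, cross]
  ring

lemma volume_image_ofColumns (u w : Fin 2 → ℝ) (S : Set (Fin 2 → ℝ)) :
    volume (ofColumns u w '' S) = ENNReal.ofReal |cross u w| * volume S := by
  rw [Measure.addHaar_image_linearMap, det_ofColumns]

lemma volume_square :
    volume (Set.Icc (fun _ => (-1 : ℝ)) (fun _ => (1 : ℝ)) : Set (Fin 2 → ℝ))
      = ENNReal.ofReal 4 := by
  rw [Real.volume_Icc_pi]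
  simp only [Fin.prod_univ_two]
  rw [← ENNReal.ofReal_mul (by norm_num)]
  norm_num

lemma ofColumns_square_subset {B : Set (Fin 2 → ℝ)} (hconv : Convex ℝ B) (hsymm : B = -B)
    {p q : Fin 2 → ℝ} (hp : p ∈ B) (hq : q ∈ B) :
    ofColumns ((1 / 2 : ℝ) • (p + q)) ((1 / 2 : ℝ) • (p - q)) ''
      Set.Icc (fun _ => (-1 : ℝ)) (fun _ => (1 : ℝ)) ⊆ B := by
  have hneg : ∀ {x}, x ∈ B → -x ∈ B := fun {x} hx => by
    rw [hsymm] at hx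
    exact hx
  rintro _ ⟨x, ⟨hl, hu⟩, rfl⟩
  have l0 := hl 0
  have l1 := hl 1
  have u0 := hu 0
  have u1 := hu 1
  simp only at l0 l1 u0 u1
  have key : ofColumns ((1 / 2 : ℝ) • (p + q)) ((1 / 2 : ℝ) • (p - q)) x =
      ((1 + x 0) / 2) • (((1 + x 1) / 2) • p + ((1 - x 1) / 2) • q) +
      ((1 - x 0) / 2) • (((1 + x 1) / 2) • (-q) + ((1 - x 1) / 2) • (-p)) := by
    rw [ofColumns_apply]
    ext i
    simp
    ring
  rw [key]
  exact hconv (hconv hp hq (by linarith) (by linarith) (by ring))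
    (hconv (hneg hq) (hneg hp) (by linarith) (by linarith) (by ring))
    (by linarith) (by linarith) (by ring)

lemma cross_half_add_half_sub (p q : Fin 2 → ℝ) :
    cross ((1 / 2 : ℝ) • (p + q)) ((1 / 2 : ℝ) • (p - q)) = -(1 / 2 * cross p q) := by
  simp [cross]
  ring

lemma volume_ofColumns_square (p q : Fin 2 → ℝ) :
    volume (ofColumns ((1 / 2 : ℝ) • (p + q)) ((1 / 2 : ℝ) • (p - q)) ''
      Set.Icc (fun _ => (-1 : ℝ)) (fun _ => (1 : ℝ))) = ENNReal.ofReal (2 * |cross p q|) := by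
  rw [volume_image_ofColumns, volume_square, cross_half_add_half_sub, abs_neg, abs_mul,
    ← ENNReal.ofReal_mul (by positivity)]
  congr 1
  norm_num
  ring

lemma eq_of_subset_of_volume_le {B K : Set (Fin 2 → ℝ)} (hconv : Convex ℝ B)
    (hint : (interior B).Nonempty) (hK : IsCompact K) (hKB : K ⊆ B)
    (hvol : volume B ≤ volume K) : B = K := by
  refine Set.Subset.antisymm ?_ hKB
  have h0 : volume (interior B \ K) = 0 := by
    have h1 : volume (B \ K) = 0 := by
      rw [measure_sdiff hKB hK.measurableSet.nullMeasurableSet hK.measure_lt_top.ne]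
      exact tsub_eq_zero_of_le hvol
    exact measure_mono_null (Set.sdiff_subset_sdiff_left interior_subset) h1
  have h1 : interior B \ K = ∅ :=
    ((isOpen_interior.sdiff hK.isClosed).measure_eq_zero_iff volume).1 h0
  calc B ⊆ closure B := subset_closure
    _ = closure (interior B) := (hconv.closure_interior_eq_closure_of_nonempty_interior hint).symm
    _ ⊆ K := closure_minimal (Set.sdiff_eq_empty.1 h1) hK.isClosed

/-- The area of the right triangle with legs `1`, without its boundary. -/
lemma volume_triangle :
    volume {x : Fin 2 → ℝ | 0 < x 0 ∧ x 0 ≤ 1 ∧ 0 < x 1 ∧ x 1 < 1 - x 0}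
      = ENNReal.ofReal (1 / 2) := by
  have hR := volume_regionBetween_eq_integral (μ := (volume : Measure ℝ)) (f := fun _ => (0 : ℝ))
    (g := fun x => 1 - x) (s := Set.Ioc 0 1)
    (by simp)
    ((by fun_prop : Continuous fun x : ℝ => 1 - x).integrableOn_Ioc) measurableSet_Ioc
    (fun x hx => by linarith [hx.2])
  have hI : ∫ y in Set.Ioc (0 : ℝ) 1, ((fun x => 1 - x) - fun _ => 0 : ℝ → ℝ) y = 1 / 2 := by
    rw [← intervalIntegral.integral_of_le zero_le_one]
    simp only [Pi.sub_apply, sub_zero]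
    rw [intervalIntegral.integral_comp_sub_left fun x => x]
    simp
  rw [hI] at hR
  have hmp := volume_preserving_finTwoArrow ℝ
  have hmeas : MeasurableSet (regionBetween (fun _ => (0 : ℝ)) (fun x => 1 - x) (Set.Ioc 0 1)) :=
    measurableSet_regionBetween (by fun_prop) (by fun_prop) measurableSet_Ioc
  rw [← Measure.volume_eq_prod] at hR
  rw [← hR, ← hmp.measure_preimage hmeas.nullMeasurableSet]
  congr 1
  ext x
  simp [regionBetween, MeasurableEquiv.finTwoArrow, and_assoc]

lemma volume_hexagon_le {B : Set (Fin 2 → ℝ)} (hconv : Convex ℝ B)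
    (hsymm : B = -B) {a b c : Fin 2 → ℝ} (ha : a ∈ B) (hb : b ∈ B) (hc : c ∈ B)
    (hac : 0 < cross a c) (hE : cross a c < cross a b + cross b c) :
    ENNReal.ofReal (cross a b + cross b c + cross a c) ≤ volume B := by
  set φ : (Fin 2 → ℝ) → ℝ := fun x => cross a x + cross x c with hφ
  have hφc : Continuous φ := by
    unfold φ cross
    fun_prop
  set P := ofColumns ((1 / 2 : ℝ) • (a + c)) ((1 / 2 : ℝ) • (a - c)) ''
      Set.Icc (fun _ => (-1 : ℝ)) (fun _ => (1 : ℝ)) with hP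
  set T := (b + ·) '' (ofColumns (a - b) (c - b) ''
    {x : Fin 2 → ℝ | 0 < x 0 ∧ x 0 ≤ 1 ∧ 0 < x 1 ∧ x 1 < 1 - x 0}) with hT
  have hvT : volume T = ENNReal.ofReal ((cross a b + cross b c - cross a c) / 2) := by
    have h : cross (a - b) (c - b) = -(cross a b + cross b c - cross a c) := by
      simp [cross]
      ring
    rw [hT, Set.image_add_left, measure_preimage_add, volume_image_ofColumns, volume_triangle,
      h, abs_neg, abs_of_pos (by linarith), ← ENNReal.ofReal_mul (by linarith)]
    congr 1
    ring
  have hTB : T ⊆ B ∩ {x | cross a c < φ x} := by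
    rintro _ ⟨_, ⟨x, ⟨h1, h2, h3, h4⟩, rfl⟩, rfl⟩
    constructor
    · have h5 := hconv.sum_mem (t := Finset.univ) (w := ![1 - x 0 - x 1, x 0, x 1])
        (z := ![b, a, c])
        (by intro i _; fin_cases i <;> simp <;> linarith)
        (by simp [Fin.sum_univ_three]; ring)
        (by intro i _; fin_cases i <;> simp [ha, hb, hc])
      convert h5 using 1
      simp only [ofColumns_apply, Fin.sum_univ_three]
      ext i
      simp
      ring
    · have : φ (b + ofColumns (a - b) (c - b) x) - cross a c
          = (1 - x 0 - x 1) * (cross a b + cross b c - cross a c) := by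
        simp [hφ, ofColumns_apply, cross]
        ring
      have h6 := mul_pos (by linarith : 0 < 1 - x 0 - x 1)
        (by linarith : 0 < cross a b + cross b c - cross a c)
      simp only [Set.mem_ofPred_eq]
      linarith
  have hφneg : ∀ x, φ (-x) = -φ x := fun x => by
    simp [hφ, cross]
    ring
  have hT'B : -T ⊆ B ∩ {x | φ x < -cross a c} := by
    intro x hx
    obtain ⟨h1, h2⟩ := hTB hx
    refine ⟨by rw [hsymm]; exact h1, ?_⟩
    simp only [Set.mem_ofPred_eq, hφneg] at h2 ⊢
    linarith
  have hPB : P ⊆ B ∩ {x | -cross a c ≤ φ x ∧ φ x ≤ cross a c} := by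
    intro y hy
    refine ⟨ofColumns_square_subset hconv hsymm ha hc hy, ?_⟩
    obtain ⟨x, ⟨hl, hu⟩, rfl⟩ := hy
    have l0 := hl 0
    have u0 := hu 0
    simp only at l0 u0
    have : φ (ofColumns ((1 / 2 : ℝ) • (a + c)) ((1 / 2 : ℝ) • (a - c)) x)
        = x 0 * cross a c := by
      simp [hφ, ofColumns_apply, cross]
      ring
    simp only [Set.mem_ofPred_eq, this]
    constructor <;> nlinarith
  have hvP : volume P = ENNReal.ofReal (2 * cross a c) := by
    rw [hP, volume_ofColumns_square, abs_of_pos hac]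
  have hB1 := measure_inter_add_sdiff (μ := volume) B
    (measurableSet_lt measurable_const hφc.measurable : MeasurableSet {x | cross a c < φ x})
  have hB2 := measure_inter_add_sdiff (μ := volume) (B \ {x | cross a c < φ x})
    (measurableSet_lt hφc.measurable measurable_const : MeasurableSet {x | φ x < -cross a c})
  calc ENNReal.ofReal (cross a b + cross b c + cross a c)
      = volume T + (volume (-T) + volume P) := by
        rw [Measure.measure_neg, hvT, hvP, ← ENNReal.ofReal_add (by linarith) (by linarith),
          ← ENNReal.ofReal_add (by linarith) (by linarith)]
        congr 1
        ring
    _ ≤ volume B := by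
        rw [← hB1, ← hB2]
        gcongr
        · intro x hx
          obtain ⟨h1, h2⟩ := hT'B hx
          refine ⟨⟨h1, ?_⟩, h2⟩
          simp only [Set.mem_ofPred_eq] at h2 ⊢
          linarith
        · intro x hx
          obtain ⟨h1, h2, h3⟩ := hPB hx
          exact ⟨⟨h1, not_lt.2 h3⟩, not_lt.2 h2⟩

/-- A body meeting three suitable lines at points of a strip either contains a large
parallelogram or has area greater than `2`. -/
lemma exists_cross_ge_one_or_volume_gt {B : Set (Fin 2 → ℝ)}
    (hconv : Convex ℝ B) (hsymm : B = -B) {a b c : Fin 2 → ℝ} (ha : a ∈ B) (hb : b ∈ B)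
    (hc : c ∈ B) {t s v : ℝ} (ht : 0 ≤ t) (ht1 : t < 1) (hs : s ≤ 1) (hv : v ≤ 1)
    (hab : cross a b = 1 - t * s) (hbc : cross b c = s + v - s * v)
    (hac : cross a c = 1 - v * (1 - t)) :
    (∃ p ∈ B, ∃ q ∈ B, 1 ≤ |cross p q|) ∨ ENNReal.ofReal 2 < volume B := by
  by_contra! hcon
  obtain ⟨h1, h2⟩ := hcon
  have hab' := (abs_lt.1 (h1 a ha b hb)).2
  have hbc' := (abs_lt.1 (h1 b hb c hc)).2
  have hac' := (abs_lt.1 (h1 a ha c hc)).2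
  rw [hab] at hab'
  rw [hbc] at hbc'
  rw [hac] at hac'
  have hts : 0 < t * s := by linarith
  have ht0 : 0 < t := lt_of_le_of_ne ht fun h => by simp [← h] at hts
  have hs0 : 0 < s := pos_of_mul_pos_right hts ht
  have hv0 : 0 < v := pos_of_mul_pos_left (by linarith : 0 < v * (1 - t)) (by linarith)
  have hsv : 0 < (1 - s) * (1 - v) := by nlinarith
  have hs1 : s < 1 := lt_of_le_of_ne hs fun h => by simp [h] at hsv
  have hsum : 0 < s * (1 - t) * (1 - v) + t * v * (1 - s) := by
    have : 0 ≤ s * (1 - t) * (1 - v) :=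
      mul_nonneg (mul_nonneg hs0.le (by linarith)) (by linarith)
    have : 0 < t * v * (1 - s) := mul_pos (mul_pos ht0 hv0) (by linarith)
    linarith
  have h3 : 2 < cross a b + cross b c + cross a c := by
    rw [hab, hbc, hac]
    nlinarith
  have h4 := volume_hexagon_le hconv hsymm ha hb hc
    (by rw [hac]; nlinarith) (by rw [hac] at h3 ⊢; linarith)
  have h5 := (ENNReal.ofReal_le_ofReal_iff (by norm_num)).1 (h4.trans h2)
  linarith

/-- Among the nonzero integer vectors there is one minimizing the support function. -/
lemma exists_min_support {B : Set (Fin 2 → ℝ)} (hcomp : IsCompact B)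
    (hint : (interior B).Nonempty) (hsymm : B = -B) :
    ∃ m : Fin 2 → ℤ, m ≠ 0 ∧ ∃ a ∈ B, (∀ x ∈ B, ∑ i, (m i : ℝ) * x i ≤ ∑ i, (m i : ℝ) * a i) ∧
      ∀ n : Fin 2 → ℤ, n ≠ 0 → ∃ x ∈ B, ∑ i, (m i : ℝ) * a i ≤ ∑ i, (n i : ℝ) * x i := by
  have hneg : ∀ {x}, x ∈ B → -x ∈ B := fun {x} hx => by
    rw [hsymm] at hx
    exact hx
  have hmax : ∀ m : Fin 2 → ℤ, ∃ a ∈ B, ∀ x ∈ B,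
      ∑ i, (m i : ℝ) * x i ≤ ∑ i, (m i : ℝ) * a i := fun m =>
    hcomp.exists_isMaxOn (f := fun x : Fin 2 → ℝ => ∑ i, (m i : ℝ) * x i)
      (hint.mono interior_subset) (by fun_prop)
  choose f hfB hf using hmax
  set h : (Fin 2 → ℤ) → ℝ := fun m => ∑ i, (m i : ℝ) * f m i
  obtain ⟨z, hz⟩ := hint
  obtain ⟨r, hr, hball⟩ := Metric.isOpen_iff.1 isOpen_interior z hz
  have hcoord : ∀ (m : Fin 2 → ℤ) (j : Fin 2), r / 2 * |(m j : ℝ)| ≤ h m := by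
    intro m j
    have hmem : ∀ y : ℝ, |y| = r / 2 → z + Pi.single j y ∈ B := by
      intro y hy
      refine interior_subset (hball ?_)
      rw [mem_ball_iff_norm, add_sub_cancel_left, Pi.norm_single, Real.norm_eq_abs, hy]
      linarith
    have hw : ∀ y : ℝ, |y| = r / 2 → y * m j ≤ h m := by
      intro y hy
      have h2 := hf m _ (hmem y hy)
      have h3 := hf m _ (hneg (hmem (-y) (by rwa [abs_neg])))
      have h4 : ∀ y : ℝ, ∑ i, (m i : ℝ) * (Pi.single j y : Fin 2 → ℝ) i = m j * y := fun y => by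
        simp [Pi.single_apply]
      simp only [Pi.add_apply, Pi.neg_apply, mul_add, mul_neg, Finset.sum_add_distrib,
        Finset.sum_neg_distrib, neg_add] at h2 h3
      rw [h4] at h2 h3
      have h5 : h m = ∑ i, (m i : ℝ) * f m i := rfl
      linarith
    rcases abs_cases (m j : ℝ) with ⟨h1, _⟩ | ⟨h1, _⟩
    · rw [h1]
      exact hw (r / 2) (abs_of_pos (by linarith))
    · rw [h1]
      simpa using hw (-(r / 2)) (by rw [abs_neg]; exact abs_of_pos (by linarith))
  have hfin : ∀ K : ℝ, {m : Fin 2 → ℤ | m ≠ 0 ∧ h m ≤ K}.Finite := by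
    intro K
    refine (Set.finite_Icc (fun _ => -⌈K / (r / 2)⌉ : Fin 2 → ℤ)
      (fun _ => ⌈K / (r / 2)⌉)).subset ?_
    rintro m ⟨-, hm⟩
    have hj : ∀ j, |m j| ≤ ⌈K / (r / 2)⌉ := fun j => by
      have h1 : |(m j : ℝ)| ≤ K / (r / 2) := by
        rw [le_div_iff₀ (by linarith)]
        linarith [hcoord m j]
      exact_mod_cast h1.trans (Int.le_ceil _)
    exact ⟨fun j => (abs_le.1 (hj j)).1, fun j => (abs_le.1 (hj j)).2⟩
  obtain ⟨m, ⟨hm0, hm1⟩, hm2⟩ := Set.exists_min_image _ h (hfin (h 1))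
    ⟨1, one_ne_zero, le_rfl⟩
  refine ⟨m, hm0, f m, hfB m, hf m, fun n hn => ⟨f n, hfB n, ?_⟩⟩
  rcases le_total (h n) (h 1) with h1 | h1
  · exact hm2 n ⟨hn, h1⟩
  · exact hm1.trans h1

lemma exists_cross_ge_one_or_volume_gt_of_unavoidable {B : Set (Fin 2 → ℝ)} (hcomp : IsCompact B)
    (hconv : Convex ℝ B) (hint : (interior B).Nonempty) (hsymm : B = -B)
    (hline : ∀ m : Fin 2 → ℤ, m ≠ 0 → ∃ x ∈ B, ∑ i, (m i : ℝ) * x i = 1) :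
    (∃ p ∈ B, ∃ q ∈ B, 1 ≤ |cross p q|) ∨ ENNReal.ofReal 2 < volume B := by
  have hneg : ∀ {x}, x ∈ B → -x ∈ B := fun {x} hx => by
    rw [hsymm] at hx
    exact hx
  obtain ⟨m, hm0, a, ha, hamax, hmin⟩ := exists_min_support hcomp hint hsymm
  simp only [Fin.sum_univ_two] at hline hamax hmin
  set μ : ℝ := m 0 * a 0 + m 1 * a 1 with hμ
  have hμ1 : 1 ≤ μ := by
    obtain ⟨x, hx, hx1⟩ := hline m hm0
    linarith [hamax x hx]
  have h0 : (0 : Fin 2 → ℝ) ∈ B := by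
    have := hconv ha (hneg ha) (a := 1 / 2) (b := 1 / 2) (by norm_num) (by norm_num) (by norm_num)
    simpa using this
  have hscale : ∀ {x}, x ∈ B → ∀ {y : ℝ}, 1 ≤ y → y⁻¹ • x ∈ B := fun hx y hy =>
    hconv.smul_mem_of_zero_mem h0 hx ⟨by positivity, inv_le_one_of_one_le₀ hy⟩
  have hpt : ∀ n : Fin 2 → ℤ, n ≠ 0 → ∃ x ∈ B, n 0 * x 0 + n 1 * x 1 = 1 ∧
      m 0 * x 0 + m 1 * x 1 ≤ 1 ∧ -1 ≤ m 0 * x 0 + m 1 * x 1 := by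
    intro n hn
    obtain ⟨x, hx, hx1⟩ := hmin n hn
    set y : ℝ := n 0 * x 0 + n 1 * x 1 with hy
    have hy0 : 0 < y := by linarith
    refine ⟨y⁻¹ • x, hscale hx (by linarith), ?_⟩
    have e : ∀ α β : ℝ, α * (y⁻¹ • x) 0 + β * (y⁻¹ • x) 1 = (α * x 0 + β * x 1) / y :=
      fun α β => by
        simp only [Pi.smul_apply, smul_eq_mul]
        ring
    rw [e, e, ← hy, div_self hy0.ne', div_le_one hy0, le_div_iff₀ hy0]
    have h1 := hamax x hx
    have h2 := hamax _ (hneg hx)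
    simp only [Pi.neg_apply] at h2
    exact ⟨rfl, by linarith, by linarith⟩
  have hcop : IsCoprime (m 0) (m 1) := by
    obtain ⟨k, hk0⟩ := Int.gcd_dvd_left (m 0) (m 1)
    obtain ⟨l, hl0⟩ := Int.gcd_dvd_right (m 0) (m 1)
    rw [Int.isCoprime_iff_gcd_eq_one]
    set d := Int.gcd (m 0) (m 1)
    have hkl : ![k, l] ≠ 0 := by
      intro h
      have hk : k = 0 := congrFun h 0
      have hl : l = 0 := congrFun h 1
      refine hm0 (funext fun i => ?_)
      fin_cases i
      · simpa [hk] using hk0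
      · simpa [hl] using hl0
    obtain ⟨x, hx, hx1, hx2, -⟩ := hpt _ hkl
    have hd1 : (d : ℝ) ≤ 1 := by
      have hk' : (m 0 : ℝ) = d * k := by exact_mod_cast hk0
      have hl' : (m 1 : ℝ) = d * l := by exact_mod_cast hl0
      rw [hk', hl'] at hx2
      simp only [Matrix.cons_val_zero, Matrix.cons_val_one] at hx1
      calc (d : ℝ) = d * (k * x 0 + l * x 1) := by rw [hx1, mul_one]
        _ = d * k * x 0 + d * l * x 1 := by ring
        _ ≤ 1 := hx2
    have hd0 : d ≠ 0 := fun h => by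
      rw [h] at hk0 hl0
      refine hm0 (funext fun i => ?_)
      fin_cases i
      · simpa using hk0
      · simpa using hl0
    have : d ≤ 1 := by exact_mod_cast hd1
    omega
  obtain ⟨u, w, huw⟩ := hcop
  set k : ℤ := ⌊(-w * a 0 + u * a 1) / μ⌋ with hk
  have hμ0 : 0 < μ := by linarith
  set n : Fin 2 → ℤ := ![-w - k * m 0, u - k * m 1] with hn
  have hdet : m 0 * n 1 - m 1 * n 0 = 1 := by
    simp only [hn, Matrix.cons_val_zero, Matrix.cons_val_one]
    linear_combination huw
  have hn0 : n ≠ 0 := fun h => by simp [h] at hdet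
  have hnm0 : n - m ≠ 0 := fun h => by
    rw [sub_eq_zero.1 h, mul_comm] at hdet
    simp at hdet
  have hdetR : (m 0 * n 1 - m 1 * n 0 : ℝ) = 1 := by exact_mod_cast hdet
  have hcross : ∀ p q : Fin 2 → ℝ, cross p q =
      (m 0 * p 0 + m 1 * p 1) * (n 0 * q 0 + n 1 * q 1)
        - (m 0 * q 0 + m 1 * q 1) * (n 0 * p 0 + n 1 * p 1) := fun p q => by
    unfold cross
    linear_combination -(p 0 * q 1 - p 1 * q 0) * hdetR
  obtain ⟨b, hb, hb1, hb2, -⟩ := hpt n hn0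
  obtain ⟨c, hc, hc1, -, hc2⟩ := hpt (n - m) hnm0
  have hXa : (m 0 * (μ⁻¹ • a) 0 + m 1 * (μ⁻¹ • a) 1 : ℝ) = 1 := by
    simp only [Pi.smul_apply, smul_eq_mul]
    calc _ = μ / μ := by rw [hμ]; ring
      _ = 1 := div_self hμ0.ne'
  have hYa : (n 0 * (μ⁻¹ • a) 0 + n 1 * (μ⁻¹ • a) 1 : ℝ)
      = Int.fract ((-w * a 0 + u * a 1) / μ) := by
    simp only [Pi.smul_apply, smul_eq_mul] at hXa ⊢
    simp only [hn, Matrix.cons_val_zero, Matrix.cons_val_one, Int.fract, ← hk]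
    push_cast
    linear_combination -(k : ℝ) * hXa
  simp only [Pi.sub_apply, Int.cast_sub] at hc1
  set s : ℝ := m 0 * b 0 + m 1 * b 1
  have hYc : (n 0 * c 0 + n 1 * c 1 : ℝ) = 1 + (m 0 * c 0 + m 1 * c 1) := by linarith
  refine exists_cross_ge_one_or_volume_gt hconv hsymm (hscale ha hμ1) hb hc
    (Int.fract_nonneg _) (Int.fract_lt_one ((-w * a 0 + u * a 1) / μ)) (s := s)
    (v := -(m 0 * c 0 + m 1 * c 1)) hb2 (by linarith) ?_ ?_ ?_
  · rw [hcross, hXa, hYa, hb1]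
    ring
  · rw [hcross, hYc, hb1]
    ring
  · rw [hcross, hXa, hYa, hYc]
    ring

end IntegerLines

open IntegerLines in
/-- A `0`-symmetric convex body in the plane that intersects every integer
line `m₁x₁ + m₂x₂ = 1` has area at least `2`, with equality only for parallelograms. -/
theorem stmt_11 (B : Set (Fin 2 → ℝ))
    (hB_compact : IsCompact B) (hB_convex : Convex ℝ B)
    (hB_int : (interior B).Nonempty) (hB_symm : B = -B)
    (hB_unavoidable : ∀ m : Fin 2 → ℤ, m ≠ 0 →
      ∃ x ∈ B, ∑ i, (m i : ℝ) * x i = 1) :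
    ENNReal.ofReal 2 ≤ volume B ∧
      (volume B = ENNReal.ofReal 2 →
        ∃ L : (Fin 2 → ℝ) ≃ᵃ[ℝ] (Fin 2 → ℝ),
          B = L '' Set.Icc (fun _ => (-1 : ℝ)) (fun _ => (1 : ℝ))) := by
  rcases exists_cross_ge_one_or_volume_gt_of_unavoidable hB_compact hB_convex hB_int hB_symm
    hB_unavoidable with ⟨p, hp, q, hq, hpq⟩ | hlt
  · have hsub := ofColumns_square_subset hB_convex hB_symm hp hq
    have hvol := volume_ofColumns_square p q
    have hle : ENNReal.ofReal 2 ≤ ENNReal.ofReal (2 * |cross p q|) :=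
      ENNReal.ofReal_le_ofReal (by linarith)
    refine ⟨(hle.trans_eq hvol.symm).trans (measure_mono hsub), fun hB => ?_⟩
    have hdet : LinearMap.det (ofColumns ((1 / 2 : ℝ) • (p + q)) ((1 / 2 : ℝ) • (p - q))) ≠ 0 := by
      have h0 : cross p q ≠ 0 := abs_pos.1 (by linarith)
      rw [det_ofColumns, cross_half_add_half_sub]
      simpa using h0
    refine ⟨(LinearMap.equivOfDetNeZero _ hdet).toAffineEquiv, ?_⟩
    exact eq_of_subset_of_volume_le hB_convex hB_int
      (isCompact_Icc.image (LinearMap.continuous_of_finiteDimensional _)) hsub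
      ((hB.le.trans hle).trans_eq hvol.symm)
  · exact ⟨hlt.le, fun hB => absurd hB hlt.ne'⟩
end

section
/- Let c > 0 be a constant such that cⁿ · (n+1)/n! ≤ |K| · Δ(K*) for every convex body K ⊂ ℝⁿ containing the origin in its interior. Then (c/e)ⁿ · (n+1)^{n+1}/(n!)² ≤ |K| · |K*| for every convex body K ⊂ ℝⁿ containing the origin in its interior. -/
open MeasureTheory

lemma critDet_le_abs_det {n : ℕ} {L : Set (Fin n → ℝ)} (A : (Fin n → ℝ) →ₗ[ℝ] (Fin n → ℝ))
    (hA : LinearMap.det A ≠ 0)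
    (hL : ∀ m : Fin n → ℤ, A (fun i => (m i : ℝ)) ∈ L → m = 0) :
    critDet n L ≤ |LinearMap.det A| := by
  refine csInf_le ⟨0, ?_⟩ ⟨A, (LinearMap.equivOfDetNeZero A hA).bijective,
    fun m hm => hL m (interior_subset hm), rfl⟩
  rintro _ ⟨B, -, -, rfl⟩
  exact abs_nonneg _

lemma convex_polarBody (n : ℕ) (K : Set (Fin n → ℝ)) : Convex ℝ (polarBody n K) := by
  intro ξ hξ η hη a b ha hb hab x hx
  have h1 := hξ x hx
  have h2 := hη x hx
  have : ∑ i, (a • ξ + b • η) i * x i = a * ∑ i, ξ i * x i + b * ∑ i, η i * x i := by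
    simp only [Finset.mul_sum, ← Finset.sum_add_distrib]
    refine Finset.sum_congr rfl fun i _ => ?_
    simp
    ring
  rw [this]
  nlinarith

lemma isClosed_polarBody (n : ℕ) (K : Set (Fin n → ℝ)) : IsClosed (polarBody n K) := by
  have : polarBody n K = ⋂ x ∈ K, {ξ : Fin n → ℝ | ∑ i, ξ i * x i ≤ 1} := by
    ext ξ
    simp [polarBody]
  rw [this]
  exact isClosed_biInter fun x _ => isClosed_le (by fun_prop) continuous_const

lemma zero_mem_polarBody (n : ℕ) (K : Set (Fin n → ℝ)) : (0 : Fin n → ℝ) ∈ polarBody n K := by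
  intro x _
  simp

lemma isBounded_polarBody {n : ℕ} {K : Set (Fin n → ℝ)} (hK : (0 : Fin n → ℝ) ∈ interior K) :
    Bornology.IsBounded (polarBody n K) := by
  obtain ⟨r, hr, hrK⟩ := Metric.mem_nhds_iff.mp (mem_interior_iff_mem_nhds.mp hK)
  have hmem : ∀ (i : Fin n) (t : ℝ), |t| < r → Pi.single i t ∈ K := fun i t ht => by
    apply hrK
    rw [mem_ball_zero_iff, pi_norm_lt_iff hr]
    intro j
    by_cases hj : j = i
    · subst hj
      simpa using ht
    · simpa [hj] using hr
  refine (Metric.isBounded_iff_subset_closedBall 0).mpr ⟨2 / r, fun ξ hξ => ?_⟩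
  rw [mem_closedBall_zero_iff, pi_norm_le_iff_of_nonneg (by positivity)]
  intro i
  have h1 := hξ _ (hmem i (r / 2) (by rw [abs_of_pos (by positivity)]; linarith))
  have h2 := hξ _ (hmem i (-(r / 2)) (by rw [abs_neg, abs_of_pos (by positivity)]; linarith))
  simp only [Pi.single_apply, mul_ite, mul_zero, Finset.sum_ite_eq', Finset.mem_univ, if_true]
    at h1 h2
  rw [Real.norm_eq_abs, abs_le, ← neg_div, div_le_iff₀ hr, le_div_iff₀ hr]
  constructor <;> linarith

/-- The lattice basis with columns `(1, v)` and `p eᵢ`, for `i ≠ 0`. -/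
def congruenceMatrix {k : ℕ} (p : ℝ) (v : Fin k → ℝ) : Matrix (Fin (k + 1)) (Fin (k + 1)) ℝ :=
  Matrix.of fun i j => if j = 0 then (Fin.cons 1 v : Fin (k + 1) → ℝ) i else if i = j then p else 0

lemma det_congruenceMatrix {k : ℕ} (p : ℝ) (v : Fin k → ℝ) :
    (congruenceMatrix p v).det = p ^ k := by
  have hT : (congruenceMatrix p v).BlockTriangular OrderDual.toDual := by
    intro i j hij
    have hij : i < j := hij
    simp [congruenceMatrix, (Fin.pos_of_ne_zero (Fin.ne_zero_of_lt hij)).ne', hij.ne]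
  rw [Matrix.det_of_isLowerTriangular _ hT, Fin.prod_univ_succ]
  simp [congruenceMatrix]

lemma congruenceMatrix_mulVec_zero {k : ℕ} (p : ℝ) (v : Fin k → ℝ) (m : Fin (k + 1) → ℝ) :
    (congruenceMatrix p v).mulVec m 0 = m 0 := by
  simp [congruenceMatrix, Matrix.mulVec, dotProduct, Fin.sum_univ_succ, (Fin.succ_ne_zero _).symm]

lemma congruenceMatrix_mulVec_succ {k : ℕ} (p : ℝ) (v : Fin k → ℝ) (m : Fin (k + 1) → ℝ)
    (i : Fin k) :
    (congruenceMatrix p v).mulVec m i.succ = m 0 * v i + p * m i.succ := by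
  simp [congruenceMatrix, Matrix.mulVec, dotProduct, Fin.sum_univ_succ, mul_comm]

open scoped Pointwise in
lemma tendsto_card_inter_smul_lattice {n : ℕ} {L : Set (Fin n → ℝ)}
    (hb : Bornology.IsBounded L) (hc : Convex ℝ L) (hcl : IsClosed L)
    (h0 : (0 : Fin n → ℝ) ∈ L) :
    Filter.Tendsto (fun x : ℝ => (Nat.card
      {y : Fin n → ℝ // y ∈ L ∧ ∃ z : Fin n → ℤ, y = fun i => x⁻¹ * z i} : ℝ) / x ^ n)
      Filter.atTop (nhds (volume.real L)) := by
  have key := tendsto_card_div_pow_atTop_volume' L hb hcl.measurableSet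
    (hc.addHaar_frontier volume) (fun x y hx hxy => by
      rintro _ ⟨a, ha, rfl⟩
      have hy : 0 < y := hx.trans_le hxy
      refine ⟨(x / y) • a, hc.smul_mem_of_zero_mem h0 ha
        ⟨by positivity, (div_le_one hy).mpr hxy⟩, ?_⟩
      simp only [smul_smul]
      rw [mul_div_cancel₀ _ hy.ne'])
  rw [Fintype.card_fin] at key
  refine key.congr fun x => ?_
  congr 2
  refine Nat.card_congr (Equiv.subtypeEquivRight fun y => ?_)
  refine and_congr_right fun _ => ?_
  rw [Set.mem_smul_set]
  constructor
  · rintro ⟨w, hw, rfl⟩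
    have hw' := ((Pi.basisFun ℝ (Fin n)).mem_span_iff_repr_mem ℤ w).mp hw
    choose z hz using hw'
    refine ⟨z, funext fun i => ?_⟩
    have := hz i
    simp at this
    simp [this]
  · rintro ⟨z, rfl⟩
    refine ⟨fun i => z i, ((Pi.basisFun ℝ (Fin n)).mem_span_iff_repr_mem ℤ _).mpr fun i => ?_, ?_⟩
    · exact ⟨z i, by simp⟩
    · ext i
      simp

lemma finite_inter_smul_lattice {n : ℕ} {L : Set (Fin n → ℝ)}
    (hb : Bornology.IsBounded L) {x : ℝ} (hx : 0 < x) :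
    Finite {y : Fin n → ℝ // y ∈ L ∧ ∃ z : Fin n → ℤ, y = fun i => x⁻¹ * z i} := by
  obtain ⟨R, hR⟩ := (Metric.isBounded_iff_subset_closedBall 0).mp hb
  have hfin : (Set.Icc (fun _ : Fin n => -⌈x * R⌉) (fun _ => ⌈x * R⌉)).Finite := Set.finite_Icc _ _
  refine ((hfin.image fun (z : Fin n → ℤ) (i : Fin n) => x⁻¹ * (z i : ℝ)).subset ?_).to_subtype
  rintro _ ⟨hy, z, rfl⟩
  refine ⟨z, ?_, rfl⟩
  have hz : ∀ i, |(z i : ℝ)| ≤ x * R := fun i => by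
    have h1 := (norm_le_pi_norm _ i).trans (mem_closedBall_zero_iff.mp (hR hy))
    rw [Real.norm_eq_abs, abs_mul, abs_of_pos (inv_pos.mpr hx), inv_mul_le_iff₀ hx] at h1
    exact h1
  constructor <;> intro i
  · have := (abs_le.mp ((hz i).trans (Int.le_ceil _))).1
    exact_mod_cast this
  · have := (abs_le.mp ((hz i).trans (Int.le_ceil _))).2
    exact_mod_cast this

/-- If the scaled integer lattice has fewer than `p ^ k` points in `L`, then some sublattice of
index `p ^ k` meets `L` only at the origin. -/
lemma critDet_le_of_card_lt {k p : ℕ} [Fact p.Prime] {L : Set (Fin (k + 1) → ℝ)} {x R : ℝ}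
    (hb : L ⊆ Metric.closedBall 0 R) (hx : 0 < x) (hpx : x * R < p)
    (hcard : Nat.card {y : Fin (k + 1) → ℝ // y ∈ L ∧ ∃ z : Fin (k + 1) → ℤ,
      y = fun i => x⁻¹ * z i} < p ^ k) :
    critDet (k + 1) L ≤ (p : ℝ) ^ k / x ^ (k + 1) := by
  have hp : (0 : ℝ) < p := by exact_mod_cast (Fact.out : p.Prime).pos
  have hfin := finite_inter_smul_lattice (Metric.isBounded_closedBall.subset hb) hx
  obtain ⟨u, hu⟩ : ∃ u : Fin k → ZMod p, ∀ z : Fin (k + 1) → ℤ,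
      (fun i => x⁻¹ * (z i : ℝ)) ∈ L → (∀ i : Fin k, (z i.succ : ZMod p) = z 0 * u i) →
      (z 0 : ZMod p) = 0 := by
    by_contra! hcon
    choose z hzL hzu hz0 using hcon
    refine hcard.not_ge ?_
    have hinj : Function.Injective (fun u : Fin k → ZMod p =>
        (⟨fun i => x⁻¹ * (z u i : ℝ), hzL u, z u, rfl⟩ :
          {y : Fin (k + 1) → ℝ // y ∈ L ∧ ∃ z : Fin (k + 1) → ℤ, y = fun i => x⁻¹ * z i})) := by
      intro u v huv
      have hz : z u = z v := funext fun i => by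
        have := congrFun (Subtype.ext_iff.mp huv) i
        exact_mod_cast mul_left_cancel₀ (inv_ne_zero hx.ne') this
      funext i
      have h1 := hzu u i
      rw [hz, hzu v i] at h1
      exact (mul_left_cancel₀ (hz0 v) h1).symm
    simpa [Nat.card_eq_fintype_card] using Nat.card_le_card_of_injective _ hinj
  have hdet : LinearMap.det (x⁻¹ • Matrix.toLin' (congruenceMatrix p fun i => ((u i).val : ℝ))) =
      (p : ℝ) ^ k / x ^ (k + 1) := by
    rw [LinearMap.det_smul, LinearMap.det_toLin', det_congruenceMatrix]
    simp
    field_simp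
  have hpos : 0 < (p : ℝ) ^ k / x ^ (k + 1) := by positivity
  rw [← abs_of_pos hpos, ← hdet]
  refine critDet_le_abs_det _ (hdet ▸ hpos.ne') fun m hm => ?_
  set z : Fin (k + 1) → ℤ := Fin.cons (m 0) fun i => m 0 * ((u i).val : ℤ) + p * m i.succ with hz
  have hzL : (fun i => x⁻¹ * (z i : ℝ)) ∈ L := by
    convert! hm using 1
    funext i
    rw [LinearMap.smul_apply, Pi.smul_apply, Matrix.toLin'_apply, smul_eq_mul]
    congr 1
    refine Fin.cases ?_ (fun i => ?_) i
    · rw [congruenceMatrix_mulVec_zero]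
      simp [hz]
    · rw [congruenceMatrix_mulVec_succ]
      simp [hz]
  have hz0 : (z 0 : ZMod p) = 0 := hu z hzL fun i => by
    simp [hz]
  have hzdvd : ∀ i, (p : ℤ) ∣ z i := by
    have h0 : (p : ℤ) ∣ m 0 := (ZMod.intCast_zmod_eq_zero_iff_dvd _ _).mp hz0
    intro i
    refine Fin.cases ?_ (fun i => ?_) i
    · simpa [hz] using h0
    · rw [hz, Fin.cons_succ]
      exact dvd_add (h0.mul_right _) (dvd_mul_right _ _)
  have hzzero : ∀ i, z i = 0 := fun i => by
    refine Int.eq_zero_of_abs_lt_dvd (hzdvd i) ?_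
    have h1 := (norm_le_pi_norm _ i).trans (mem_closedBall_zero_iff.mp (hb hzL))
    rw [Real.norm_eq_abs, abs_mul, abs_of_pos (inv_pos.mpr hx), inv_mul_le_iff₀ hx] at h1
    have := h1.trans_lt hpx
    exact_mod_cast this
  have hm0 : m 0 = 0 := by simpa [hz] using hzzero 0
  funext i
  refine Fin.cases hm0 (fun i => ?_) i
  have := hzzero i.succ
  simpa [hz, hm0, (Fact.out : p.Prime).ne_zero] using this

open Filter in
lemma critDet_le_volume_of_two_le {k : ℕ} (hk : k ≠ 0) {L : Set (Fin (k + 1) → ℝ)}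
    (hb : Bornology.IsBounded L) (hc : Convex ℝ L) (hcl : IsClosed L)
    (h0 : (0 : Fin (k + 1) → ℝ) ∈ L) :
    critDet (k + 1) L ≤ volume.real L := by
  refine le_of_forall_gt_imp_ge_of_dense fun d hd => ?_
  have hd0 : 0 < d := measureReal_nonneg.trans_lt hd
  obtain ⟨R, hR⟩ := (Metric.isBounded_iff_subset_closedBall 0).mp hb
  set x : ℕ → ℝ := fun p => ((p : ℝ) ^ k / d) ^ ((1 : ℝ) / ((k + 1 : ℕ) : ℝ)) with hxdef
  have hxpow : ∀ p, x p ^ (k + 1) = (p : ℝ) ^ k / d := fun p => by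
    rw [hxdef]
    simp only
    rw [one_div, Real.rpow_inv_natCast_pow (by positivity) (Nat.succ_ne_zero k)]
  have hxtop : Tendsto x atTop atTop :=
    (tendsto_rpow_atTop (by positivity)).comp
      (((tendsto_pow_atTop hk).comp tendsto_natCast_atTop_atTop).atTop_div_const hd0)
  have hcount := hxtop.eventually
    ((tendsto_card_inter_smul_lattice hb hc hcl h0).eventually_lt_const hd)
  have hlarge := tendsto_natCast_atTop_atTop.eventually_gt_atTop (|R| ^ (k + 1) / d)
  obtain ⟨N, hN⟩ := eventually_atTop.mp
    (hcount.and (hlarge.and (hxtop.eventually_gt_atTop 0)))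
  obtain ⟨p, hpN, hp⟩ := Nat.exists_infinite_primes N
  obtain ⟨h1, h2, hx⟩ := hN p hpN
  have := Fact.mk hp
  have hp0 : (0 : ℝ) < p := by exact_mod_cast hp.pos
  have hfinal := critDet_le_of_card_lt (p := p) hR hx ?_ ?_
  · rwa [hxpow, div_div_cancel₀ (by positivity)] at hfinal
  · refine (mul_le_mul_of_nonneg_left (le_abs_self R) hx.le).trans_lt ?_
    refine lt_of_pow_lt_pow_left₀ (k + 1) hp0.le ?_
    rw [mul_pow, hxpow, pow_succ (p : ℝ)]
    rw [div_lt_iff₀ hd0] at h2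
    rw [div_mul_eq_mul_div, div_lt_iff₀ hd0, mul_assoc]
    gcongr
  · rw [div_lt_iff₀ (by positivity), hxpow, mul_div_cancel₀ _ hd0.ne'] at h1
    exact_mod_cast h1

lemma critDet_one_le_volume {L : Set (Fin 1 → ℝ)} (hb : Bornology.IsBounded L)
    (hc : Convex ℝ L) (h0 : (0 : Fin 1 → ℝ) ∈ L) :
    critDet 1 L ≤ volume.real L := by
  refine le_of_forall_gt_imp_ge_of_dense fun d hd => ?_
  have hd0 : 0 < d := measureReal_nonneg.trans_lt hd
  have hdet : LinearMap.det (d • (LinearMap.id : (Fin 1 → ℝ) →ₗ[ℝ] (Fin 1 → ℝ))) = d := by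
    simp
  refine (critDet_le_abs_det (d • LinearMap.id) (by rw [hdet]; exact hd0.ne') fun m hm => ?_).trans
    (by rw [hdet, abs_of_pos hd0])
  by_contra hne
  have hm0 : m 0 ≠ 0 := fun h => hne (funext fun i => by rw [Subsingleton.elim i 0, h]; rfl)
  have hm1 : (1 : ℝ) ≤ |(m 0 : ℝ)| := by exact_mod_cast Int.one_le_abs hm0
  have hseg : Set.pi Set.univ (fun _ : Fin 1 => Set.uIcc 0 (d * (m 0 : ℝ))) ⊆ L := by
    intro y hy
    have hy0 : y 0 ∈ segment ℝ 0 (d * (m 0 : ℝ)) := by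
      rw [segment_eq_uIcc]
      exact hy 0 trivial
    obtain ⟨a, b, ha, hb, hab, hy0⟩ := hy0
    convert! hc h0 hm ha hb hab using 1
    funext i
    rw [Subsingleton.elim i 0, ← hy0]
    simp
  have hvol : volume.real (Set.pi Set.univ (fun _ : Fin 1 => Set.uIcc 0 (d * (m 0 : ℝ)))) =
      d * |(m 0 : ℝ)| := by
    rw [measureReal_def, volume_pi_pi]
    simp [Real.volume_interval, abs_mul, abs_of_pos hd0, hd0.le]
  have hle := measureReal_mono (μ := volume) hseg hb.measure_lt_top.ne
  rw [hvol] at hle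
  nlinarith

lemma critDet_zero_le_volume {L : Set (Fin 0 → ℝ)} (h0 : (0 : Fin 0 → ℝ) ∈ L) :
    critDet 0 L ≤ volume.real L := by
  have hL : L = Set.univ := Set.eq_univ_of_forall fun y => by rwa [Subsingleton.elim y 0]
  have hA := critDet_le_abs_det (L := L) LinearMap.id (by simp) fun m _ => Subsingleton.elim m 0
  have hvol : volume.real L = 1 := by
    rw [hL, ← Set.pi_univ Set.univ, measureReal_def, volume_pi_pi]
    simp
  simpa [hvol] using hA

/-- A Minkowski–Hlawka bound: the critical determinant is at most the volume. -/
theorem critDet_le_volume {n : ℕ} {L : Set (Fin n → ℝ)} (hb : Bornology.IsBounded L)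
    (hc : Convex ℝ L) (hcl : IsClosed L) (h0 : (0 : Fin n → ℝ) ∈ L) :
    critDet n L ≤ volume.real L := by
  match n, L, hb, hc, hcl, h0 with
  | 0, _, _, _, _, h0 => exact critDet_zero_le_volume h0
  | 1, _, hb, hc, _, h0 => exact critDet_one_le_volume hb hc h0
  | k + 2, _, hb, hc, hcl, h0 => exact critDet_le_volume_of_two_le k.succ_ne_zero hb hc hcl h0

lemma succ_pow_le_exp_pow_mul_factorial (n : ℕ) :
    ((n : ℝ) + 1) ^ n ≤ Real.exp 1 ^ n * n.factorial := by
  induction n with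
  | zero => simp
  | succ n ih =>
    have h1 : (1 + ((n + 1 : ℕ) : ℝ)⁻¹) ^ (n + 1) ≤ Real.exp 1 := Real.one_add_inv_pow_le_exp
    have h2 : (((n + 1 : ℕ) : ℝ) + 1) ^ (n + 1) =
        (1 + ((n + 1 : ℕ) : ℝ)⁻¹) ^ (n + 1) * ((n + 1) * ((n : ℝ) + 1) ^ n) := by
      rw [← pow_succ', Nat.cast_succ, ← mul_pow]
      congr 1
      field_simp
    rw [h2, Nat.factorial_succ, pow_succ]
    push_cast
    calc _ ≤ Real.exp 1 * ((n + 1) * (Real.exp 1 ^ n * n.factorial)) := by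
          rw [Nat.cast_succ] at h1
          refine mul_le_mul h1 ?_ (by positivity) (by positivity)
          gcongr
      _ = _ := by ring

/-- If `cⁿ (n+1)/n! ≤ |K| Δ(K*)` for every convex body `K ⊆ ℝⁿ` with the
origin in its interior, then `(c/e)ⁿ (n+1)^{n+1}/(n!)² ≤ |K||K*|` for every such body. -/
theorem stmt_12 (n : ℕ) (c : ℝ) (hc : 0 < c)
    (h : ∀ K : Set (Fin n → ℝ),
      IsCompact K → Convex ℝ K → (0 : Fin n → ℝ) ∈ interior K →
      c ^ n * (n + 1) / n.factorial ≤ (volume K).toReal * critDet n (polarBody n K)) :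
    ∀ K : Set (Fin n → ℝ),
      IsCompact K → Convex ℝ K → (0 : Fin n → ℝ) ∈ interior K →
      (c / Real.exp 1) ^ n * (n + 1) ^ (n + 1) / (n.factorial : ℝ) ^ 2 ≤
        (volume K).toReal * (volume (polarBody n K)).toReal := by
  intro K hKc hKconv hK0
  have hmain := h K hKc hKconv hK0
  have hcrit := critDet_le_volume (isBounded_polarBody hK0) (convex_polarBody n K)
    (isClosed_polarBody n K) (zero_mem_polarBody n K)
  refine le_trans ?_ (hmain.trans (mul_le_mul_of_nonneg_left hcrit ENNReal.toReal_nonneg))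
  have hf : (0 : ℝ) < n.factorial := by exact_mod_cast n.factorial_pos
  rw [div_pow, div_le_div_iff₀ (by positivity) hf, div_mul_eq_mul_div, div_mul_eq_mul_div,
    div_le_iff₀ (by positivity)]
  calc c ^ n * ((n : ℝ) + 1) ^ (n + 1) * n.factorial
      = c ^ n * (n + 1) * n.factorial * ((n : ℝ) + 1) ^ n := by ring
    _ ≤ c ^ n * (n + 1) * n.factorial * (Real.exp 1 ^ n * n.factorial) := by
        gcongr
        exact succ_pow_le_exp_pow_mul_factorial n
    _ = _ := by ring
end

section
/- Fix c > 0. For every sequence (K_i) of unavoidable convex bodies in ℝⁿ with |K_i| ≤ c for all i, there exist unimodular transformations T_i of ℝⁿ and a subsequence along which the bodies T_i(K_i) converge in Hausdorff distance to an unavoidable convex body. In other words, the set of unavoidable convex bodies in ℝⁿ of volume at most c is compact modulo unimodular transformations. -/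
open MeasureTheory
open scoped Matrix

/-- Every integer vector is an integer multiple of the first column of a unimodular matrix. -/
theorem exists_unimodular_eq_smul_col (n : ℕ) (m : Fin (n + 1) → ℤ) :
    ∃ (V : Matrix (Fin (n + 1)) (Fin (n + 1)) ℤ) (g : ℤ),
      IsUnit V.det ∧ m = g • V.col 0 := by
  induction hk : ∑ i, (m i).natAbs using Nat.strong_induction_on generalizing m with
  | _ k ih =>
    subst hk
    by_cases h : ∃ i j, i ≠ j ∧ m i ≠ 0 ∧ m j ≠ 0
    · obtain ⟨i, j, hij, hi, hj, hle⟩ : ∃ i j, i ≠ j ∧ m i ≠ 0 ∧ m j ≠ 0 ∧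
          (m j).natAbs ≤ (m i).natAbs := by
        obtain ⟨i, j, hij, hi, hj⟩ := h
        rcases le_total (m j).natAbs (m i).natAbs with h | h
        · exact ⟨i, j, hij, hi, hj, h⟩
        · exact ⟨j, i, hij.symm, hj, hi, h⟩
      obtain ⟨s, hs⟩ : ∃ s : ℤ, (m i - s * m j).natAbs < (m i).natAbs := by
        rcases lt_or_gt_of_ne hi with h1 | h1 <;> rcases lt_or_gt_of_ne hj with h2 | h2
        · exact ⟨1, by omega⟩
        · exact ⟨-1, by omega⟩
        · exact ⟨-1, by omega⟩
        · exact ⟨1, by omega⟩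
      obtain ⟨V, g, hV, hm⟩ := ih _ (by
        refine Finset.sum_lt_sum (f := fun l => (Function.update m i (m i - s * m j) l).natAbs)
          (g := fun l => (m l).natAbs) (fun l _ => ?_) ⟨i, Finset.mem_univ _, ?_⟩
        · by_cases hl : l = i
          · subst hl; simpa using hs.le
          · simp [hl]
        · simpa using hs) (Function.update m i (m i - s * m j)) rfl
      refine ⟨Matrix.transvection i j s * V, g, ?_, ?_⟩
      · rw [Matrix.det_mul, Matrix.det_transvection_of_ne _ _ hij, one_mul]
        exact hV
      · have hcol : (Matrix.transvection i j s * V).col 0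
            = Matrix.transvection i j s *ᵥ V.col 0 := by
          ext l; rfl
        rw [hcol, ← Matrix.mulVec_smul, ← hm, Matrix.transvection, Matrix.add_mulVec,
          Matrix.one_mulVec, Matrix.single_mulVec]
        ext l
        by_cases hl : l = i
        · subst hl; simp [hij.symm]
        · simp [hl]
    · push Not at h
      obtain ⟨i, hi⟩ : ∃ i, ∀ j, j ≠ i → m j = 0 := by
        by_cases h0 : ∃ i, m i ≠ 0
        · obtain ⟨i, hi⟩ := h0
          exact ⟨i, fun j hj => h i j hj.symm hi⟩
        · push Not at h0
          exact ⟨0, fun j _ => h0 j⟩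
      refine ⟨(Equiv.swap 0 i).permMatrix ℤ, m i, ?_, ?_⟩
      · rw [Matrix.det_permutation]
        exact Units.isUnit _
      · ext l
        by_cases hl : l = i
        · subst hl; simp [Matrix.col]
        · simp [Matrix.col, hi l hl, hl]

/-- Determinant of a block triangular matrix whose first column vanishes below the diagonal. -/
theorem det_eq_mul_det_submatrix_succ {n : ℕ} {S : Type*} [CommRing S]
    (A : Matrix (Fin (n + 1)) (Fin (n + 1)) S) (h : ∀ i : Fin n, A i.succ 0 = 0) :
    A.det = A 0 0 * (A.submatrix Fin.succ Fin.succ).det := by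
  rw [Matrix.det_succ_column_zero, Fin.sum_univ_succ]
  simp [h]

/-- The Schur complement of the top left entry of a matrix. -/
noncomputable def pivotComplement {n : ℕ} (N : Matrix (Fin (n + 1)) (Fin (n + 1)) ℝ) :
    Matrix (Fin n) (Fin n) ℝ :=
  Matrix.of fun i j => N i.succ j.succ - N i.succ 0 * N 0 j.succ / N 0 0

theorem det_eq_mul_det_pivotComplement {n : ℕ} (N : Matrix (Fin (n + 1)) (Fin (n + 1)) ℝ)
    (h : N 0 0 ≠ 0) : N.det = N 0 0 * (pivotComplement N).det := by
  let A : Matrix (Fin (n + 1)) (Fin (n + 1)) ℝ :=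
    Matrix.of (Fin.cons (N 0) fun i j => N i.succ j - N i.succ 0 * N 0 j / N 0 0)
  have hA : N.det = A.det := by
    refine Matrix.det_eq_of_forall_row_eq_smul_add_const
      (Fin.cons 0 fun i => N i.succ 0 / N 0 0) 0 (by simp) fun i j => ?_
    refine Fin.cases ?_ (fun i => ?_) i
    · simp [A]
    · simp [A]; ring
  rw [hA, det_eq_mul_det_submatrix_succ A (fun i => by simp [A, h])]
  rfl

theorem le_norm_pivotComplement_mulVec {n : ℕ} (N : Matrix (Fin (n + 1)) (Fin (n + 1)) ℝ)
    (h0 : N 0 0 ≠ 0) (hcol : ∀ i, |N i 0| ≤ |N 0 0|)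
    (hmin : ∀ m : Fin (n + 1) → ℤ, m ≠ 0 → 3 / 4 * |N 0 0| ≤ ‖N *ᵥ fun i => (m i : ℝ)‖)
    (m : Fin n → ℤ) (hm : m ≠ 0) :
    |N 0 0| / 4 ≤ ‖pivotComplement N *ᵥ fun i => (m i : ℝ)‖ := by
  have hpos : 0 < |N 0 0| := abs_pos.2 h0
  by_contra! hlt
  set t : ℝ := (∑ j, N 0 j.succ * m j) / N 0 0 with ht
  set v : Fin (n + 1) → ℤ := Fin.cons (-round t) m with hv
  have hv0 : v ≠ 0 := by
    intro h
    apply hm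
    ext i
    simpa [v] using congrFun h i.succ
  have hround := abs_sub_round t
  have hlt' : ‖N *ᵥ fun i => (v i : ℝ)‖ < 3 / 4 * |N 0 0| := by
    rw [pi_norm_lt_iff (by positivity)]
    intro i
    rw [Real.norm_eq_abs]
    have hmul : ∀ i, |(t - round t) * N i 0| ≤ |N 0 0| / 2 := fun i => by
      rw [abs_mul]
      nlinarith [hcol i, abs_nonneg (N i 0)]
    refine Fin.cases ?_ (fun i => ?_) i
    · have : (N *ᵥ fun i => (v i : ℝ)) 0 = (t - round t) * N 0 0 := by
        simp only [Matrix.mulVec, dotProduct, Fin.sum_univ_succ, v, Fin.cons_zero, Fin.cons_succ]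
        rw [sub_mul, ht, div_mul_cancel₀ _ h0]
        push_cast
        ring
      rw [this]
      linarith [hmul 0]
    · have : (N *ᵥ fun i => (v i : ℝ)) i.succ
          = (pivotComplement N *ᵥ fun i => (m i : ℝ)) i + (t - round t) * N i.succ 0 := by
        simp only [Matrix.mulVec, dotProduct, Fin.sum_univ_succ, v, Fin.cons_zero, Fin.cons_succ,
          pivotComplement, Matrix.of_apply, sub_mul, Finset.sum_sub_distrib]
        have : ∑ j, N i.succ 0 * N 0 j.succ / N 0 0 * (m j : ℝ) = t * N i.succ 0 := by
          rw [ht, Finset.sum_div, Finset.sum_mul]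
          exact Finset.sum_congr rfl fun j _ => by ring
        rw [this]
        push_cast
        ring
      rw [this]
      have h1 := norm_le_pi_norm (pivotComplement N *ᵥ fun i => (m i : ℝ)) i
      rw [Real.norm_eq_abs] at h1
      linarith [abs_add_le ((pivotComplement N *ᵥ fun i => (m i : ℝ)) i)
        ((t - round t) * N i.succ 0), hmul i.succ]
  exact absurd (hmin v hv0) (not_le.2 hlt')

theorem exists_unimodular_lift {n : ℕ} (N : Matrix (Fin (n + 1)) (Fin (n + 1)) ℝ)
    (h0 : N 0 0 ≠ 0) (hcol : ∀ i, |N i 0| ≤ |N 0 0|) (U : Matrix (Fin n) (Fin n) ℤ)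
    (hU : IsUnit U.det) (R : ℝ)
    (hR : ∀ i j, |(pivotComplement N * U.map ((↑) : ℤ → ℝ)) i j| ≤ R) :
    ∃ W : Matrix (Fin (n + 1)) (Fin (n + 1)) ℤ, IsUnit W.det ∧
      ∀ i j, |(N * W.map ((↑) : ℤ → ℝ)) i j| ≤ |R| + |N 0 0| := by
  have hpos : 0 < |N 0 0| := abs_pos.2 h0
  set t : Fin n → ℝ := fun j => (∑ k, N 0 k.succ * U k j) / N 0 0 with ht
  let W : Matrix (Fin (n + 1)) (Fin (n + 1)) ℤ :=
    Matrix.of (Fin.cons (Fin.cons 1 fun j => -round (t j)) fun i => Fin.cons 0 (U i))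
  refine ⟨W, ?_, fun i j => ?_⟩
  · rw [det_eq_mul_det_submatrix_succ W (fun i => by simp [W])]
    have h1 : W 0 0 = 1 := rfl
    have h2 : W.submatrix Fin.succ Fin.succ = U := rfl
    rwa [h1, h2, one_mul]
  · have hmul : ∀ i j, |(t j - round (t j)) * N i 0| ≤ |N 0 0| / 2 := fun i j => by
      rw [abs_mul]
      nlinarith [hcol i, abs_nonneg (N i 0), abs_sub_round (t j)]
    refine Fin.cases ?_ (fun j => ?_) j
    · have : (N * W.map ((↑) : ℤ → ℝ)) i 0 = N i 0 := by
        simp [Matrix.mul_apply, Fin.sum_univ_succ, W]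
      rw [this]
      linarith [hcol i, abs_nonneg R]
    · refine Fin.cases ?_ (fun i => ?_) i
      · have : (N * W.map ((↑) : ℤ → ℝ)) 0 j.succ = (t j - round (t j)) * N 0 0 := by
          simp only [Matrix.mul_apply, Fin.sum_univ_succ, W, Matrix.map_apply, Matrix.of_apply,
            Fin.cons_zero, Fin.cons_succ]
          rw [sub_mul, ht, div_mul_cancel₀ _ h0]
          push_cast
          ring
        rw [this]
        linarith [hmul 0 j, abs_nonneg R]
      · have : (N * W.map ((↑) : ℤ → ℝ)) i.succ j.succ
            = (pivotComplement N * U.map ((↑) : ℤ → ℝ)) i j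
              + (t j - round (t j)) * N i.succ 0 := by
          simp only [Matrix.mul_apply, Fin.sum_univ_succ, W, Matrix.map_apply, Matrix.of_apply,
            Fin.cons_zero, Fin.cons_succ, pivotComplement, sub_mul, Finset.sum_sub_distrib]
          have : ∑ k, N i.succ 0 * N 0 k.succ / N 0 0 * (U k j : ℝ) = t j * N i.succ 0 := by
            rw [show t j = (∑ k, N 0 k.succ * U k j) / N 0 0 from rfl, Finset.sum_div,
              Finset.sum_mul]
            exact Finset.sum_congr rfl fun j _ => by ring
          rw [this]
          push_cast
          ring
        rw [this]
        linarith [abs_add_le ((pivotComplement N * U.map ((↑) : ℤ → ℝ)) i j)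
          ((t j - round (t j)) * N i.succ 0), hmul i.succ j, hR i j, le_abs_self R]

theorem unimodular_mulVec_ne_zero {n : ℕ} (V : Matrix (Fin n) (Fin n) ℤ) (hV : IsUnit V.det)
    (m : Fin n → ℤ) (hm : m ≠ 0) : V *ᵥ m ≠ 0 := fun h =>
  hm (Matrix.mulVec_injective_of_isUnit ((Matrix.isUnit_iff_isUnit_det V).2 hV) (by simpa using h))

theorem map_intCast_mulVec {n : ℕ} (V : Matrix (Fin n) (Fin n) ℤ) (m : Fin n → ℤ) :
    (V.map ((↑) : ℤ → ℝ) *ᵥ fun i => (m i : ℝ)) = fun i => ((V *ᵥ m) i : ℝ) := by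
  ext i
  simp [Matrix.mulVec, dotProduct]

theorem abs_det_map_intCast {n : ℕ} (V : Matrix (Fin n) (Fin n) ℤ) (hV : IsUnit V.det) :
    |(V.map ((↑) : ℤ → ℝ)).det| = 1 := by
  have : (V.map ((↑) : ℤ → ℝ)).det = (V.det : ℝ) := ((Int.castRingHom ℝ).map_det V).symm
  rw [this]
  rcases Int.isUnit_iff.1 hV with h | h <;> simp [h]

/-- A matrix that is bounded below on nonzero integer vectors becomes, after permuting the rows
and a unimodular change of columns, one whose first column is nearly the shortest and has its
largest entry on top. -/
theorem exists_unimodular_pivot {n : ℕ} {r : ℝ} (hr : 0 < r)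
    (M : Matrix (Fin (n + 1)) (Fin (n + 1)) ℝ)
    (hM : ∀ m : Fin (n + 1) → ℤ, m ≠ 0 → r ≤ ‖M *ᵥ fun i => (m i : ℝ)‖) :
    ∃ (σ : Equiv.Perm (Fin (n + 1))) (V : Matrix (Fin (n + 1)) (Fin (n + 1)) ℤ),
      IsUnit V.det ∧
      let N := (M * V.map ((↑) : ℤ → ℝ)).submatrix σ id
      r ≤ |N 0 0| ∧ (∀ i, |N i 0| ≤ |N 0 0|) ∧
        ∀ m : Fin (n + 1) → ℤ, m ≠ 0 → 3 / 4 * |N 0 0| ≤ ‖N *ᵥ fun i => (m i : ℝ)‖ := by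
  set f : (Fin (n + 1) → ℤ) → ℝ := fun m => ‖M *ᵥ fun i => (m i : ℝ)‖ with hf
  obtain ⟨m₀, hm₀, hmin⟩ : ∃ m₀ : Fin (n + 1) → ℤ, m₀ ≠ 0 ∧ ∀ m, m ≠ 0 → 3 / 4 * f m₀ ≤ f m := by
    set S : Set ℝ := f '' {m | m ≠ 0} with hS
    have hne : S.Nonempty := ⟨_, fun _ => 1, fun h => one_ne_zero (congrFun h 0), rfl⟩
    have hbdd : BddBelow S := ⟨r, by rintro _ ⟨m, hm, rfl⟩; exact hM m hm⟩
    have hinf : r ≤ sInf S := le_csInf hne (by rintro _ ⟨m, hm, rfl⟩; exact hM m hm)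
    obtain ⟨_, ⟨m₀, hm₀, rfl⟩, hlt⟩ := exists_lt_of_csInf_lt hne
      (show sInf S < 4 / 3 * sInf S by linarith)
    refine ⟨m₀, hm₀, fun m hm => ?_⟩
    have := csInf_le hbdd ⟨m, hm, rfl⟩
    linarith
  obtain ⟨V, g, hV, hg⟩ := exists_unimodular_eq_smul_col n m₀
  have hg0 : g ≠ 0 := by
    rintro rfl
    exact hm₀ (by simpa using hg)
  have hVf : ∀ m, ‖(M * V.map ((↑) : ℤ → ℝ)) *ᵥ fun i => (m i : ℝ)‖ = f (V *ᵥ m) := fun m => by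
    rw [hf, ← Matrix.mulVec_mulVec, map_intCast_mulVec]
  have hle : f (V.col 0) ≤ f m₀ := by
    have : f m₀ = |(g : ℝ)| * f (V.col 0) := by
      rw [hf]
      simp only [hg]
      rw [← Real.norm_eq_abs, ← norm_smul, ← Matrix.mulVec_smul]
      congr 2
      ext i
      simp
    rw [this]
    have h1 : (1 : ℝ) ≤ |(g : ℝ)| := by exact_mod_cast Int.one_le_abs hg0
    exact le_mul_of_one_le_left (norm_nonneg _) h1
  have hcolf : ‖(M * V.map ((↑) : ℤ → ℝ)).col 0‖ = f (V.col 0) := by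
    rw [hf]
    rfl
  obtain ⟨i₀, hi₀⟩ := Finite.exists_max fun i => |(M * V.map ((↑) : ℤ → ℝ)) i 0|
  have hnorm : ‖(M * V.map ((↑) : ℤ → ℝ)).col 0‖ = |(M * V.map ((↑) : ℤ → ℝ)) i₀ 0| :=
    le_antisymm ((pi_norm_le_iff_of_nonneg (abs_nonneg _)).2 hi₀)
      (norm_le_pi_norm ((M * V.map ((↑) : ℤ → ℝ)).col 0) i₀)
  have hVcol : V.col 0 ≠ 0 := by
    intro h
    rw [h] at hg
    exact hm₀ (by simpa using hg)
  have hpiv : |(M * V.map ((↑) : ℤ → ℝ)) i₀ 0| = f (V.col 0) := by rw [← hnorm, hcolf]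
  refine ⟨Equiv.swap 0 i₀, V, hV, ?_⟩
  simp only [Matrix.submatrix_apply, Equiv.swap_apply_left, id]
  refine ⟨?_, fun i => hi₀ _, fun m hm => ?_⟩
  · rw [hpiv]
    exact hM _ hVcol
  · have hperm : ‖((M * V.map ((↑) : ℤ → ℝ)).submatrix (Equiv.swap 0 i₀) id) *ᵥ
        fun i => (m i : ℝ)‖ = ‖(M * V.map ((↑) : ℤ → ℝ)) *ᵥ fun i => (m i : ℝ)‖ := by
      refine le_antisymm ?_ ?_
      · refine (pi_norm_le_iff_of_nonneg (norm_nonneg _)).2 fun i => ?_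
        exact norm_le_pi_norm ((M * V.map ((↑) : ℤ → ℝ)) *ᵥ fun i => (m i : ℝ)) (Equiv.swap 0 i₀ i)
      · refine (pi_norm_le_iff_of_nonneg (norm_nonneg _)).2 fun i => ?_
        have := norm_le_pi_norm (((M * V.map ((↑) : ℤ → ℝ)).submatrix (Equiv.swap 0 i₀) id) *ᵥ
          fun i => (m i : ℝ)) (Equiv.swap 0 i₀ i)
        simpa [Matrix.mulVec] using this
    rw [hpiv, hperm, hVf]
    have := hmin _ (unimodular_mulVec_ne_zero V hV m hm)
    linarith

/-- Lattice reduction: a lattice without short nonzero vectors and with bounded covolume has a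
bounded basis. -/
theorem exists_unimodular_bounded (n : ℕ) : ∀ r : ℝ, 0 < r → ∀ C : ℝ, ∃ R δ : ℝ, 0 < δ ∧
    ∀ M : Matrix (Fin n) (Fin n) ℝ,
      (∀ m : Fin n → ℤ, m ≠ 0 → r ≤ ‖M *ᵥ fun i => (m i : ℝ)‖) → |M.det| ≤ C →
      δ ≤ |M.det| ∧ ∃ U : Matrix (Fin n) (Fin n) ℤ, IsUnit U.det ∧
        ∀ i j, |(M * U.map ((↑) : ℤ → ℝ)) i j| ≤ R := by
  induction n with
  | zero => exact fun r _ C => ⟨0, 1, one_pos, fun M _ _ => ⟨by simp, 1, by simp, by simp⟩⟩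
  | succ n ih =>
    intro r hr C
    obtain ⟨R, δ, hδ, h⟩ := ih (r / 4) (by positivity) (C / r)
    refine ⟨|R| + C / δ, r * δ, by positivity, fun M hM hC => ?_⟩
    obtain ⟨σ, V, hV, hN⟩ := exists_unimodular_pivot hr M hM
    set N := (M * V.map ((↑) : ℤ → ℝ)).submatrix σ id with hNdef
    obtain ⟨hrN, hcol, hmin⟩ := hN
    have hpos : 0 < |N 0 0| := hr.trans_le hrN
    have h0 : N 0 0 ≠ 0 := abs_pos.1 hpos
    have hdetN : |N.det| = |M.det| := by
      have hs : |((Equiv.Perm.sign σ : ℤ) : ℝ)| = 1 := by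
        rcases Int.units_eq_one_or (Equiv.Perm.sign σ) with h | h <;> simp [h]
      rw [hNdef, Matrix.det_permute, abs_mul, hs, one_mul, Matrix.det_mul, abs_mul,
        abs_det_map_intCast V hV, mul_one]
    have hdet : |M.det| = |N 0 0| * |(pivotComplement N).det| := by
      rw [← hdetN, det_eq_mul_det_pivotComplement N h0, abs_mul]
    have hC' : |(pivotComplement N).det| ≤ C / r := by
      rw [le_div_iff₀ hr]
      nlinarith [abs_nonneg (pivotComplement N).det]
    obtain ⟨hδN, U, hU, hUR⟩ := h (pivotComplement N) (fun m hm =>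
      (by linarith : r / 4 ≤ |N 0 0| / 4).trans
        (le_norm_pivotComplement_mulVec N h0 hcol hmin m hm)) hC'
    refine ⟨by rw [hdet]; gcongr, ?_⟩
    obtain ⟨W, hW, hWR⟩ := exists_unimodular_lift N h0 hcol U hU R hUR
    refine ⟨V * W, by rw [Matrix.det_mul]; exact hV.mul hW, fun i j => ?_⟩
    have hle : |N 0 0| ≤ C / δ := by
      rw [le_div_iff₀ hδ]
      nlinarith
    have hmap : (V * W).map ((↑) : ℤ → ℝ) = V.map ((↑) : ℤ → ℝ) * W.map ((↑) : ℤ → ℝ) :=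
      Matrix.map_mul (f := Int.castRingHom ℝ)
    have hent : (M * (V * W).map ((↑) : ℤ → ℝ)) i j
        = (N * W.map ((↑) : ℤ → ℝ)) (σ.symm i) j := by
      rw [hmap, ← Matrix.mul_assoc, hNdef]
      simp [Matrix.mul_apply (N := W.map _)]
    rw [hent]
    linarith [hWR (σ.symm i) j]

/-- A convex body contains a simplex whose associated centred parallelepiped covers the body. -/
theorem exists_simplex_subset_subset_parallelepiped {n : ℕ} {K : Set (Fin n → ℝ)}
    (hcpt : IsCompact K) (hconv : Convex ℝ K) (hint : (interior K).Nonempty) :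
    ∃ (p : Fin n → ℝ) (A : Matrix (Fin n) (Fin n) ℝ),
      (∀ t : Fin n → ℝ, (∀ i, 0 ≤ t i) → ∑ i, t i ≤ 1 → p + t ᵥ* A ∈ K) ∧
      ∀ x ∈ K, ∃ t : Fin n → ℝ, (∀ i, |t i| ≤ 1) ∧ x = p + t ᵥ* A := by
  let F : (Fin n → Fin n → ℝ) × (Fin n → ℝ) → Matrix (Fin n) (Fin n) ℝ :=
    fun w => Matrix.of fun i j => w.1 i j - w.2 j
  set S : Set ((Fin n → Fin n → ℝ) × (Fin n → ℝ)) := (Set.univ.pi fun _ => K) ×ˢ K with hS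
  have hScpt : IsCompact S := (isCompact_univ_pi fun _ => hcpt).prod hcpt
  have hFcont : Continuous fun w => |(F w).det| := by
    refine (Continuous.matrix_det ?_).abs
    exact continuous_matrix fun i j => by simp only [F, Matrix.of_apply]; fun_prop
  obtain ⟨w₀, hw₀, hw₀det⟩ : ∃ w ∈ S, 0 < |(F w).det| := by
    obtain ⟨q, hq⟩ := hint
    obtain ⟨ε, hε, hball⟩ := Metric.isOpen_iff.1 isOpen_interior q hq
    refine ⟨(fun i => q + Pi.single i (ε / 2), q), ⟨fun i _ => ?_, interior_subset hq⟩, ?_⟩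
    · apply interior_subset (hball _)
      simp only [Metric.mem_ball, dist_self_add_left, Pi.norm_single, Real.norm_eq_abs]
      rw [abs_of_pos (by positivity)]
      linarith
    · have : F (fun i => q + Pi.single i (ε / 2), q) = (ε / 2) • 1 := by
        ext i j
        simp [F, Matrix.one_apply, Pi.single_apply, eq_comm]
      rw [this, Matrix.det_smul, Matrix.det_one]
      positivity
  obtain ⟨⟨v, p⟩, ⟨hv, hp⟩, hmax⟩ := hScpt.exists_isMaxOn ⟨w₀, hw₀⟩ hFcont.continuousOn
  set A := F (v, p) with hA
  have hdet : 0 < |A.det| := hw₀det.trans_le (hmax hw₀)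
  refine ⟨p, A, fun t ht hsum => ?_, fun x hx => ?_⟩
  · have h := hconv.sum_mem (t := Finset.univ)
      (w := (Fin.cons (1 - ∑ i, t i) t : Fin (n + 1) → ℝ))
      (z := (Fin.cons p v : Fin (n + 1) → Fin n → ℝ))
      (fun i _ => Fin.cases (by simpa using hsum) (fun i => by simpa using ht i) i)
      (by simp [Fin.sum_univ_succ])
      (fun i _ => Fin.cases (by simpa using hp) (fun i => by simpa using hv i trivial) i)
    convert h using 1
    ext j
    simp only [Fin.sum_univ_succ, Fin.cons_zero, Fin.cons_succ, Pi.add_apply, Pi.smul_apply,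
      Finset.sum_apply, smul_eq_mul, Matrix.vecMul, dotProduct, hA, F, Matrix.of_apply, mul_sub,
      Finset.sum_sub_distrib, ← Finset.sum_mul]
    ring
  · refine ⟨A.det⁻¹ • Aᵀ.cramer (x - p), fun i => ?_, ?_⟩
    · have hup : A.updateRow i (x - p) = F (Function.update v i x, p) := by
        ext k j
        by_cases hk : k = i
        · subst hk; simp [F]
        · simp [F, hA, hk]
      have hle : |(F (Function.update v i x, p)).det| ≤ |A.det| := by
        refine hmax ⟨fun k _ => ?_, hp⟩
        by_cases hk : k = i
        · subst hk; simpa using hx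
        · simpa [hk] using hv k trivial
      rw [Pi.smul_apply, Matrix.cramer_transpose_apply, hup, smul_eq_mul, abs_mul, abs_inv,
        inv_mul_le_iff₀ hdet, mul_one]
      exact hle
    · rw [← Matrix.mulVec_transpose, Matrix.mulVec_smul, Matrix.mulVec_cramer,
        Matrix.det_transpose, smul_smul, inv_mul_cancel₀ (abs_pos.1 hdet), one_smul]
      simp

theorem abs_det_le_of_simplex_subset {n : ℕ} {K : Set (Fin n → ℝ)} {c : ℝ} (hc : 0 ≤ c)
    (hvol : volume K ≤ ENNReal.ofReal c) (p : Fin n → ℝ) (A : Matrix (Fin n) (Fin n) ℝ)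
    (hA : ∀ t : Fin n → ℝ, (∀ i, 0 ≤ t i) → ∑ i, t i ≤ 1 → p + t ᵥ* A ∈ K) :
    |A.det| ≤ c * (n + 1) ^ n := by
  set s : ℝ := ((n : ℝ) + 1)⁻¹ with hs
  have hs0 : 0 < s := by positivity
  have hsub : Matrix.toLin' Aᵀ '' Set.Icc 0 (fun _ => s) ⊆ (fun x => p + x) ⁻¹' K := by
    rintro _ ⟨t, ht, rfl⟩
    rw [Matrix.toLin'_apply, Matrix.mulVec_transpose]
    refine hA t (fun i => ht.1 i) ?_
    calc ∑ i, t i ≤ ∑ _i : Fin n, s := Finset.sum_le_sum fun i _ => ht.2 i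
      _ = n / (n + 1) := by simp [hs, div_eq_mul_inv]
      _ ≤ 1 := by rw [div_le_one (by positivity)]; linarith
  have h := (measure_mono (μ := volume) hsub).trans_eq (measure_preimage_add volume p K)
  rw [Measure.addHaar_image_linearMap, LinearMap.det_toLin', Matrix.det_transpose,
    Real.volume_Icc_pi] at h
  simp only [Pi.zero_apply, sub_zero, Finset.prod_const, Finset.card_univ, Fintype.card_fin] at h
  rw [← ENNReal.ofReal_pow hs0.le, ← ENNReal.ofReal_mul (abs_nonneg _)] at h
  have h' := (ENNReal.ofReal_le_ofReal_iff hc).1 (h.trans hvol)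
  rwa [hs, inv_pow, ← div_eq_mul_inv, div_le_iff₀ (by positivity)] at h'

/-- A set is unavoidable if it meets every integer hyperplane. -/
def IsUnavoidable {n : ℕ} (K : Set (Fin n → ℝ)) : Prop :=
  ∀ m : Fin n → ℤ, m ≠ 0 → ∃ x ∈ K, ∑ j, (m j : ℝ) * x j = 1

theorem abs_dotProduct_sub_le {n : ℕ} {B : ℝ} {u s t : Fin n → ℝ} (hu : ∀ i, |u i| ≤ B)
    (hs : ∀ i, |s i| ≤ 1) (ht : ∀ i, |t i| ≤ 1) : |u ⬝ᵥ (s - t)| ≤ n * (2 * B) := by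
  calc |u ⬝ᵥ (s - t)| ≤ ∑ i, |u i * (s i - t i)| := Finset.abs_sum_le_sum_abs _ _
    _ ≤ ∑ _i : Fin n, 2 * B := Finset.sum_le_sum fun i _ => by
        rw [abs_mul]
        have h1 := abs_sub (s i) (t i)
        have h2 := abs_nonneg (u i)
        nlinarith [hu i, hs i, ht i]
    _ = n * (2 * B) := by simp

theorem IsUnavoidable.le_norm_mulVec {n : ℕ} {K : Set (Fin n → ℝ)} (hK : IsUnavoidable K)
    (p : Fin n → ℝ) (A : Matrix (Fin n) (Fin n) ℝ)
    (hA : ∀ x ∈ K, ∃ t : Fin n → ℝ, (∀ i, |t i| ≤ 1) ∧ x = p + t ᵥ* A)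
    (m : Fin n → ℤ) (hm : m ≠ 0) : ((n : ℝ) + 1)⁻¹ ≤ ‖A *ᵥ fun i => (m i : ℝ)‖ := by
  obtain ⟨x, hx, hmx⟩ := hK m hm
  obtain ⟨y, hy, hmy⟩ := hK (-m) (neg_ne_zero.2 hm)
  obtain ⟨s, hs, rfl⟩ := hA x hx
  obtain ⟨t, ht, rfl⟩ := hA y hy
  have key : (A *ᵥ fun i => (m i : ℝ)) ⬝ᵥ (s - t) = 2 := by
    have h1 : (fun i => (m i : ℝ)) ⬝ᵥ (p + s ᵥ* A) = 1 := hmx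
    have h2 : (fun i => (m i : ℝ)) ⬝ᵥ (p + t ᵥ* A) = -1 := by
      have : -((fun i => (m i : ℝ)) ⬝ᵥ (p + t ᵥ* A)) = 1 := by
        rw [← hmy, ← neg_dotProduct]
        simp [dotProduct]
      linarith
    rw [dotProduct_add, dotProduct_comm _ (_ ᵥ* _), ← Matrix.dotProduct_mulVec] at h1 h2
    rw [dotProduct_sub, dotProduct_comm _ s, dotProduct_comm _ t]
    linarith
  have hle := abs_dotProduct_sub_le (norm_le_pi_norm (A *ᵥ fun i => (m i : ℝ))) hs ht
  rw [key, abs_two] at hle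
  rw [inv_le_iff_one_le_mul₀ (by positivity)]
  nlinarith [norm_nonneg (A *ᵥ fun i => (m i : ℝ))]

/-- Unavoidable convex bodies of bounded volume lie in a common ball, up to unimodular
transformations. -/
theorem exists_unimodular_image_subset_closedBall (n : ℕ) {c : ℝ} (hc : 0 ≤ c) :
    ∃ B : ℝ, ∀ K : Set (Fin n → ℝ), IsCompact K → Convex ℝ K → (interior K).Nonempty →
      IsUnavoidable K → volume K ≤ ENNReal.ofReal c →
      ∃ T : Matrix (Fin n) (Fin n) ℤ, IsUnit T.det ∧
        Matrix.toLin' (T.map ((↑) : ℤ → ℝ)) '' K ⊆ Metric.closedBall 0 B := by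
  obtain ⟨R, δ, -, h⟩ := exists_unimodular_bounded n ((n : ℝ) + 1)⁻¹ (by positivity)
    (c * (n + 1) ^ n)
  refine ⟨1 + n * (2 * |R|), fun K hcpt hconv hint hun hvol => ?_⟩
  obtain ⟨p, A, hsimp, hpar⟩ := exists_simplex_subset_subset_parallelepiped hcpt hconv hint
  obtain ⟨-, U, hU, hUR⟩ := h A (hun.le_norm_mulVec p A hpar)
    (abs_det_le_of_simplex_subset hc hvol p A hsimp)
  refine ⟨Uᵀ, by rwa [Matrix.det_transpose], ?_⟩
  rintro _ ⟨x, hx, rfl⟩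
  rw [mem_closedBall_zero_iff, pi_norm_le_iff_of_nonneg (by positivity)]
  intro i
  have hcol : U.col i ≠ 0 := by
    intro h0
    rw [Matrix.det_eq_zero_of_column_eq_zero i (congrFun h0)] at hU
    exact not_isUnit_zero hU
  obtain ⟨y, hy, hiy⟩ := hun _ hcol
  obtain ⟨s, hs, rfl⟩ := hpar x hx
  obtain ⟨t, ht, rfl⟩ := hpar y hy
  have hle := abs_dotProduct_sub_le (B := |R|)
    (u := A *ᵥ fun k => (U.col i k : ℝ)) (fun k => (hUR k i).trans (le_abs_self R)) hs ht
  have hiy' : (fun k => (U.col i k : ℝ)) ⬝ᵥ (p + t ᵥ* A) = 1 := hiy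
  have hix : Matrix.toLin' (Uᵀ.map ((↑) : ℤ → ℝ)) (p + s ᵥ* A) i
      = (fun k => (U.col i k : ℝ)) ⬝ᵥ (p + s ᵥ* A) := rfl
  rw [hix, Real.norm_eq_abs]
  have hdiff : (fun k => (U.col i k : ℝ)) ⬝ᵥ (p + s ᵥ* A)
      = 1 + (A *ᵥ fun k => (U.col i k : ℝ)) ⬝ᵥ (s - t) := by
    rw [← hiy', dotProduct_add, dotProduct_add, dotProduct_comm _ (s ᵥ* A),
      dotProduct_comm _ (t ᵥ* A), ← Matrix.dotProduct_mulVec, ← Matrix.dotProduct_mulVec,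
      dotProduct_sub, dotProduct_comm _ s, dotProduct_comm _ t]
    ring
  rw [hdiff]
  refine (abs_add_le _ _).trans ?_
  rw [abs_one]
  linarith

theorem IsUnavoidable.image_unimodular {n : ℕ} {K : Set (Fin n → ℝ)} (hK : IsUnavoidable K)
    {T : Matrix (Fin n) (Fin n) ℤ} (hT : IsUnit T.det) :
    IsUnavoidable (Matrix.toLin' (T.map ((↑) : ℤ → ℝ)) '' K) := by
  intro m hm
  obtain ⟨x, hx, hmx⟩ := hK (Tᵀ *ᵥ m)
    (unimodular_mulVec_ne_zero Tᵀ (by rwa [Matrix.det_transpose]) m hm)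
  refine ⟨_, ⟨x, hx, rfl⟩, ?_⟩
  rw [← hmx]
  change (fun j => (m j : ℝ)) ⬝ᵥ (T.map ((↑) : ℤ → ℝ) *ᵥ x) = (fun j => ((Tᵀ *ᵥ m) j : ℝ)) ⬝ᵥ x
  rw [← map_intCast_mulVec, Matrix.dotProduct_mulVec, ← Matrix.mulVec_transpose,
    Matrix.transpose_map]

/-- Simultaneous Diophantine approximation with an arbitrarily large denominator. -/
theorem exists_nat_forall_abs_mul_sub_le {n : ℕ} (a : Fin n → ℝ) {ε : ℝ} (hε : 0 < ε) (Q : ℕ) :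
    ∃ q : ℕ, Q ≤ q ∧ ∃ m : Fin n → ℤ, ∀ j, |q * a j - m j| ≤ ε := by
  obtain ⟨l, -, φ, hφ, hl⟩ := (isCompact_Icc (a := (0 : Fin n → ℝ)) (b := 1)).tendsto_subseq
    (x := fun (k : ℕ) j => Int.fract (k * a j))
    (fun k => ⟨fun j => Int.fract_nonneg _, fun j => (Int.fract_lt_one _).le⟩)
  obtain ⟨N, hN⟩ := Metric.cauchySeq_iff'.1 hl.cauchySeq ε hε
  refine ⟨φ (N + Q) - φ N, ?_, fun j => ⌊φ (N + Q) * a j⌋ - ⌊φ N * a j⌋, fun j => ?_⟩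
  · have := hφ.add_le_nat Q N
    rw [add_comm Q N] at this
    omega
  · have h := (dist_le_pi_dist _ _ j).trans (hN (N + Q) (Nat.le_add_right _ _)).le
    rw [Real.dist_eq] at h
    simp only [Function.comp_apply, Int.fract] at h
    rw [Nat.cast_sub (hφ.monotone (Nat.le_add_right _ _))]
    refine (congrArg abs ?_).trans_le h
    push_cast
    ring

theorem IsUnavoidable.interior_nonempty {n : ℕ} {L : Set (Fin n → ℝ)} (hL : IsUnavoidable L)
    (hcpt : IsCompact L) (hconv : Convex ℝ L) (hne : L.Nonempty) : (interior L).Nonempty := by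
  rw [hconv.interior_nonempty_iff_affineSpan_eq_top,
    AffineSubspace.affineSpan_eq_top_iff_vectorSpan_eq_top_of_nonempty ℝ _ _ hne]
  by_contra hspan
  obtain ⟨f, hf, hker⟩ := Submodule.exists_le_ker_of_lt_top _ (lt_top_iff_ne_top.2 hspan)
  set a : Fin n → ℝ := fun j => f (Pi.single j 1) with ha
  have hfa : ∀ x, f x = ∑ j, a j * x j := fun x => by
    rw [LinearMap.pi_apply_eq_sum_univ f x]
    refine Finset.sum_congr rfl fun j _ => ?_
    rw [smul_eq_mul, mul_comm, ha]
    congr 2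
    ext k
    simp [Pi.single_apply, eq_comm]
  obtain ⟨j₀, hj₀⟩ : ∃ j, a j ≠ 0 := by
    by_contra! h
    exact hf (LinearMap.ext fun x => by simp [hfa, h])
  obtain ⟨x₀, hx₀⟩ := hne
  have hconst : ∀ x ∈ L, f x = f x₀ := fun x hx => by
    have := hker (vsub_mem_vectorSpan ℝ hx hx₀)
    rwa [LinearMap.mem_ker, vsub_eq_sub, map_sub, sub_eq_zero] at this
  set b := f x₀
  obtain ⟨R, hR⟩ := hcpt.isBounded.exists_norm_le
  have hR0 : 0 ≤ R := (norm_nonneg _).trans (hR x₀ hx₀)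
  set ε : ℝ := (2 * (n * R + 1))⁻¹ with hε
  have hεpos : 0 < ε := by positivity
  have hεR : n * (ε * R) ≤ 1 / 2 := by
    have : ε * (2 * (n * R + 1)) = 1 := inv_mul_cancel₀ (by positivity)
    linarith
  have hε2 : ε ≤ 1 / 2 := by
    rw [hε, one_div]
    exact inv_anti₀ two_pos (by nlinarith [mul_nonneg n.cast_nonneg hR0 (α := ℝ)])
  obtain ⟨q, hQ, m, hm⟩ := exists_nat_forall_abs_mul_sub_le a hεpos
    (max ⌈2 / |b|⌉₊ ⌈1 / |a j₀|⌉₊)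
  have hq₁ : 2 / |b| ≤ q := (Nat.le_ceil _).trans (by exact_mod_cast (le_max_left _ _).trans hQ)
  have hq₂ : 1 / |a j₀| ≤ q := (Nat.le_ceil _).trans (by exact_mod_cast (le_max_right _ _).trans hQ)
  have hm0 : m ≠ 0 := by
    rintro rfl
    have h := hm j₀
    rw [div_le_iff₀ (abs_pos.2 hj₀)] at hq₂
    simp only [Pi.zero_apply, Int.cast_zero, sub_zero, abs_mul, Nat.abs_cast] at h
    linarith
  obtain ⟨x, hx, hmx⟩ := hL m hm0
  have hclose : |q * b - 1| ≤ 1 / 2 := by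
    have hsum : q * b - 1 = ∑ j, (q * (a j * x j) - m j * x j) := by
      rw [Finset.sum_sub_distrib, hmx, ← Finset.mul_sum, ← hfa, hconst x hx]
    rw [hsum]
    calc |∑ j, (q * (a j * x j) - m j * x j)| ≤ ∑ j, |q * (a j * x j) - m j * x j| :=
          Finset.abs_sum_le_sum_abs _ _
      _ ≤ ∑ _j : Fin n, ε * R := Finset.sum_le_sum fun j _ => by
          rw [← mul_assoc, ← sub_mul, abs_mul]
          exact mul_le_mul (hm j) ((norm_le_pi_norm x j).trans (hR x hx)) (abs_nonneg _) hεpos.le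
      _ = n * (ε * R) := by simp
      _ ≤ 1 / 2 := hεR
  by_cases hb : b = 0
  · rw [hb, mul_zero, zero_sub, abs_neg, abs_one] at hclose
    linarith
  · rw [div_le_iff₀ (abs_pos.2 hb)] at hq₁
    have h1 := abs_sub_abs_le_abs_sub (q * b) 1
    rw [abs_mul, Nat.abs_cast, abs_one] at h1
    linarith

open TopologicalSpace in
theorem convex_of_tendsto_nonemptyCompacts {E : Type*} [NormedAddCommGroup E] [NormedSpace ℝ E]
    {C : ℕ → NonemptyCompacts E} {L : NonemptyCompacts E}
    (hC : ∀ i, Convex ℝ (C i : Set E)) (h : Filter.Tendsto C Filter.atTop (nhds L)) :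
    Convex ℝ (L : Set E) := by
  intro x hx y hy a b ha hb hab
  rw [← L.isCompact.isClosed.closure_eq, Metric.mem_closure_iff]
  intro ε hε
  obtain ⟨N, hN⟩ := Metric.tendsto_atTop.1 h (ε / 2) (half_pos hε)
  have hd : Metric.hausdorffDist (C N : Set E) L < ε / 2 := hN N le_rfl
  have hfin : Metric.hausdorffEDist (C N : Set E) L ≠ ⊤ :=
    Metric.hausdorffEDist_ne_top_of_nonempty_of_bounded (C N).nonempty L.nonempty
      (C N).isCompact.isBounded L.isCompact.isBounded
  obtain ⟨x', hx', hxd⟩ := Metric.exists_dist_lt_of_hausdorffDist_lt' hx hd hfin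
  obtain ⟨y', hy', hyd⟩ := Metric.exists_dist_lt_of_hausdorffDist_lt' hy hd hfin
  obtain ⟨z, hz, hzd⟩ := Metric.exists_dist_lt_of_hausdorffDist_lt
    (hC N hx' hy' ha hb hab) hd hfin
  refine ⟨z, hz, ?_⟩
  have hmid : dist (a • x + b • y) (a • x' + b • y') ≤ ε / 2 := by
    refine (dist_add_add_le _ _ _ _).trans ?_
    rw [dist_smul₀, dist_smul₀, Real.norm_of_nonneg ha, Real.norm_of_nonneg hb]
    rw [dist_comm] at hxd hyd
    nlinarith
  linarith [dist_triangle (a • x + b • y) (a • x' + b • y') z]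

/-- The set of unavoidable convex bodies in `ℝⁿ` of volume at most `c` is
compact modulo unimodular transformations: every sequence of such bodies admits unimodular
transformations and a subsequence along which the transformed bodies converge in Hausdorff
distance to an unavoidable convex body. -/
theorem stmt_13 (n : ℕ) (c : ℝ) (hc : 0 < c)
    (K : ℕ → Set (Fin n → ℝ))
    (hcpt : ∀ i, IsCompact (K i)) (hconv : ∀ i, Convex ℝ (K i))
    (hint : ∀ i, (interior (K i)).Nonempty)
    (hunav : ∀ i, ∀ m : Fin n → ℤ, m ≠ 0 →
      ∃ x ∈ K i, ∑ j, (m j : ℝ) * x j = 1)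
    (hvol : ∀ i, volume (K i) ≤ ENNReal.ofReal c) :
    ∃ (T : ℕ → Matrix (Fin n) (Fin n) ℤ) (φ : ℕ → ℕ) (L : Set (Fin n → ℝ)),
      (∀ i, (T i).det = 1 ∨ (T i).det = -1) ∧ StrictMono φ ∧
      IsCompact L ∧ Convex ℝ L ∧ (interior L).Nonempty ∧
      (∀ m : Fin n → ℤ, m ≠ 0 → ∃ x ∈ L, ∑ j, (m j : ℝ) * x j = 1) ∧
      Filter.Tendsto
        (fun i => Metric.hausdorffDist
          ((Matrix.toLin' ((T (φ i)).map ((↑) : ℤ → ℝ))) '' K (φ i)) L)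
        Filter.atTop (nhds 0) := by
  obtain ⟨B, hB⟩ := exists_unimodular_image_subset_closedBall n hc.le
  choose T hT hTB using fun i => hB (K i) (hcpt i) (hconv i) (hint i) (hunav i) (hvol i)
  let C : ℕ → TopologicalSpace.NonemptyCompacts (Fin n → ℝ) := fun i =>
    { carrier := Matrix.toLin' ((T i).map ((↑) : ℤ → ℝ)) '' K i
      isCompact' := (hcpt i).image (LinearMap.continuous_of_finiteDimensional _)
      nonempty' := ((hint i).mono interior_subset).image _ }
  obtain ⟨L, -, φ, hφ, hlim⟩ :=
    (TopologicalSpace.NonemptyCompacts.isCompact_subsets_of_isCompact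
      (isCompact_closedBall (0 : Fin n → ℝ) B)).tendsto_subseq (x := C) hTB
  have hLconv : Convex ℝ (L : Set (Fin n → ℝ)) :=
    convex_of_tendsto_nonemptyCompacts (fun i => (hconv (φ i)).linear_image _) hlim
  have hLun : IsUnavoidable (L : Set (Fin n → ℝ)) := by
    intro m hm
    have hclosed : IsClosed {x : Fin n → ℝ | ∑ j, (m j : ℝ) * x j = 1} :=
      isClosed_eq (by fun_prop) continuous_const
    exact (TopologicalSpace.NonemptyCompacts.isClosed_inter_nonempty_of_isClosed
      hclosed).mem_of_tendsto hlim (Filter.Eventually.of_forall fun i =>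
        IsUnavoidable.image_unimodular (hunav (φ i)) (hT (φ i)) m hm)
  refine ⟨T, φ, L, fun i => Int.isUnit_iff.1 (hT i), hφ, L.isCompact, hLconv,
    hLun.interior_nonempty L.isCompact hLconv L.nonempty, hLun, ?_⟩
  exact tendsto_iff_dist_tendsto_zero.1 hlim
end

section
/- There exists a constant R_n > 0 depending only on the dimension n such that for every unavoidable convex body K ⊂ ℝⁿ there is a unimodular transformation T of ℝⁿ with T(K) contained in the closed Euclidean ball of radius R_n · |K| centered at the origin. -/
open MeasureTheory

/-- The value at `z` of the quadratic form with matrix `S`. -/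
def quadValue {ι : Type*} [Fintype ι] (S : Matrix ι ι ℝ) (z : ι → ℝ) : ℝ :=
  ∑ i, ∑ j, S i j * z i * z j

theorem quadValue_eq_dotProduct {ι : Type*} [Fintype ι] (S : Matrix ι ι ℝ) (z : ι → ℝ) :
    quadValue S z = z ⬝ᵥ (S.mulVec z) := by
  simp only [quadValue, dotProduct, Matrix.mulVec, Finset.mul_sum]
  refine Finset.sum_congr rfl fun i _ => Finset.sum_congr rfl fun j _ => by ring

theorem quadValue_transpose_mul_mul {ι : Type*} [Fintype ι] (S A : Matrix ι ι ℝ) (z : ι → ℝ) :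
    quadValue (A.transpose * S * A) z = quadValue S (A.mulVec z) := by
  rw [quadValue_eq_dotProduct, quadValue_eq_dotProduct, Matrix.mul_assoc, ← Matrix.mulVec_mulVec,
    ← Matrix.mulVec_mulVec, Matrix.dotProduct_mulVec, Matrix.vecMul_transpose]

theorem quadValue_smul_left {ι : Type*} [Fintype ι] (c : ℝ) (S : Matrix ι ι ℝ) (z : ι → ℝ) :
    quadValue (c • S) z = c * quadValue S z := by
  simp only [quadValue, Finset.mul_sum, Matrix.smul_apply, smul_eq_mul]
  refine Finset.sum_congr rfl fun i _ => Finset.sum_congr rfl fun j _ => by ring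

theorem quadValue_smul_right {ι : Type*} [Fintype ι] (c : ℝ) (S : Matrix ι ι ℝ) (z : ι → ℝ) :
    quadValue S (c • z) = c ^ 2 * quadValue S z := by
  simp only [quadValue, Finset.mul_sum, Pi.smul_apply, smul_eq_mul]
  refine Finset.sum_congr rfl fun i _ => Finset.sum_congr rfl fun j _ => by ring

theorem quadValue_mul_transpose {ι : Type*} [Fintype ι] (A : Matrix ι ι ℝ) (z : ι → ℝ) :
    quadValue (A * A.transpose) z = ∑ j, (∑ i, z i * A i j) ^ 2 := by
  rw [quadValue_eq_dotProduct, ← Matrix.mulVec_mulVec, Matrix.dotProduct_mulVec,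
    ← Matrix.vecMul_transpose, Matrix.transpose_transpose]
  simp only [dotProduct, Matrix.vecMul, sq]

theorem quadValue_sumElim {ι : Type*} [Fintype ι] (S : Matrix (Unit ⊕ ι) (Unit ⊕ ι) ℝ)
    (hS : S.IsSymm) (hl : S (.inl ()) (.inl ()) ≠ 0) (t : ℝ) (x : ι → ℝ) :
    quadValue S (Sum.elim (fun _ => t) x) =
      S (.inl ()) (.inl ()) *
        (t + (∑ j, S (.inl ()) (.inr j) * x j) / S (.inl ()) (.inl ())) ^ 2 +
      quadValue (Matrix.of fun i j => S (.inr i) (.inr j) -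
        S (.inl ()) (.inr i) * S (.inl ()) (.inr j) / S (.inl ()) (.inl ())) x := by
  have h1 : ∀ i, S (.inr i) (.inl ()) = S (.inl ()) (.inr i) := fun i => hS.apply _ _
  have h2 : (∑ j, S (.inl ()) (.inr j) * x j) ^ 2 =
      ∑ i, ∑ j, (S (.inl ()) (.inr i) * S (.inl ()) (.inr j)) * x i * x j := by
    rw [sq, Finset.sum_mul_sum]
    refine Finset.sum_congr rfl fun i _ => Finset.sum_congr rfl fun j _ => by ring
  have h3 : quadValue (Matrix.of fun i j => S (.inr i) (.inr j) -
        S (.inl ()) (.inr i) * S (.inl ()) (.inr j) / S (.inl ()) (.inl ())) x =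
      ∑ i, ∑ j, S (.inr i) (.inr j) * x i * x j -
        (∑ j, S (.inl ()) (.inr j) * x j) ^ 2 / S (.inl ()) (.inl ()) := by
    rw [h2, Finset.sum_div, ← Finset.sum_sub_distrib]
    refine Finset.sum_congr rfl fun i _ => ?_
    rw [Finset.sum_div, ← Finset.sum_sub_distrib]
    refine Finset.sum_congr rfl fun j _ => ?_
    simp only [Matrix.of_apply]
    ring
  have h4 : ∑ i, S (.inl ()) (.inr i) * x i * t = (∑ j, S (.inl ()) (.inr j) * x j) * t := by
    rw [Finset.sum_mul]
  have h5 : ∑ i, S (.inl ()) (.inr i) * t * x i = (∑ j, S (.inl ()) (.inr j) * x j) * t := by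
    rw [Finset.sum_mul]
    exact Finset.sum_congr rfl fun i _ => by ring
  rw [h3]
  simp only [quadValue, Fintype.sum_sum_type, Sum.elim_inl, Sum.elim_inr, Finset.univ_unique,
    Finset.sum_singleton, PUnit.default_eq_unit, h1, Finset.sum_add_distrib, h4, h5]
  field_simp
  ring

theorem det_eq_mul_det_schur {ι : Type*} [Fintype ι] [DecidableEq ι]
    (S : Matrix (Unit ⊕ ι) (Unit ⊕ ι) ℝ)
    (hS : S.IsSymm) (hl : S (.inl ()) (.inl ()) ≠ 0) :
    S.det = S (.inl ()) (.inl ()) * (Matrix.of fun i j => S (.inr i) (.inr j) -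
        S (.inl ()) (.inr i) * S (.inl ()) (.inr j) / S (.inl ()) (.inl ())).det := by
  have hd : S.toBlocks₁₁.det = S (.inl ()) (.inl ()) := by simp [Matrix.toBlocks₁₁]
  have : Invertible S.toBlocks₁₁ :=
    Matrix.invertibleOfIsUnitDet _ (by rw [hd]; exact hl.isUnit)
  have := Matrix.det_fromBlocks₁₁ S.toBlocks₁₁ S.toBlocks₁₂ S.toBlocks₂₁ S.toBlocks₂₂
  rw [Matrix.fromBlocks_toBlocks, hd] at this
  rw [this]
  congr 2
  ext i j
  rw [Matrix.invOf_eq_nonsing_inv, Matrix.inv_def, Matrix.adjugate_subsingleton]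
  have h1 : ∀ i, S (.inr i) (.inl ()) = S (.inl ()) (.inr i) := fun i => hS.apply _ _
  simp [Matrix.mul_apply, Matrix.toBlocks₁₁, Matrix.toBlocks₁₂, Matrix.toBlocks₂₁,
    Matrix.toBlocks₂₂, h1]
  ring

/-- Every integer vector is a multiple of a column of a unimodular matrix. -/
theorem exists_unimodular_col {ι : Type*} [Fintype ι] [DecidableEq ι] (i₀ : ι) (v : ι → ℤ) :
    ∃ (U : Matrix ι ι ℤ) (d : ℤ), IsUnit U.det ∧ ∀ i, v i = d * U i i₀ := by
  induction h : ∑ i, (v i).natAbs using Nat.strong_induction_on generalizing v with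
  | _ k ih =>
  by_cases hv : ∃ i j, i ≠ j ∧ v j ≠ 0 ∧ |v j| ≤ |v i|
  · obtain ⟨i, j, hij, hj, hle⟩ := hv
    obtain ⟨U, d, hU, hd⟩ := ih _ (by
      rw [← h]
      refine Finset.sum_lt_sum (f := fun l => ((Function.update v i (v i % v j)) l).natAbs)
        (fun l _ => ?_) ⟨i, Finset.mem_univ _, ?_⟩
      · by_cases hl : l = i
        · subst hl
          have := Int.emod_lt_abs (v l) hj
          have := Int.emod_nonneg (v l) hj
          simp only [Function.update_self]
          simp only [Int.abs_eq_natAbs] at *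
          omega
        · simp [Function.update_of_ne hl]
      · have := Int.emod_lt_abs (v i) hj
        have := Int.emod_nonneg (v i) hj
        simp only [Function.update_self]
        simp only [Int.abs_eq_natAbs] at *
        omega) (Function.update v i (v i % v j)) rfl
    refine ⟨Matrix.transvection i j (v i / v j) * U, d, ?_, fun l => ?_⟩
    · rwa [Matrix.det_mul, Matrix.det_transvection_of_ne _ _ hij, one_mul]
    · by_cases hl : l = i
      · subst hl
        rw [Matrix.transvection_mul_apply_same, mul_add, mul_left_comm, ← hd, ← hd,
          Function.update_self, Function.update_of_ne hij.symm]
        have := Int.emod_add_mul_ediv (v l) (v j)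
        linarith
      · rw [Matrix.transvection_mul_apply_of_ne _ _ _ _ hl, ← hd, Function.update_of_ne hl]
  · push Not at hv
    by_cases h0 : ∀ i, v i = 0
    · exact ⟨1, 0, by simp, by simpa using h0⟩
    · push Not at h0
      obtain ⟨i, hi⟩ := h0
      refine ⟨(Equiv.swap i i₀).permMatrix ℤ, v i, ?_, fun l => ?_⟩
      · rw [Matrix.det_permutation]
        exact (Units.isUnit _).map (Int.castRingHom ℤ)
      · have hz : l ≠ i → v l = 0 := fun hl => by
          by_contra hne
          have h1 := hv i l hl.symm hne
          have h2 := hv l i hl hi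
          linarith
        by_cases hl : l = i
        · subst hl; simp [Equiv.Perm.permMatrix, PEquiv.toMatrix]
        · have : Equiv.swap i i₀ l ≠ i₀ := by
            rwa [Ne, Equiv.swap_apply_eq_iff, Equiv.swap_apply_right]
          rw [hz hl]
          simp [Equiv.Perm.permMatrix, PEquiv.toMatrix, this]

/-- The bound on the size of a reduced basis passes to forms in one more variable. -/
theorem exists_reduced_basis_sum_unit {ι : Type*} [Fintype ι] [DecidableEq ι] {C : ℝ}
    (hC : 0 < C)
    (h : ∀ S : Matrix ι ι ℝ, S.IsSymm →
      (∀ m : ι → ℤ, m ≠ 0 → 1 ≤ quadValue S (fun i => (m i : ℝ))) →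
      ∃ U : Matrix ι ι ℤ, IsUnit U.det ∧
        ∀ j, quadValue S (fun i => (U i j : ℝ)) ≤ C * S.det)
    (S : Matrix (Unit ⊕ ι) (Unit ⊕ ι) ℝ) (hS : S.IsSymm)
    (hm : ∀ m : Unit ⊕ ι → ℤ, m ≠ 0 → 1 ≤ quadValue S (fun i => (m i : ℝ))) :
    ∃ U : Matrix (Unit ⊕ ι) (Unit ⊕ ι) ℤ, IsUnit U.det ∧
      ∀ j, quadValue S (fun i => (U i j : ℝ)) ≤
        (1 + 2 * (C * 2 ^ Fintype.card ι)) * S.det := by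
  -- a nearly shortest vector, extended to a basis
  obtain ⟨U, hU, hmin⟩ : ∃ U : Matrix (Unit ⊕ ι) (Unit ⊕ ι) ℤ, IsUnit U.det ∧
      ∀ m : Unit ⊕ ι → ℤ, m ≠ 0 →
        3 / 4 * quadValue S (fun i => (U i (.inl ()) : ℝ)) ≤ quadValue S (fun i => (m i : ℝ)) := by
    set A : Set ℝ := (fun m : Unit ⊕ ι → ℤ => quadValue S (fun i => (m i : ℝ))) '' {m | m ≠ 0}
    have hA : A.Nonempty := ⟨_, 1, one_ne_zero, rfl⟩
    have hbdd : BddBelow A := ⟨1, by rintro _ ⟨m, hm0, rfl⟩; exact hm m hm0⟩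
    have hA1 : 1 ≤ sInf A := le_csInf hA (by rintro _ ⟨m, hm0, rfl⟩; exact hm m hm0)
    obtain ⟨_, ⟨v, hv0, rfl⟩, hv⟩ := exists_lt_of_csInf_lt hA
      (show sInf A < 4 / 3 * sInf A by linarith)
    obtain ⟨U, d, hU, hd⟩ := exists_unimodular_col (Sum.inl ()) v
    refine ⟨U, hU, fun m hm0 => ?_⟩
    have h1 : sInf A ≤ quadValue S (fun i => (m i : ℝ)) := csInf_le hbdd ⟨m, hm0, rfl⟩
    have hd0 : d ≠ 0 := by
      rintro rfl
      exact hv0 (funext fun i => by simpa using hd i)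
    have hc0 : (fun i => U i (.inl ())) ≠ 0 := by
      intro h0
      exact hv0 (funext fun i => by rw [hd, congrFun h0 i]; simp)
    have h2 : (fun i => (v i : ℝ)) = (d : ℝ) • fun i => (U i (.inl ()) : ℝ) := by
      funext i
      simp [hd i]
    have h3 := hm _ hc0
    have h4 : (1 : ℝ) ≤ (d : ℝ) ^ 2 := by
      have : 0 < d ^ 2 := by positivity
      exact_mod_cast this
    simp only [h2, quadValue_smul_right] at hv
    nlinarith
  set S₁ : Matrix (Unit ⊕ ι) (Unit ⊕ ι) ℝ :=
    (U.map ((↑) : ℤ → ℝ)).transpose * S * U.map ((↑) : ℤ → ℝ) with hS₁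
  have hS₁s : S₁.IsSymm := by
    rw [Matrix.IsSymm, hS₁]
    simp only [Matrix.transpose_mul, Matrix.transpose_transpose, hS.eq, Matrix.mul_assoc]
  have hmul : ∀ z : Unit ⊕ ι → ℤ, (U.map ((↑) : ℤ → ℝ)).mulVec (fun i => (z i : ℝ)) =
      fun i => ((U.mulVec z i : ℤ) : ℝ) := by
    intro z
    funext i
    simp [Matrix.mulVec, dotProduct]
  have hq : ∀ z : Unit ⊕ ι → ℤ, quadValue S₁ (fun i => (z i : ℝ)) =
      quadValue S (fun i => ((U.mulVec z i : ℤ) : ℝ)) := by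
    intro z
    rw [hS₁, quadValue_transpose_mul_mul, hmul]
  have hdet : S₁.det = S.det := by
    have : (U.map ((↑) : ℤ → ℝ)).det = (U.det : ℝ) := (Int.cast_det U).symm
    rw [hS₁, Matrix.det_mul, Matrix.det_mul, Matrix.det_transpose, this]
    rcases Int.isUnit_iff.1 hU with h | h <;> simp [h]
  set l := S₁ (.inl ()) (.inl ()) with hl
  have hlq : l = quadValue S (fun i => (U i (.inl ()) : ℝ)) := by
    have h1 := hq (Pi.single (.inl ()) 1)
    simp only [Matrix.mulVec_single_one, Matrix.col_apply] at h1
    rw [← h1]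
    simp [quadValue, Pi.single_apply, hl]
  have hc0 : (fun i => U i (.inl ())) ≠ 0 := by
    intro h0
    have := Matrix.det_eq_zero_of_column_eq_zero (Sum.inl ()) (congrFun h0)
    rw [this] at hU
    exact not_isUnit_zero hU
  have hl1 : 1 ≤ l := hlq ▸ hm _ hc0
  have hl0 : l ≠ 0 := by linarith
  have hmin₁ : ∀ z : Unit ⊕ ι → ℤ, z ≠ 0 → 3 / 4 * l ≤ quadValue S₁ (fun i => (z i : ℝ)) := by
    intro z hz
    rw [hq, hlq]
    refine hmin _ fun h0 => hz ?_
    exact Matrix.eq_zero_of_mulVec_eq_zero hU.ne_zero h0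
  set S' : Matrix ι ι ℝ := Matrix.of fun i j => S₁ (.inr i) (.inr j) -
        S₁ (.inl ()) (.inr i) * S₁ (.inl ()) (.inr j) / l with hS'
  have hS's : S'.IsSymm := by
    ext i j
    simp only [Matrix.transpose_apply, hS', Matrix.of_apply, hS₁s.apply (.inr i) (.inr j)]
    ring
  have hdet' : S.det = l * S'.det := hdet ▸ det_eq_mul_det_schur S₁ hS₁s hl0
  -- the best choice of the first coordinate over a given vector
  have hround : ∀ x : ι → ℤ, ∃ t : ℤ, quadValue S₁ (Sum.elim (fun _ => (t : ℝ)) fun i => (x i : ℝ))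
      ≤ l / 4 + quadValue S' (fun i => (x i : ℝ)) := by
    intro x
    refine ⟨-round ((∑ j, S₁ (.inl ()) (.inr j) * (x j : ℝ)) / l), ?_⟩
    rw [quadValue_sumElim S₁ hS₁s hl0, ← hl, ← hS']
    have := abs_sub_round ((∑ j, S₁ (.inl ()) (.inr j) * (x j : ℝ)) / l)
    set y := (∑ j, S₁ (.inl ()) (.inr j) * (x j : ℝ)) / l
    have h2 : (((-round y : ℤ) : ℝ) + y) ^ 2 ≤ 1 / 4 := by
      push_cast
      rw [abs_le] at this
      nlinarith
    nlinarith
  have hcast : ∀ (t : ℤ) (x : ι → ℤ), (Sum.elim (fun _ => (t : ℝ)) fun i => (x i : ℝ)) =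
      fun i : Unit ⊕ ι => (((Sum.elim (fun _ => t) x : Unit ⊕ ι → ℤ) i : ℤ) : ℝ) := by
    intro t x
    funext i
    cases i <;> rfl
  have hS'l : ∀ x : ι → ℤ, x ≠ 0 → l / 2 ≤ quadValue S' (fun i => (x i : ℝ)) := by
    intro x hx
    obtain ⟨t, ht⟩ := hround x
    rw [hcast] at ht
    have := hmin₁ (Sum.elim (fun _ => t) x) fun h0 => hx (funext fun i => congrFun h0 (.inr i))
    linarith
  obtain ⟨V, hV, hVb⟩ := h ((2 : ℝ) • S') (hS's.smul 2) fun x hx => by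
    rw [quadValue_smul_left]
    linarith [hS'l x hx]
  simp only [quadValue_smul_left, Matrix.det_smul] at hVb
  set C₁ := C * 2 ^ Fintype.card ι with hC₁
  have hC₁0 : 0 < C₁ := by positivity
  have hVb' : ∀ j, 2 * (l * quadValue S' (fun i => (V i j : ℝ))) ≤ C₁ * S.det := by
    intro j
    rw [hdet', hC₁]
    have := mul_le_mul_of_nonneg_left (hVb j) (show 0 ≤ l by linarith)
    linarith
  have hVl : ∀ j, l / 2 ≤ quadValue S' (fun i => (V i j : ℝ)) := by
    intro j
    refine hS'l _ fun h0 => ?_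
    have := Matrix.det_eq_zero_of_column_eq_zero j (congrFun h0)
    rw [this] at hV
    exact not_isUnit_zero hV
  have hldet : l ≤ (1 + C₁) * S.det := by
    rcases isEmpty_or_nonempty ι with hι | ⟨⟨j⟩⟩
    · have : S'.det = 1 := Matrix.det_isEmpty
      rw [hdet', this]
      nlinarith
    · have h1 := hVb' j
      have h2 := hVl j
      have h3 : l ≤ C₁ * S.det := by nlinarith
      have : 0 ≤ S.det := by
        by_contra hneg
        nlinarith
      linarith
  have hdet0 : 0 ≤ S.det := by
    by_contra hneg
    nlinarith
  choose t ht using fun j => hround (fun i => V i j)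
  refine ⟨U * Matrix.fromBlocks 1 (Matrix.of fun _ j => t j) 0 V, ?_, ?_⟩
  · rw [Matrix.det_mul, Matrix.det_fromBlocks_zero₂₁, Matrix.det_one, one_mul]
    exact hU.mul hV
  · have hcol : ∀ (W : Matrix (Unit ⊕ ι) (Unit ⊕ ι) ℤ) j,
        quadValue S (fun i => ((U * W) i j : ℝ)) = quadValue S₁ (fun i => (W i j : ℝ)) := by
      intro W j
      rw [hq fun i => W i j]
      rfl
    intro j
    rw [hcol]
    rcases j with _ | j
    · have : quadValue S₁ (fun i => ((Matrix.fromBlocks (1 : Matrix Unit Unit ℤ)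
          (Matrix.of fun _ j => t j) 0 V i (.inl ()) : ℤ) : ℝ)) = l := by
        simp [quadValue, hl]
      rw [this]
      nlinarith
    · have h1 := ht j
      rw [hcast] at h1
      have h2 : (fun i : Unit ⊕ ι => (((Sum.elim (fun _ => t j) fun i => V i j :
          Unit ⊕ ι → ℤ) i : ℤ) : ℝ)) = fun i => ((Matrix.fromBlocks (1 : Matrix Unit Unit ℤ)
          (Matrix.of fun _ j => t j) 0 V i (.inr j) : ℤ) : ℝ) := by
        funext i
        cases i <;> rfl
      rw [h2] at h1
      have h3 := hVb' j
      have h4 := hVl j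
      have h5 : quadValue S' (fun i => (V i j : ℝ)) ≤ C₁ * S.det := by nlinarith
      nlinarith

/-- A symmetric matrix whose quadratic form is at least one at all nonzero integer vectors has a
lattice basis on which the form is bounded by a multiple of the determinant. -/
theorem exists_reduced_basis (n : ℕ) : ∃ C : ℝ, 0 < C ∧ ∀ S : Matrix (Fin n) (Fin n) ℝ, S.IsSymm →
    (∀ m : Fin n → ℤ, m ≠ 0 → 1 ≤ quadValue S (fun i => (m i : ℝ))) →
    ∃ U : Matrix (Fin n) (Fin n) ℤ, IsUnit U.det ∧
      ∀ j, quadValue S (fun i => (U i j : ℝ)) ≤ C * S.det := by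
  induction n with
  | zero => exact ⟨1, one_pos, fun S _ _ => ⟨1, by simp, fun j => j.elim0⟩⟩
  | succ n ih =>
    obtain ⟨C, hC, h⟩ := ih
    refine ⟨1 + 2 * (C * 2 ^ Fintype.card (Fin n)), by positivity, fun S hS hm => ?_⟩
    let e : Unit ⊕ Fin n ≃ Fin (n + 1) :=
      (Equiv.sumComm _ _).trans ((Equiv.optionEquivSumPUnit _).symm.trans (finSuccEquiv n).symm)
    have hq : ∀ z : Fin (n + 1) → ℝ, quadValue (S.submatrix e e) (z ∘ e) = quadValue S z := by
      intro z
      simp only [quadValue, Matrix.submatrix_apply, Function.comp_apply]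
      rw [← e.sum_comp]
      exact Finset.sum_congr rfl fun i _ => e.sum_comp fun j => S (e i) j * z (e i) * z j
    obtain ⟨U, hU, hb⟩ := exists_reduced_basis_sum_unit hC h (S.submatrix e e) (hS.submatrix e)
      fun m hm0 => by
        have := hm (m ∘ e.symm) fun h0 => hm0 (funext fun i => by simpa using congrFun h0 (e i))
        rw [← hq] at this
        simpa [Function.comp_def] using this
    refine ⟨U.submatrix e.symm e.symm, by rwa [Matrix.det_submatrix_equiv_self], fun j => ?_⟩
    have := hb (e.symm j)
    rw [Matrix.det_submatrix_equiv_self] at this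
    rw [← hq]
    simpa [Function.comp_def] using this

/-- A compact set with nonempty interior contains the vertices of a simplex such that every point
has coordinates of absolute value at most one with respect to its edges at the first vertex. -/
theorem exists_simplex_edges {n : ℕ} {K : Set (EuclideanSpace ℝ (Fin n))} (hK : IsCompact K)
    (hint : (interior K).Nonempty) :
    ∃ x₀ ∈ K, ∃ A : Matrix (Fin n) (Fin n) ℝ, A.det ≠ 0 ∧
      (∀ j, x₀ + WithLp.toLp 2 (fun i => A i j) ∈ K) ∧
      ∀ y ∈ K, ∃ t : Fin n → ℝ, (∀ j, |t j| ≤ 1) ∧ ∀ i, y i = x₀ i + ∑ j, A i j * t j := by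
  let M : EuclideanSpace ℝ (Fin n) × (Fin n → EuclideanSpace ℝ (Fin n)) →
      Matrix (Fin n) (Fin n) ℝ := fun p => Matrix.of fun i j => p.2 j i - p.1 i
  have hM : Continuous M := by
    refine continuous_matrix fun i j => ?_
    simp only [M, Matrix.of_apply]
    fun_prop
  have hcont : Continuous fun p => |(M p).det| := hM.matrix_det.abs
  have hcpt : IsCompact (K ×ˢ Set.pi Set.univ fun _ : Fin n => K) :=
    hK.prod (isCompact_univ_pi fun _ => hK)
  obtain ⟨c, hc⟩ := hint
  obtain ⟨r, hr, hball⟩ := Metric.isOpen_iff.1 isOpen_interior c hc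
  have hcK : c ∈ K := interior_subset hc
  let q : EuclideanSpace ℝ (Fin n) × (Fin n → EuclideanSpace ℝ (Fin n)) :=
    (c, fun j => c + EuclideanSpace.single j (r / 2))
  have hq : q ∈ K ×ˢ Set.pi Set.univ fun _ : Fin n => K := by
    refine ⟨hcK, fun j _ => interior_subset (hball ?_)⟩
    simp [q, abs_of_pos hr]
    linarith
  obtain ⟨p, ⟨hp1, hp2⟩, hmax⟩ := hcpt.exists_isMaxOn ⟨q, hq⟩ hcont.continuousOn
  have hq0 : 0 < |(M q).det| := by
    have : M q = (r / 2) • (1 : Matrix (Fin n) (Fin n) ℝ) := by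
      ext i j
      by_cases h : i = j <;> simp [M, q, h]
    rw [this, Matrix.det_smul, Matrix.det_one]
    positivity
  have hp0 : 0 < |(M p).det| := hq0.trans_le (hmax hq)
  refine ⟨p.1, hp1, M p, abs_pos.1 hp0, fun j => ?_, fun y hy => ?_⟩
  · have : p.1 + WithLp.toLp 2 (fun i => M p i j) = p.2 j := by
      ext i
      simp [M]
    rw [this]
    exact hp2 j trivial
  · set b : Fin n → ℝ := fun i => y i - p.1 i with hb
    refine ⟨fun j => Matrix.cramer (M p) b j / (M p).det, fun j => ?_, fun i => ?_⟩
    · have hu : (M p).updateCol j b = M (p.1, Function.update p.2 j y) := by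
        ext i k
        by_cases h : k = j
        · subst h; simp [M, hb]
        · simp [M, h]
      rw [abs_div, div_le_one hp0, Matrix.cramer_apply, hu]
      refine hmax ⟨hp1, fun k _ => ?_⟩
      by_cases h : k = j
      · subst h; simpa using hy
      · simpa [h] using hp2 k trivial
    · have h1 := congrFun (Matrix.mulVec_cramer (M p) b) i
      simp only [Matrix.mulVec, dotProduct, Pi.smul_apply, smul_eq_mul] at h1
      simp only [← mul_div_assoc]
      rw [← Finset.sum_div, h1, mul_div_cancel_left₀ _ (abs_pos.1 hp0), hb]
      ring

/-- The volume of a convex set containing a simplex is bounded below by a multiple of the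
determinant of the edges. -/
theorem exists_mul_abs_det_le_volume (n : ℕ) : ∃ c : ℝ, 0 < c ∧
    ∀ K : Set (EuclideanSpace ℝ (Fin n)), IsCompact K → Convex ℝ K →
      ∀ x₀ ∈ K, ∀ A : Matrix (Fin n) (Fin n) ℝ,
        (∀ j, x₀ + WithLp.toLp 2 (fun i => A i j) ∈ K) →
        c * |A.det| ≤ (volume K).toReal := by
  set s : ℝ := 1 / (2 * (n + 1)) with hs
  have hs0 : 0 < s := by positivity
  set B : Set (EuclideanSpace ℝ (Fin n)) := Metric.ball (WithLp.toLp 2 fun _ => s) s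
  have hB : ∀ t ∈ B, (∀ i, 0 ≤ t i) ∧ ∑ i, t i ≤ 1 := by
    intro t ht
    have h1 : ∀ i, |t i - s| < s := fun i => by
      have h2 := PiLp.norm_apply_le (t - WithLp.toLp 2 fun _ => s) i
      have h3 := mem_ball_iff_norm.1 ht
      simp only [PiLp.sub_apply, Real.norm_eq_abs] at h2
      exact h2.trans_lt h3
    refine ⟨fun i => by linarith [(abs_lt.1 (h1 i)).1], ?_⟩
    calc ∑ i, t i ≤ ∑ _i : Fin n, 2 * s :=
          Finset.sum_le_sum fun i _ => by linarith [(abs_lt.1 (h1 i)).2]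
      _ ≤ 1 := by
        rw [Finset.sum_const, Finset.card_univ, Fintype.card_fin, nsmul_eq_mul, hs]
        field_simp
        linarith
  refine ⟨(volume B).toReal, ENNReal.toReal_pos (Metric.measure_ball_pos _ _ hs0).ne'
    measure_ball_lt_top.ne, fun K hK hconv x₀ hx₀ A hA => ?_⟩
  have hsub : Matrix.toEuclideanLin A '' B ⊆ (fun y => x₀ + y) ⁻¹' K := by
    rintro _ ⟨t, ht, rfl⟩
    obtain ⟨h0, h1⟩ := hB t ht
    have := hconv.sum_mem (t := Finset.univ)
      (w := fun o : Option (Fin n) => o.elim (1 - ∑ i, t i) fun i => t i)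
      (z := fun o => o.elim x₀ fun j => x₀ + WithLp.toLp 2 (fun i => A i j))
      (by rintro (_ | i) - <;> simp [h0, h1]) (by simp [Fintype.sum_option])
      (by rintro (_ | i) - <;> simp [hx₀, hA])
    have heq : x₀ + Matrix.toEuclideanLin A t = ∑ o : Option (Fin n),
        (o.elim (1 - ∑ i, t i) fun i => t i) •
          (o.elim x₀ fun j => x₀ + WithLp.toLp 2 (fun i => A i j)) := by
      ext i
      simp [Fintype.sum_option, Matrix.mulVec, dotProduct, Finset.sum_add_distrib, mul_comm]
      rw [← Finset.mul_sum]
      ring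
    rw [Set.mem_preimage, heq]
    exact this
  have hdet : LinearMap.det (Matrix.toEuclideanLin A) = A.det := by
    rw [Matrix.toEuclideanLin_eq_toLin_orthonormal, LinearMap.det_toLin]
  have hle := measure_mono (μ := volume) hsub
  rw [measure_preimage_add, Measure.addHaar_image_linearMap, hdet] at hle
  have := ENNReal.toReal_mono hK.measure_lt_top.ne hle
  rwa [ENNReal.toReal_mul, ENNReal.toReal_ofReal (abs_nonneg _), mul_comm] at this

/-- There is a constant `R > 0` depending only on `n` such that every
unavoidable convex body `K ⊆ ℝⁿ` can be mapped by a unimodular transformation into the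
closed Euclidean ball of radius `R · |K|` centered at the origin. -/
theorem stmt_14 (n : ℕ) :
    ∃ R : ℝ, 0 < R ∧
      ∀ K : Set (EuclideanSpace ℝ (Fin n)),
        IsCompact K → Convex ℝ K → (interior K).Nonempty →
        (∀ m : Fin n → ℤ, m ≠ 0 → ∃ x ∈ K, ∑ i, (m i : ℝ) * x i = 1) →
        ∃ M : Matrix (Fin n) (Fin n) ℤ, (M.det = 1 ∨ M.det = -1) ∧
          (Matrix.toEuclideanLin (M.map ((↑) : ℤ → ℝ))) '' K ⊆
            Metric.closedBall 0 (R * (volume K).toReal) := by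
  obtain ⟨C, hC, hred⟩ := exists_reduced_basis n
  obtain ⟨c, hc, hvol⟩ := exists_mul_abs_det_le_volume n
  set N : ℝ := n + 1 with hN
  have hN0 : 0 < N := by positivity
  set D : ℝ := Real.sqrt (C * N ^ n) with hD
  have hD0 : 0 < D := Real.sqrt_pos.2 (by positivity)
  refine ⟨N * (3 * D / c), by positivity, fun K hK hconv hint hun => ?_⟩
  obtain ⟨x₀, hx₀, A, hA0, hA, hcoord⟩ := exists_simplex_edges hK hint
  have hV := hvol K hK hconv x₀ hx₀ A hA
  set w : (Fin n → ℤ) → ℝ := fun m => ∑ j, |∑ i, (m i : ℝ) * A i j| with hw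
  have hdist : ∀ m : Fin n → ℤ, ∀ y ∈ K,
      |∑ i, (m i : ℝ) * y i - ∑ i, (m i : ℝ) * x₀ i| ≤ w m := by
    intro m y hy
    obtain ⟨t, ht, hy'⟩ := hcoord y hy
    have : ∑ i, (m i : ℝ) * y i - ∑ i, (m i : ℝ) * x₀ i =
        ∑ j, (∑ i, (m i : ℝ) * A i j) * t j := by
      simp only [hy', mul_add, Finset.sum_add_distrib, add_sub_cancel_left, Finset.mul_sum,
        Finset.sum_mul]
      rw [Finset.sum_comm]
      simp only [mul_assoc]
    rw [this]
    refine (Finset.abs_sum_le_sum_abs _ _).trans (Finset.sum_le_sum fun j _ => ?_)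
    rw [abs_mul]
    exact mul_le_of_le_one_right (abs_nonneg _) (ht j)
  have hone : ∀ m : Fin n → ℤ, m ≠ 0 → 1 ≤ w m := by
    intro m hm
    obtain ⟨y, hy, h1⟩ := hun m hm
    obtain ⟨z, hz, h2⟩ := hun (-m) (neg_ne_zero.2 hm)
    simp only [Pi.neg_apply, Int.cast_neg, neg_mul, Finset.sum_neg_distrib] at h2
    have h3 := abs_le.1 (hdist m y hy)
    have h4 := abs_le.1 (hdist m z hz)
    linarith [h3.2, h4.1]
  have hthree : ∀ m : Fin n → ℤ, m ≠ 0 → ∀ y ∈ K, |∑ i, (m i : ℝ) * y i| ≤ 3 * w m := by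
    intro m hm y hy
    obtain ⟨z, hz, h1⟩ := hun m hm
    have h3 := abs_le.1 (hdist m y hy)
    have h4 := abs_le.1 (hdist m z hz)
    have h5 := hone m hm
    rw [abs_le]
    constructor <;> linarith [h3.1, h3.2, h4.1, h4.2]
  set S : Matrix (Fin n) (Fin n) ℝ := N • (A * A.transpose) with hS
  have hwS : ∀ m : Fin n → ℤ, w m ^ 2 ≤ quadValue S (fun i => (m i : ℝ)) := by
    intro m
    rw [hS, quadValue_smul_left, quadValue_mul_transpose]
    have h1 := sq_sum_le_card_mul_sum_sq (s := Finset.univ)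
      (f := fun j => |∑ i, (m i : ℝ) * A i j|)
    simp only [sq_abs, Finset.card_univ, Fintype.card_fin] at h1
    refine h1.trans (mul_le_mul_of_nonneg_right (by linarith) ?_)
    exact Finset.sum_nonneg fun j _ => sq_nonneg _
  have hSs : S.IsSymm := (Matrix.isSymm_mul_transpose_self A).smul N
  obtain ⟨U, hU, hb⟩ := hred S hSs fun m hm => by
    have h1 := hone m hm
    have h2 := hwS m
    nlinarith
  have hdet : S.det = N ^ n * |A.det| ^ 2 := by
    rw [hS, Matrix.det_smul, Matrix.det_mul, Matrix.det_transpose, Fintype.card_fin, sq_abs, sq]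
  have hwU : ∀ j, w (fun i => U i j) ≤ D * |A.det| := by
    intro j
    refine (le_abs_self _).trans (abs_le_of_sq_le_sq ?_ (by positivity))
    rw [mul_pow, hD, Real.sq_sqrt (by positivity)]
    have h1 := (hwS fun i => U i j).trans (hb j)
    rw [hdet] at h1
    linarith
  refine ⟨U.transpose, by rw [Matrix.det_transpose]; exact Int.isUnit_iff.1 hU, ?_⟩
  rintro _ ⟨y, hy, rfl⟩
  rw [mem_closedBall_zero_iff]
  set z := Matrix.toEuclideanLin (U.transpose.map ((↑) : ℤ → ℝ)) y with hz
  have hzj : ∀ j, |z j| ≤ 3 * D / c * (volume K).toReal := by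
    intro j
    have h0 : (fun i => U i j) ≠ 0 := fun h0 => by
      rw [Matrix.det_eq_zero_of_column_eq_zero j (congrFun h0)] at hU
      exact not_isUnit_zero hU
    have h1 : z j = ∑ i, (U i j : ℝ) * y i := by
      simp [hz, Matrix.mulVec, dotProduct]
    rw [h1]
    refine (hthree _ h0 y hy).trans ?_
    rw [div_mul_eq_mul_div, le_div_iff₀ hc]
    have h2 := mul_le_mul_of_nonneg_right (hwU j) hc.le
    have h3 := mul_le_mul_of_nonneg_left hV hD0.le
    linarith
  have hnn : 0 ≤ 3 * D / c * (volume K).toReal := by positivity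
  rw [EuclideanSpace.norm_eq, mul_assoc]
  refine Real.sqrt_le_iff.2 ⟨by positivity, ?_⟩
  calc ∑ j, ‖z j‖ ^ 2 ≤ ∑ _j : Fin n, (3 * D / c * (volume K).toReal) ^ 2 :=
        Finset.sum_le_sum fun j _ => pow_le_pow_left₀ (norm_nonneg _) (hzj j) 2
    _ = n * (3 * D / c * (volume K).toReal) ^ 2 := by
        rw [Finset.sum_const, Finset.card_univ, Fintype.card_fin, nsmul_eq_mul]
    _ ≤ N ^ 2 * (3 * D / c * (volume K).toReal) ^ 2 := by
        refine mul_le_mul_of_nonneg_right ?_ (sq_nonneg _)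
        rw [hN]
        nlinarith [(Nat.cast_nonneg n : (0 : ℝ) ≤ n)]
    _ = (N * (3 * D / c * (volume K).toReal)) ^ 2 := by ring
end

section
/- Let P ⊂ ℝⁿ be a polytope with all vertices in ℤⁿ that intersects every integer hyperplane {x ∈ ℝⁿ : m₁x₁ + ⋯ + mₙxₙ = 1}, m ∈ ℤⁿ \ {0}. Then the volume of P is at least (n+1)/n!, and equality holds if and only if P is a basic simplex, i.e., the image under a unimodular transformation of the simplex with vertices e₁ = (1,0,…,0), …, eₙ = (0,…,0,1), and (−1,−1,…,−1). -/
open MeasureTheory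

/-- The open corner simplex of size `r`. -/
def openCorner (n : ℕ) (r : ℝ) : Set (Fin n → ℝ) := {t | (∀ i, 0 < t i) ∧ ∑ i, t i < r}

theorem isOpen_openCorner (n : ℕ) (r : ℝ) : IsOpen (openCorner n r) := by
  have : openCorner n r = (⋂ i, {t | 0 < t i}) ∩ {t | ∑ i, t i < r} := by
    ext t; simp [openCorner]
  rw [this]
  refine (isOpen_iInter_of_finite fun i => ?_).inter ?_
  · exact isOpen_lt continuous_const (continuous_apply i)
  · exact isOpen_lt (by fun_prop) continuous_const

theorem convex_openCorner (n : ℕ) (r : ℝ) : Convex ℝ (openCorner n r) := by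
  rintro x ⟨hx, hx'⟩ y ⟨hy, hy'⟩ a b ha hb hab
  refine ⟨fun i => ?_, ?_⟩
  · exact convex_Ioi (𝕜 := ℝ) (0 : ℝ) (hx i) (hy i) ha hb hab
  · have := convex_Iio (𝕜 := ℝ) r hx' hy' ha hb hab
    simpa [Finset.sum_add_distrib, Finset.mul_sum] using this

theorem volume_openCorner (n : ℕ) (r : ℝ) (hr : 0 < r) :
    volume (openCorner n r) = ENNReal.ofReal (r ^ n / n.factorial) := by
  induction n generalizing r with
  | zero =>
    have : openCorner 0 r = Set.univ := by ext t; simp [openCorner, hr]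
    simp [this, volume_pi]
  | succ n ih =>
    have mp := (volume_preserving_piFinSuccAbove (fun _ : Fin (n + 1) => ℝ) 0).symm
    have hm : MeasurableSet (openCorner (n + 1) r) := (isOpen_openCorner _ _).measurableSet
    rw [← mp.measure_preimage hm.nullMeasurableSet, Measure.volume_eq_prod,
      Measure.prod_apply (mp.measurable hm)]
    have key : ∀ s : ℝ, volume (Prod.mk s ⁻¹' ((MeasurableEquiv.piFinSuccAbove
        (fun _ : Fin (n + 1) => ℝ) 0).symm ⁻¹' openCorner (n + 1) r)) =
        (Set.Ioo 0 r).indicator (fun s => ENNReal.ofReal ((r - s) ^ n / n.factorial)) s := by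
      intro s
      by_cases hs : s ∈ Set.Ioo 0 r
      · rw [Set.indicator_of_mem hs, ← ih (r - s) (by linarith [hs.2])]
        congr 1
        ext t
        simp [openCorner, MeasurableEquiv.piFinSuccAbove_symm_apply, Fin.insertNthEquiv,
          Fin.sum_univ_succ, Fin.forall_fin_succ, hs.1, lt_sub_iff_add_lt']
      · rw [Set.indicator_of_notMem hs]
        convert measure_empty (μ := volume)
        ext t
        simp only [openCorner, MeasurableEquiv.piFinSuccAbove_symm_apply, Fin.insertNthEquiv,
          Fin.sum_univ_succ, Fin.forall_fin_succ, Set.mem_preimage, Set.mem_ofPred_eq,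
          Set.mem_empty_iff_false, iff_false, not_and]
        simp only [Equiv.coe_fn_mk, Fin.insertNth_zero', Fin.cons_zero, Fin.cons_succ]
        rintro ⟨h0, h1⟩ h2
        refine hs ⟨h0, ?_⟩
        have := Finset.sum_nonneg fun i (_ : i ∈ Finset.univ) => (h1 i).le
        linarith
    simp_rw [key]
    rw [lintegral_indicator measurableSet_Ioo, setLIntegral_congr Ioo_ae_eq_Ioc,
      ← ofReal_integral_eq_lintegral_ofReal, ← intervalIntegral.integral_of_le hr.le]
    · congr 1
      rw [intervalIntegral.integral_div,
        intervalIntegral.integral_comp_sub_left (fun x => x ^ n) r]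
      simp [Nat.factorial_succ]
      field_simp
    · exact (Continuous.integrableOn_Ioc (by fun_prop))
    · refine (ae_restrict_mem measurableSet_Ioc).mono fun s hs => ?_
      have : 0 ≤ r - s := by linarith [hs.2]
      positivity

theorem mem_closure_openCorner {n : ℕ} {x : Fin n → ℝ} (h0 : ∀ i, 0 ≤ x i) (h1 : ∑ i, x i ≤ 1) :
    x ∈ closure (openCorner n 1) := by
  have hlim : Filter.Tendsto (fun s : ℝ => (1 - s) • x + s • fun _ => 1 / ((n : ℝ) + 1))
      (nhdsWithin 0 (Set.Ioi 0)) (nhds x) := by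
    have : Continuous (fun s : ℝ => (1 - s) • x + s • fun _ : Fin n => 1 / ((n : ℝ) + 1)) := by
      fun_prop
    simpa using (this.tendsto 0).mono_left nhdsWithin_le_nhds
  refine mem_closure_of_tendsto hlim ?_
  filter_upwards [Ioo_mem_nhdsGT (show (0 : ℝ) < 1 by norm_num)] with s hs
  have h2 : (0 : ℝ) < 1 / ((n : ℝ) + 1) := by positivity
  have h3 : 0 < 1 - s := by linarith [hs.2]
  refine ⟨fun i => ?_, ?_⟩
  · have := mul_nonneg h3.le (h0 i)
    have := mul_pos hs.1 h2
    simp only [Pi.add_apply, Pi.smul_apply, smul_eq_mul]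
    linarith
  · simp only [Pi.add_apply, Pi.smul_apply, smul_eq_mul, Finset.sum_add_distrib, Finset.sum_const,
      Finset.card_univ, Fintype.card_fin, nsmul_eq_mul, ← Finset.mul_sum]
    have h4 : (n : ℝ) * (s * (1 / ((n : ℝ) + 1))) < s := by
      have := hs.1
      rw [mul_one_div, mul_div_assoc', div_lt_iff₀ (by positivity)]
      nlinarith
    nlinarith

theorem volume_closure_openCorner (n : ℕ) :
    volume (closure (openCorner n 1)) = ENNReal.ofReal (1 / n.factorial) := by
  rw [measure_closure_of_null_frontier ((convex_openCorner n 1).addHaar_frontier volume),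
    volume_openCorner n 1 one_pos, one_pow]

theorem volume_simplex_le (n : ℕ) :
    volume (convexHull ℝ (insert (fun _ => (-1 : ℝ))
              (Set.range fun i : Fin n => (Pi.single i 1 : Fin n → ℝ)))) ≤
      ENNReal.ofReal ((n + 1) / n.factorial) := by
  classical
  let A : Matrix (Fin n) (Fin n) ℝ :=
    1 + Matrix.replicateCol Unit (fun _ => (1 : ℝ)) * Matrix.replicateRow Unit (fun _ => (1 : ℝ))
  have hA : A.det = n + 1 := by
    simp [A, Matrix.det_one_add_replicateCol_mul_replicateRow, dotProduct, add_comm]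
  have hAv : ∀ v j, A.mulVec v j = v j + ∑ i, v i := by
    intro v j
    simp [A, Matrix.mulVec, dotProduct, Matrix.mul_apply, Matrix.one_apply, add_mul,
      Finset.sum_add_distrib]
  have hsub : convexHull ℝ (insert (fun _ => (-1 : ℝ))
      (Set.range fun i : Fin n => (Pi.single i 1 : Fin n → ℝ))) ⊆
      (fun x => (fun _ => (-1 : ℝ)) + x) '' (Matrix.toLin' A '' closure (openCorner n 1)) := by
    refine convexHull_min ?_ ?_
    · rintro _ (rfl | ⟨i, rfl⟩)
      · refine ⟨0, ⟨0, mem_closure_openCorner (by simp) (by simp), by simp⟩, ?_⟩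
        ext; simp
      · refine ⟨_, ⟨Pi.single i 1, mem_closure_openCorner ?_ (by simp), rfl⟩, ?_⟩
        · intro j
          by_cases h : j = i
          · subst h; simp
          · simp [h]
        · ext j
          simp only [Matrix.toLin'_apply, Pi.add_apply, hAv]
          simp
    · exact (((convex_openCorner n 1).closure).linear_image _).translate _
  refine (measure_mono hsub).trans ?_
  rw [Set.image_add_left, measure_preimage_add, Measure.addHaar_image_linearMap,
    LinearMap.det_toLin', hA, volume_closure_openCorner,
    ← ENNReal.ofReal_mul (abs_nonneg _), abs_of_nonneg (by positivity), mul_one_div]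

theorem exists_int_dotProduct_nonpos {n : ℕ} (W : Finset (Fin n → ℤ)) (u : Fin n → ℝ) (hu : u ≠ 0)
    (h : ∀ v ∈ W, u ⬝ᵥ (fun i => (v i : ℝ)) ≤ 0) :
    ∃ m : Fin n → ℤ, m ≠ 0 ∧ ∀ v ∈ W, m ⬝ᵥ v ≤ 0 := by
  obtain ⟨i₀, hi₀⟩ := Function.ne_iff.1 hu
  simp only [Pi.zero_apply] at hi₀
  wlog hi : |u i₀| = 1 generalizing u
  · refine this (|u i₀|⁻¹ • u) (by simp [hu, hi₀]) (fun v hv => ?_) (by simp [hi₀])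
      (by simp [abs_mul, hi₀])
    rw [smul_dotProduct]
    exact mul_nonpos_of_nonneg_of_nonpos (by positivity) (h v hv)
  let C : ℝ := ∑ v ∈ W, ∑ i, |(v i : ℝ)|
  have hC : 0 ≤ C := Finset.sum_nonneg fun v _ => Finset.sum_nonneg fun i _ => abs_nonneg _
  obtain ⟨a, -, φ, hφ, hlim⟩ := tendsto_subseq_of_bounded
    (s := Set.Icc (0 : Fin n → ℝ) 1) (Metric.isBounded_Icc 0 1)
    (x := fun (k : ℕ) i => Int.fract ((k : ℝ) * u i))
    (fun k => ⟨fun i => Int.fract_nonneg _, fun i => (Int.fract_lt_one _).le⟩)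
  obtain ⟨N, hN⟩ := Metric.cauchySeq_iff.1 hlim.cauchySeq (1 / (C + 2)) (by positivity)
  have hd := hN (N + 1) (Nat.le_succ N) N le_rfl
  have hlt : φ N < φ (N + 1) := hφ (Nat.lt_succ_self N)
  set k := φ N
  set l := φ (N + 1)
  let p : Fin n → ℤ := fun i => ⌊(l : ℝ) * u i⌋ - ⌊(k : ℝ) * u i⌋
  have hp : ∀ i, |((l : ℝ) - k) * u i - p i| < 1 / (C + 2) := by
    intro i
    have h1 : |Int.fract ((l : ℝ) * u i) - Int.fract ((k : ℝ) * u i)| < 1 / (C + 2) :=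
      (dist_le_pi_dist _ _ i).trans_lt hd
    simp only [Int.fract] at h1
    convert h1 using 2
    simp only [p]; push_cast; ring
  have hε : 1 / (C + 2) < 1 := by rw [div_lt_one (by positivity)]; linarith
  have hlk : (1 : ℝ) ≤ (l : ℝ) - k := by
    have : ((k + 1 : ℕ) : ℝ) ≤ l := by exact_mod_cast hlt
    push_cast at this; linarith
  refine ⟨p, fun h0 => ?_, fun v hv => ?_⟩
  · have h1 := hp i₀
    simp only [h0, Pi.zero_apply, Int.cast_zero, sub_zero, abs_mul, hi, mul_one] at h1
    have := le_abs_self ((l : ℝ) - k)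
    linarith
  · rw [← Int.lt_add_one_iff, zero_add]
    have h2 : ((p ⬝ᵥ v : ℤ) : ℝ) = ((l : ℝ) - k) * (u ⬝ᵥ fun i => (v i : ℝ)) -
        ∑ i, (((l : ℝ) - k) * u i - p i) * v i := by
      simp only [dotProduct, Finset.mul_sum, ← Finset.sum_sub_distrib, Int.cast_sum, Int.cast_mul]
      exact Finset.sum_congr rfl fun i _ => by ring
    have h3 : |∑ i, (((l : ℝ) - k) * u i - p i) * v i| ≤ 1 / (C + 2) * C := by
      refine (Finset.abs_sum_le_sum_abs _ _).trans ?_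
      refine le_trans (b := 1 / (C + 2) * ∑ i, |(v i : ℝ)|) ?_ ?_
      · rw [Finset.mul_sum]
        refine Finset.sum_le_sum fun i _ => ?_
        rw [abs_mul]
        exact mul_le_mul_of_nonneg_right (hp i).le (abs_nonneg _)
      · refine mul_le_mul_of_nonneg_left ?_ (by positivity)
        exact Finset.single_le_sum (f := fun v : Fin n → ℤ => ∑ i, |(v i : ℝ)|)
          (fun v _ => Finset.sum_nonneg fun i _ => abs_nonneg _) hv
    have h4 : 1 / (C + 2) * C < 1 := by
      rw [one_div_mul_eq_div, div_lt_one (by positivity)]; linarith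
    have h5 : ((l : ℝ) - k) * (u ⬝ᵥ fun i => (v i : ℝ)) ≤ 0 :=
      mul_nonpos_of_nonneg_of_nonpos (by linarith) (h v hv)
    have h6 := abs_le.1 h3
    have : ((p ⬝ᵥ v : ℤ) : ℝ) < 1 := by rw [h2]; linarith
    exact_mod_cast this

theorem dotProduct_le_of_mem_convexHull {n : ℕ} {S : Set (Fin n → ℝ)} {y x : Fin n → ℝ} {c : ℝ}
    (h : ∀ v ∈ S, y ⬝ᵥ v ≤ c) (hx : x ∈ convexHull ℝ S) : y ⬝ᵥ x ≤ c := by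
  have hconv : Convex ℝ {x | y ⬝ᵥ x ≤ c} :=
    convex_halfSpace_le (f := fun x => y ⬝ᵥ x) ⟨dotProduct_add y, fun c x => dotProduct_smul c y x⟩ c
  exact convexHull_min (t := {x | y ⬝ᵥ x ≤ c}) h hconv hx

theorem exists_dotProduct_eq {n : ℕ} (f : (Fin n → ℝ) →ₗ[ℝ] ℝ) :
    ∃ u : Fin n → ℝ, ∀ x, f x = u ⬝ᵥ x := by
  refine ⟨fun i => f (Pi.single i 1), fun x => ?_⟩
  conv_lhs => rw [pi_eq_sum_univ' x]
  simp [dotProduct, mul_comm]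

theorem zero_mem_interior_of_unavoidable_s16 {n : ℕ} (V : Finset (Fin n → ℤ)) (P : Set (Fin n → ℝ))
    (hP : P = convexHull ℝ
      ((fun (m : Fin n → ℤ) (i : Fin n) => (m i : ℝ)) '' (V : Set (Fin n → ℤ))))
    (hint : (interior P).Nonempty)
    (hunav : ∀ m : Fin n → ℤ, m ≠ 0 → ∃ x ∈ P, ∑ i, (m i : ℝ) * x i = 1) :
    (0 : Fin n → ℝ) ∈ interior P := by
  by_contra h0
  have hc : Convex ℝ P := hP ▸ convex_convexHull ℝ _
  obtain ⟨f, hf⟩ := geometric_hahn_banach_open_point hc.interior isOpen_interior h0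
  obtain ⟨u, hu⟩ := exists_dotProduct_eq (f : (Fin n → ℝ) →ₗ[ℝ] ℝ)
  simp only [ContinuousLinearMap.coe_coe] at hu
  rw [map_zero] at hf
  have hle : ∀ x ∈ P, f x ≤ 0 := by
    intro x hx
    have : x ∈ closure (interior P) := by
      rw [hc.closure_interior_eq_closure_of_nonempty_interior hint]; exact subset_closure hx
    exact closure_minimal (fun a ha => (hf a ha).le) (isClosed_le f.continuous continuous_const) this
  have hu0 : u ≠ 0 := by
    rintro rfl
    obtain ⟨a, ha⟩ := hint
    simpa [hu] using hf a ha
  obtain ⟨m, hm, hmv⟩ := exists_int_dotProduct_nonpos V u hu0 fun v hv => by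
    rw [← hu]
    exact hle _ (hP ▸ subset_convexHull ℝ _ ⟨v, hv, rfl⟩)
  obtain ⟨x, hx, hx1⟩ := hunav m hm
  have := dotProduct_le_of_mem_convexHull (y := fun i => (m i : ℝ)) (c := 0) ?_ (hP ▸ hx)
  · simp only [dotProduct] at this
    linarith
  · rintro _ ⟨v, hv, rfl⟩
    have := hmv v hv
    simp only [dotProduct] at this ⊢
    exact_mod_cast this
/-- The polar of a set, with respect to the dot product. -/
def dotPolar {n : ℕ} (S : Set (Fin n → ℝ)) : Set (Fin n → ℝ) := {y | ∀ v ∈ S, y ⬝ᵥ v ≤ 1}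

theorem convex_dotPolar {n : ℕ} (S : Set (Fin n → ℝ)) : Convex ℝ (dotPolar S) := by
  intro x hx y hy a b ha hb hab v hv
  rw [add_dotProduct, smul_dotProduct, smul_dotProduct]
  have h1 := mul_le_mul_of_nonneg_left (hx v hv) ha
  have h2 := mul_le_mul_of_nonneg_left (hy v hv) hb
  simp only [smul_eq_mul]
  linarith

theorem isCompact_dotPolar {n : ℕ} {S : Set (Fin n → ℝ)} (h0 : 0 ∈ interior (convexHull ℝ S)) :
    IsCompact (dotPolar S) := by
  refine Metric.isCompact_of_isClosed_isBounded ?_ ?_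
  · have : dotPolar S = ⋂ v ∈ S, {y | y ⬝ᵥ v ≤ 1} := by ext; simp [dotPolar]
    rw [this]
    exact isClosed_biInter fun v _ => isClosed_le (by fun_prop) continuous_const
  · obtain ⟨r, hr, hball⟩ := Metric.isOpen_iff.1 isOpen_interior 0 h0
    refine (Metric.isBounded_Icc (fun _ => -(2 / r)) (fun _ => 2 / r)).subset fun y hy => ?_
    have key : ∀ s : ℝ, |s| = r / 2 → ∀ i, y i * s ≤ 1 := by
      intro s hs i
      have : (Pi.single i s : Fin n → ℝ) ∈ convexHull ℝ S := by
        refine interior_subset (hball ?_)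
        rw [mem_ball_zero_iff, Pi.norm_single, Real.norm_eq_abs, hs]
        linarith
      simpa using dotProduct_le_of_mem_convexHull hy this
    refine ⟨fun i => ?_, fun i => ?_⟩
    · have := key (-(r / 2)) (by rw [abs_neg, abs_of_pos (by positivity)]) i
      rw [neg_le, le_div_iff₀ hr]
      linarith
    · have := key (r / 2) (abs_of_pos (by positivity)) i
      rw [le_div_iff₀ hr]
      linarith

theorem zero_mem_interior_dotPolar {n : ℕ} {S : Set (Fin n → ℝ)} (hS : S.Finite) :
    0 ∈ interior (dotPolar S) := by
  have ho : IsOpen (⋂ v ∈ S, {y : Fin n → ℝ | y ⬝ᵥ v < 1}) :=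
    hS.isOpen_biInter fun v _ => isOpen_lt (by fun_prop) continuous_const
  refine mem_interior.2 ⟨_, fun y hy v hv => ?_, ho, by simp⟩
  exact (Set.mem_iInter₂.1 hy v hv).le

theorem exists_independent_tight {n : ℕ} {S : Set (Fin n → ℝ)} (hS : S.Finite) {y : Fin n → ℝ}
    (hy : y ∈ (dotPolar S).extremePoints ℝ) :
    ∃ B : Matrix (Fin n) (Fin n) ℝ, (∀ k, B k ∈ S ∧ y ⬝ᵥ B k = 1) ∧ B.det ≠ 0 := by
  have hspan : Submodule.span ℝ {v ∈ S | y ⬝ᵥ v = 1} = ⊤ := by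
    by_contra hne
    obtain ⟨f, hf0, hf⟩ := Submodule.exists_le_ker_of_lt_top _ (lt_top_iff_ne_top.2 hne)
    obtain ⟨w, hw⟩ := exists_dotProduct_eq f
    have hw0 : w ≠ 0 := by
      rintro rfl
      exact hf0 (LinearMap.ext fun x => by simp [hw])
    have hwt : ∀ v ∈ S, y ⬝ᵥ v = 1 → w ⬝ᵥ v = 0 := fun v hv hv1 => by
      rw [← hw]; exact hf (Submodule.subset_span ⟨hv, hv1⟩)
    have hev : ∀ᶠ s : ℝ in nhds 0, ∀ v ∈ S, y ⬝ᵥ v ≠ 1 → y ⬝ᵥ v + s * (w ⬝ᵥ v) < 1 := by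
      refine (Filter.eventually_all_finite hS).2 fun v hv => ?_
      by_cases h1 : y ⬝ᵥ v = 1
      · simp [h1]
      · have hlt : y ⬝ᵥ v < 1 := lt_of_le_of_ne (hy.1 v hv) h1
        have hcont : Continuous fun s : ℝ => y ⬝ᵥ v + s * (w ⬝ᵥ v) := by fun_prop
        have := hcont.tendsto 0
        simp only [zero_mul, add_zero] at this
        filter_upwards [this.eventually_lt_const hlt] with s hs _ using hs
    obtain ⟨r, hr, hball⟩ := Metric.eventually_nhds_iff.1 hev
    have hmem : ∀ s : ℝ, |s| < r → y + s • w ∈ dotPolar S := by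
      intro s hs v hv
      rw [add_dotProduct, smul_dotProduct, smul_eq_mul]
      by_cases h1 : y ⬝ᵥ v = 1
      · rw [h1, hwt v hv h1]; simp
      · exact (hball (by simpa using hs) v hv h1).le
    have hr2 : |r / 2| < r := by rw [abs_of_pos (by positivity)]; linarith
    have h1 := hmem (r / 2) hr2
    have h2 := hmem (-(r / 2)) (by rwa [abs_neg])
    have := hy.2 h1 h2 ⟨1 / 2, 1 / 2, by norm_num, by norm_num, by norm_num, by module⟩
    have h3 : (r / 2) • w = 0 := by simpa using this
    exact (smul_ne_zero (by positivity) hw0) h3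
  obtain ⟨g, hg, -, hli⟩ := Submodule.exists_fun_fin_finrank_span_eq ℝ {v ∈ S | y ⬝ᵥ v = 1}
  have hfin : Module.finrank ℝ (Submodule.span ℝ {v ∈ S | y ⬝ᵥ v = 1}) = n := by
    rw [hspan, finrank_top]; simp
  let B : Matrix (Fin n) (Fin n) ℝ := Matrix.of fun k => g (Fin.cast hfin.symm k)
  refine ⟨B, fun k => hg _, ?_⟩
  have hB : LinearIndependent ℝ B.row := hli.comp _ (Fin.cast_injective _)
  exact ((Matrix.isUnit_iff_isUnit_det _).1
    (Matrix.linearIndependent_rows_iff_isUnit.1 hB)).ne_zero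

theorem finite_extremePoints_dotPolar {n : ℕ} {S : Set (Fin n → ℝ)} (hS : S.Finite) :
    ((dotPolar S).extremePoints ℝ).Finite := by
  refine Set.Finite.of_finite_image (f := fun y => {v ∈ S | y ⬝ᵥ v = 1})
    (hS.finite_subsets.subset ?_) ?_
  · rintro _ ⟨y, -, rfl⟩
    exact Set.sep_subset _ _
  · intro y hy z hz hyz
    obtain ⟨B, hB, hdet⟩ := exists_independent_tight hS hy
    have : B.mulVec (y - z) = 0 := by
      ext k
      have hz1 : B k ∈ {v ∈ S | z ⬝ᵥ v = 1} := by
        have hyz : {v ∈ S | y ⬝ᵥ v = 1} = {v ∈ S | z ⬝ᵥ v = 1} := hyz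
        exact hyz ▸ hB k
      simp only [Matrix.mulVec, Pi.zero_apply]
      rw [dotProduct_sub, dotProduct_comm, (hB k).2, dotProduct_comm, hz1.2, sub_self]
    exact sub_eq_zero.1 (Matrix.eq_zero_of_mulVec_eq_zero hdet this)

theorem convexHull_extremePoints_dotPolar {n : ℕ} {S : Set (Fin n → ℝ)} (hS : S.Finite)
    (h0 : 0 ∈ interior (convexHull ℝ S)) :
    convexHull ℝ ((dotPolar S).extremePoints ℝ) = dotPolar S := by
  rw [← (finite_extremePoints_dotPolar hS).isClosed_convexHull ℝ |>.closure_eq]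
  exact closure_convexHull_extremePoints (isCompact_dotPolar h0) (convex_dotPolar S)

theorem sum_det_le_volume {n : ℕ} {S : Set (Fin n → ℝ)} (h0 : 0 ∈ convexHull ℝ S)
    {ι : Type*} [Fintype ι] {y : ι → Fin n → ℝ} (hinj : Function.Injective y)
    (hy : ∀ i, y i ∈ dotPolar S) (B : ι → Matrix (Fin n) (Fin n) ℝ)
    (hB : ∀ i k, B i k ∈ S ∧ y i ⬝ᵥ B i k = 1) (hdet : ∀ i, (B i).det ≠ 0) :
    ∑ i, ENNReal.ofReal (|(B i).det| / n.factorial) ≤ volume (convexHull ℝ S) := by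
  let U : ι → Set (Fin n → ℝ) := fun i => Matrix.toLin' (B i).transpose '' openCorner n 1
  have hval : ∀ i (t x : Fin n → ℝ),
      x ⬝ᵥ Matrix.toLin' (B i).transpose t = ∑ k, t k * (x ⬝ᵥ B i k) := by
    intro i t x
    rw [Matrix.toLin'_apply, Matrix.dotProduct_mulVec, Matrix.vecMul_transpose, dotProduct_comm]
    simp only [dotProduct, Matrix.mulVec]
    exact Finset.sum_congr rfl fun k _ => by
      congr 1; exact Finset.sum_congr rfl fun j _ => mul_comm _ _
  have hle : ∀ i j, ∀ x ∈ U i, y j ⬝ᵥ x ≤ y i ⬝ᵥ x := by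
    rintro i j _ ⟨t, ht, rfl⟩
    rw [hval, hval]
    refine Finset.sum_le_sum fun k _ => mul_le_mul_of_nonneg_left ?_ (ht.1 k).le
    rw [(hB i k).2]
    exact hy j _ (hB i k).1
  have hdisj : Pairwise (Function.onFun Disjoint U) := by
    intro i j hij
    refine Set.disjoint_left.2 fun x hxi hxj => hij (hinj ?_)
    have heq : y j ⬝ᵥ x = y i ⬝ᵥ x := le_antisymm (hle i j x hxi) (hle j i x hxj)
    obtain ⟨t, ht, rfl⟩ := hxi
    rw [hval, hval] at heq
    have hle' : ∀ k ∈ Finset.univ, t k * (y j ⬝ᵥ B i k) ≤ t k * (y i ⬝ᵥ B i k) := by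
      intro k _
      refine mul_le_mul_of_nonneg_left ?_ (ht.1 k).le
      rw [(hB i k).2]
      exact hy j _ (hB i k).1
    have h1 := (Finset.sum_eq_sum_iff_of_le hle').1 heq
    have : (B i).mulVec (y i - y j) = 0 := by
      ext k
      have h2 := mul_left_cancel₀ (ht.1 k).ne' (h1 k (Finset.mem_univ k))
      simp only [Matrix.mulVec, Pi.zero_apply]
      rw [dotProduct_sub, dotProduct_comm, dotProduct_comm _ (y j), h2, sub_self]
    exact sub_eq_zero.1 (Matrix.eq_zero_of_mulVec_eq_zero (hdet i) this)
  have hvol : ∀ i, volume (U i) = ENNReal.ofReal (|(B i).det| / n.factorial) := by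
    intro i
    rw [Measure.addHaar_image_linearMap, LinearMap.det_toLin', Matrix.det_transpose,
      volume_openCorner n 1 one_pos, ← ENNReal.ofReal_mul (abs_nonneg _), one_pow, mul_one_div]
  have hsub : ∀ i, U i ⊆ convexHull ℝ S := by
    rintro i _ ⟨t, ht, rfl⟩
    have h1 : Matrix.toLin' (B i).transpose t = ∑ k, t k • B i k := by
      ext j
      simp [Matrix.toLin'_apply, Matrix.mulVec, dotProduct, mul_comm]
    rw [h1]
    have hc := convex_convexHull ℝ S
    have := hc.sum_mem (t := Finset.univ) (w := fun o : Option (Fin n) => o.elim (1 - ∑ k, t k) t)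
      (z := fun o : Option (Fin n) => o.elim 0 (B i)) ?_ ?_ ?_
    · convert this using 1
      rw [Fintype.sum_option]
      change _ = (1 - ∑ k, t k) • (0 : Fin n → ℝ) + ∑ k, t k • B i k
      simp
    · rintro (_ | k) -
      · simpa using ht.2.le
      · exact (ht.1 k).le
    · simp [Fintype.sum_option]
    · rintro (_ | k) -
      · exact h0
      · exact subset_convexHull ℝ S (hB i k).1
  have hmeas : ∀ i, MeasurableSet (U i) := by
    intro i
    refine (isOpen_openCorner n 1).measurableSet.image_of_continuousOn_injOn
      (LinearMap.continuous_of_finiteDimensional _).continuousOn ?_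
    have : Function.Injective (Matrix.toLin' (B i).transpose) := by
      rw [← LinearMap.ker_eq_bot, LinearMap.ker_eq_bot']
      intro v hv
      exact Matrix.eq_zero_of_mulVec_eq_zero (by rw [Matrix.det_transpose]; exact hdet i) hv
    exact this.injOn
  rw [← Finset.sum_congr rfl fun i _ => hvol i, ← tsum_fintype (L := .unconditional _),
    ← measure_iUnion hdisj hmeas]
  exact measure_mono (Set.iUnion_subset hsub)

/-- The inclusion of the integer lattice into `ℝⁿ`. -/
def intVec {n : ℕ} (m : Fin n → ℤ) (i : Fin n) : ℝ := (m i : ℝ)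

theorem one_le_abs_det {n : ℕ} {V : Set (Fin n → ℤ)} {B : Matrix (Fin n) (Fin n) ℝ}
    (hB : ∀ k, B k ∈ intVec '' V) (hdet : B.det ≠ 0) : 1 ≤ |B.det| := by
  choose q hq hqB using hB
  have h : B = (Matrix.of q).map (Int.castRingHom ℝ) := by
    ext k j
    exact (congrFun (hqB k) j).symm
  have h1 : B.det = ((Matrix.of q).det : ℝ) := by
    rw [h, ← RingHom.mapMatrix_apply, ← RingHom.map_det]; rfl
  rw [h1] at hdet ⊢
  exact_mod_cast Int.one_le_abs (by exact_mod_cast hdet)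

theorem card_le_volume {n : ℕ} {V : Set (Fin n → ℤ)} (hV : V.Finite)
    (h0 : 0 ∈ convexHull ℝ (intVec '' V)) {ι : Type*} [Fintype ι] {y : ι → Fin n → ℝ}
    (hinj : Function.Injective y) (hy : ∀ i, y i ∈ (dotPolar (intVec '' V)).extremePoints ℝ) :
    ENNReal.ofReal (Fintype.card ι / n.factorial) ≤ volume (convexHull ℝ (intVec '' V)) := by
  choose B hB hdet using fun i => exists_independent_tight (hV.image _) (hy i)
  refine le_trans ?_ (sum_det_le_volume h0 hinj (fun i => (hy i).1) B hB hdet)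
  rw [← ENNReal.ofReal_sum_of_nonneg fun i _ => by positivity]
  refine ENNReal.ofReal_le_ofReal ?_
  rw [← Finset.sum_div]
  gcongr
  simpa using Finset.card_nsmul_le_sum Finset.univ (fun i => |(B i).det|) 1
    fun i _ => one_le_abs_det (fun k => (hB i k).1) (hdet i)

/-- If the polar of a finite set is a simplex, then so is the convex hull of the set, and the
vertices of the latter are determined by those of the polar. -/
theorem exists_dual_simplex {n : ℕ} {S : Set (Fin n → ℝ)} (hS : S.Finite) (hne : S.Nonempty)
    {ι : Type*} [Fintype ι] [DecidableEq ι] (b : AffineBasis ι ℝ (Fin n → ℝ))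
    (hb : convexHull ℝ (Set.range b) = dotPolar S) (hpos : ∀ i, 0 < b.coord i 0) :
    ∃ p : ι → Fin n → ℝ, ∀ j, p j ∈ S ∧
      ∀ k, b k ⬝ᵥ p j = 1 - if k = j then (b.coord j 0)⁻¹ else 0 := by
  suffices ∀ j, ∃ p ∈ S, ∀ k, k ≠ j → b k ⬝ᵥ p = 1 by
    choose p hp hp1 using this
    refine ⟨p, fun j => ⟨hp j, fun k => ?_⟩⟩
    split_ifs with h
    · subst h
      have h1 := congrArg (· ⬝ᵥ p k) (b.linear_combination_coord_eq_self 0)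
      simp only [sum_dotProduct, smul_dotProduct, zero_dotProduct, smul_eq_mul] at h1
      have h2 := b.sum_coord_apply_eq_one 0
      rw [← Finset.add_sum_erase _ _ (Finset.mem_univ k)] at h1 h2
      have h3 : ∑ i ∈ Finset.univ.erase k, b.coord i 0 * (b i ⬝ᵥ p k) =
          ∑ i ∈ Finset.univ.erase k, b.coord i 0 :=
        Finset.sum_congr rfl fun i hi => by rw [hp1 k i (Finset.ne_of_mem_erase hi), mul_one]
      have := (hpos k).ne'
      field_simp
      linarith
    · rw [hp1 j k h, sub_zero]
  intro j
  by_contra! hcon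
  have hmem : ∀ k, b k ∈ dotPolar S := fun k => hb ▸ subset_convexHull ℝ _ ⟨k, rfl⟩
  let N : ℝ := (Finset.univ.erase j).card
  have hN : 0 < N := by
    obtain ⟨v, hv⟩ := hne
    obtain ⟨k, hk, -⟩ := hcon v hv
    exact Nat.cast_pos.2 (Finset.card_pos.2 ⟨k, by simp [hk]⟩)
  let g : Fin n → ℝ := ∑ k ∈ Finset.univ.erase j, b k
  have hg : ∀ v ∈ S, g ⬝ᵥ v < N := by
    intro v hv
    obtain ⟨k, hk, hk1⟩ := hcon v hv
    simp only [g, N, sum_dotProduct]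
    have := Finset.sum_lt_sum (s := Finset.univ.erase j) (f := fun k => b k ⬝ᵥ v)
      (g := fun _ => (1 : ℝ)) (fun i _ => hmem i v hv)
      ⟨k, by simp [hk], lt_of_le_of_ne (hmem k v hv) hk1⟩
    simpa using this
  obtain ⟨c, hc0, hcN, hc⟩ : ∃ c : ℝ, 0 < c ∧ c < N ∧ ∀ v ∈ S, g ⬝ᵥ v ≤ c := by
    obtain ⟨v, hv, hmax⟩ := hS.exists_maximalFor (fun v => g ⬝ᵥ v) S hne
    refine ⟨max (g ⬝ᵥ v) (N / 2), by positivity, max_lt (hg v hv) (by linarith), fun w hw => ?_⟩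
    refine le_max_of_le_left ?_
    by_contra! hlt
    exact absurd (hmax hw hlt.le) (not_le.2 hlt)
  have hgc : c⁻¹ • g ∈ convexHull ℝ (Set.range b) := by
    rw [hb]
    intro v hv
    rw [smul_dotProduct, smul_eq_mul, inv_mul_le_iff₀ hc0, mul_one]
    exact hc v hv
  rw [b.convexHull_eq_nonneg_coord] at hgc
  have h1 := hgc j
  have hlin : ∀ x, b.coord j x = (b.coord j).linear x + b.coord j 0 := fun x =>
    congrFun (b.coord j).decomp x
  have h2 : (b.coord j).linear g = -(N * b.coord j 0) := by
    simp only [g, map_sum]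
    rw [Finset.sum_congr rfl fun k hk => show (b.coord j).linear (b k) = -b.coord j 0 by
      have := hlin (b k)
      rw [b.coord_apply_ne (Finset.ne_of_mem_erase hk).symm] at this
      linarith]
    simp [N]
  rw [hlin, map_smul, h2, smul_eq_mul] at h1
  have h3 : 1 < c⁻¹ * N := by rwa [lt_inv_mul_iff₀ hc0, mul_one]
  nlinarith [hpos j]

theorem sum_coord_smul_dual_simplex {n : ℕ} {ι : Type*} [Fintype ι] [DecidableEq ι]
    (b : AffineBasis ι ℝ (Fin n → ℝ)) (hpos : ∀ i, 0 < b.coord i 0) {p : ι → Fin n → ℝ}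
    (hp : ∀ j k, b k ⬝ᵥ p j = 1 - if k = j then (b.coord j 0)⁻¹ else 0) (x : Fin n → ℝ) :
    (∑ j, b.coord j 0 * (1 - b j ⬝ᵥ x) = 1) ∧
      ∑ j, (b.coord j 0 * (1 - b j ⬝ᵥ x)) • p j = x := by
  have hsum : ∑ j, b.coord j 0 * (1 - b j ⬝ᵥ x) = 1 := by
    have h1 := congrArg (· ⬝ᵥ x) (b.linear_combination_coord_eq_self 0)
    simp only [sum_dotProduct, smul_dotProduct, zero_dotProduct, smul_eq_mul] at h1
    simp only [mul_sub, mul_one, Finset.sum_sub_distrib, h1, b.sum_coord_apply_eq_one, sub_zero]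
  refine ⟨hsum, ?_⟩
  have key : ∀ k, b k ⬝ᵥ (∑ j, (b.coord j 0 * (1 - b j ⬝ᵥ x)) • p j) = b k ⬝ᵥ x := by
    intro k
    simp only [dotProduct_sum, dotProduct_smul, hp, smul_eq_mul, mul_sub, mul_one]
    rw [Finset.sum_sub_distrib]
    simp only [mul_ite, mul_zero, Finset.sum_ite_eq, Finset.mem_univ, if_true]
    have := (hpos k).ne'
    have h2 : ∑ j, (b.coord j 0 - b.coord j 0 * b j ⬝ᵥ x) = 1 := by
      simpa only [mul_sub, mul_one] using hsum
    rw [h2]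
    field_simp
    ring
  refine sub_eq_zero.1 (dotProduct_eq_zero _ fun z => ?_)
  rw [dotProduct_comm, ← b.linear_combination_coord_eq_self z, sum_dotProduct]
  refine Finset.sum_eq_zero fun k _ => ?_
  rw [smul_dotProduct, dotProduct_sub, key, sub_self, smul_zero]

theorem exists_unimodular_of_volume_le {n : ℕ} {V : Set (Fin n → ℤ)} (hV : V.Finite)
    (h0 : 0 ∈ convexHull ℝ (intVec '' V)) (b : AffineBasis (Fin (n + 1)) ℝ (Fin n → ℝ))
    (hb : convexHull ℝ (Set.range b) = dotPolar (intVec '' V)) (hpos : ∀ i, 0 < b.coord i 0)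
    (hvol : volume (convexHull ℝ (intVec '' V)) ≤ ENNReal.ofReal ((n + 1) / n.factorial)) :
    ∃ M : Matrix (Fin n) (Fin n) ℤ, (M.det = 1 ∨ M.det = -1) ∧
      convexHull ℝ (intVec '' V) = (Matrix.toLin' (M.map ((↑) : ℤ → ℝ))) ''
        convexHull ℝ (insert (fun _ => (-1 : ℝ))
          (Set.range fun i : Fin n => (Pi.single i 1 : Fin n → ℝ))) := by
  have hbmem : ∀ k, b k ∈ dotPolar (intVec '' V) :=
    fun k => hb ▸ subset_convexHull ℝ _ ⟨k, rfl⟩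
  obtain ⟨p, hp⟩ := exists_dual_simplex (hV.image _) (convexHull_nonempty_iff.1 ⟨0, h0⟩) b hb hpos
  have hrec := sum_coord_smul_dual_simplex b hpos fun j => (hp j).2
  have hhull : convexHull ℝ (intVec '' V) = convexHull ℝ (Set.range p) := by
    refine subset_antisymm (convexHull_min (fun v hv => ?_) (convex_convexHull ℝ _))
      (convexHull_mono (by rintro _ ⟨j, rfl⟩; exact (hp j).1))
    rw [← (hrec v).2]
    refine (convex_convexHull ℝ _).sum_mem (fun j _ => ?_) (hrec v).1
      fun j _ => subset_convexHull ℝ _ ⟨j, rfl⟩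
    exact mul_nonneg (hpos j).le (sub_nonneg.2 (hbmem j v hv))
  let l : Fin (n + 1) → ℝ := fun j => b.coord j 0
  have hl : ∀ j, 0 < l j := hpos
  let A : Matrix (Fin n) (Fin n) ℝ := Matrix.of fun k => p k.succ
  have hp0 : p 0 = ∑ k, (-(l k.succ / l 0)) • A k := by
    have h1 := (hrec 0).2
    simp only [dotProduct_zero, sub_zero, mul_one] at h1
    rw [Fin.sum_univ_succ] at h1
    have h2 : l 0 • p 0 = l 0 • ∑ k, (-(l k.succ / l 0)) • A k := by
      rw [eq_neg_of_add_eq_zero_left h1, Finset.smul_sum, ← Finset.sum_neg_distrib]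
      refine Finset.sum_congr rfl fun k _ => ?_
      have := (hl 0).ne'
      rw [smul_smul, mul_neg, mul_div_cancel₀ _ this, neg_smul]
      rfl
    exact smul_right_injective _ (hl 0).ne' h2
  have hAdet : A.det ≠ 0 := by
    intro hdet
    obtain ⟨w, hw0, hw⟩ := Matrix.exists_mulVec_eq_zero_iff.2 hdet
    have hw1 : ∀ k, A k ⬝ᵥ w = 0 := fun k => congrFun hw k
    have hw2 : ∀ j, p j ⬝ᵥ w = 0 := by
      refine Fin.cases ?_ hw1
      rw [hp0, sum_dotProduct]
      exact Finset.sum_eq_zero fun k _ => by rw [smul_dotProduct, hw1, smul_zero]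
    refine hw0 (dotProduct_eq_zero _ fun x => ?_)
    rw [dotProduct_comm, ← (hrec x).2, sum_dotProduct]
    exact Finset.sum_eq_zero fun k _ => by rw [smul_dotProduct, hw2, smul_zero]
  let B : Fin (n + 1) → Matrix (Fin n) (Fin n) ℝ :=
    Fin.cases A fun i => A.updateRow i (p 0)
  have hBdet : ∀ i : Fin n, (B i.succ).det = -(l i.succ / l 0) * A.det := by
    intro i
    change (A.updateRow i (p 0)).det = _
    rw [hp0, Matrix.det_updateRow_sum, smul_eq_mul]
  have hB : ∀ i k, B i k ∈ intVec '' V ∧ b i ⬝ᵥ B i k = 1 := by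
    have hpp : ∀ j k, k ≠ j → p j ∈ intVec '' V ∧ b k ⬝ᵥ p j = 1 := fun j k hkj =>
      ⟨(hp j).1, by rw [(hp j).2, if_neg hkj, sub_zero]⟩
    refine Fin.cases (fun k => hpp _ _ (Fin.succ_ne_zero k).symm) fun i k => ?_
    change A.updateRow i (p 0) k ∈ _ ∧ _ ⬝ᵥ A.updateRow i (p 0) k = 1
    by_cases hik : k = i
    · subst hik
      rw [Matrix.updateRow_self]
      exact hpp _ _ (Fin.succ_ne_zero k)
    · rw [Matrix.updateRow_ne hik]
      exact hpp _ _ fun h => hik (Fin.succ_injective _ h).symm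
  have hBne : ∀ i, (B i).det ≠ 0 := by
    refine Fin.cases hAdet fun i => ?_
    rw [hBdet]
    exact mul_ne_zero (neg_ne_zero.2 (div_pos (hl _) (hl _)).ne') hAdet
  have hone := fun i => one_le_abs_det (fun k => (hB i k).1) (hBne i)
  have hBone : ∀ i, |(B i).det| = 1 := by
    have h1 := (sum_det_le_volume h0 b.ind.injective hbmem B hB hBne).trans hvol
    rw [← ENNReal.ofReal_sum_of_nonneg fun i _ => by positivity,
      ENNReal.ofReal_le_ofReal_iff (by positivity), ← Finset.sum_div,
      div_le_div_iff_of_pos_right (by positivity)] at h1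
    have h2 : ∑ _i : Fin (n + 1), (1 : ℝ) = ∑ i, |(B i).det| :=
      le_antisymm (Finset.sum_le_sum fun i _ => hone i) (by simpa using h1)
    intro i
    exact ((Finset.sum_eq_sum_iff_of_le fun i _ => hone i).1 h2 i (Finset.mem_univ i)).symm
  have hAone : |A.det| = 1 := hBone 0
  have hp0' : p 0 = -∑ k : Fin n, p k.succ := by
    rw [hp0, ← Finset.sum_neg_distrib (fun k : Fin n => p k.succ)]
    refine Finset.sum_congr rfl fun k _ => ?_
    have h1 := hBone k.succ
    rw [hBdet, abs_mul, hAone, mul_one, abs_neg, abs_of_pos (div_pos (hl _) (hl _))] at h1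
    rw [h1, neg_one_smul]
    rfl
  choose q hq hqp using fun k : Fin n => (hp k.succ).1
  let M : Matrix (Fin n) (Fin n) ℤ := (Matrix.of q).transpose
  have hMA : M.map ((↑) : ℤ → ℝ) = A.transpose := by
    ext j k
    exact congrFun (hqp k) j
  have hMdet : (M.det : ℝ) = A.det := by
    rw [← Matrix.det_transpose A, ← hMA]
    exact (Int.castRingHom ℝ).map_det M
  refine ⟨M, ?_, ?_⟩
  · rw [← hMdet] at hAone
    exact eq_or_eq_neg_of_abs_eq (by exact_mod_cast hAone)
  · rw [hhull, LinearMap.image_convexHull, Set.image_insert_eq, ← Set.range_comp, hMA]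
    congr 1
    have h1 : Matrix.toLin' A.transpose (fun _ => -1) = p 0 := by
      rw [hp0']
      ext j
      simp [Matrix.mulVec, dotProduct, A]
    have h2 : ∀ k, Matrix.toLin' A.transpose (Pi.single k 1) = p k.succ := by
      intro k
      ext j
      simp [A]
    rw [h1]
    ext x
    simp only [Set.mem_range, Set.mem_insert_iff, Function.comp, h2, Fin.exists_fin_succ,
      eq_comm (a := x)]

/-- An unavoidable polytope `P ⊆ ℝⁿ` with integer vertices has volume at
least `(n+1)/n!`, with equality iff `P` is a basic simplex: the image under a unimodular
transformation of the simplex with vertices `e₁, …, eₙ, (-1,…,-1)`. -/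
theorem stmt_16 (n : ℕ) (V : Finset (Fin n → ℤ)) (P : Set (Fin n → ℝ))
    (hP : P = convexHull ℝ
      ((fun (m : Fin n → ℤ) (i : Fin n) => (m i : ℝ)) '' (V : Set (Fin n → ℤ))))
    (hint : (interior P).Nonempty)
    (hunav : ∀ m : Fin n → ℤ, m ≠ 0 → ∃ x ∈ P, ∑ i, (m i : ℝ) * x i = 1) :
    ENNReal.ofReal ((n + 1) / n.factorial) ≤ volume P ∧
      (volume P = ENNReal.ofReal ((n + 1) / n.factorial) ↔
        ∃ M : Matrix (Fin n) (Fin n) ℤ, (M.det = 1 ∨ M.det = -1) ∧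
          P = (Matrix.toLin' (M.map ((↑) : ℤ → ℝ))) ''
            convexHull ℝ (insert (fun _ => (-1 : ℝ))
              (Set.range fun i : Fin n => (Pi.single i 1 : Fin n → ℝ)))) := by
  have hPV : P = convexHull ℝ (intVec '' (V : Set (Fin n → ℤ))) := hP
  have hV := V.finite_toSet
  have hS := hV.image intVec
  have h0 := zero_mem_interior_of_unavoidable_s16 V P hP hint hunav
  rw [hPV] at h0
  have h0' := interior_subset h0
  have hext := convexHull_extremePoints_dotPolar hS h0
  obtain ⟨s, hs, b', hb'⟩ := AffineBasis.exists_affine_subbasis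
    (affineSpan_eq_top_of_nonempty_interior
      (s := (dotPolar (intVec '' (V : Set (Fin n → ℤ)))).extremePoints ℝ)
      (by rw [hext]; exact ⟨0, zero_mem_interior_dotPolar hS⟩))
  have : Fintype s := ((finite_extremePoints_dotPolar hS).subset hs).fintype
  have hcard : Fintype.card s = n + 1 := by
    rw [b'.card_eq_finrank_add_one, Module.finrank_fin_fun]
  let b := b'.reindex (Fintype.equivFinOfCardEq hcard)
  have hbext : ∀ i, b i ∈ (dotPolar (intVec '' (V : Set (Fin n → ℤ)))).extremePoints ℝ := by
    intro i
    simp only [b, AffineBasis.reindex_apply, hb']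
    exact hs (Subtype.coe_prop _)
  have hlow : ENNReal.ofReal ((n + 1) / n.factorial) ≤ volume P := by
    rw [hPV]
    simpa using card_le_volume hV h0' b.ind.injective hbext
  refine ⟨hlow, fun hvol => ?_, ?_⟩
  · have hrange : Set.range b = (dotPolar (intVec '' (V : Set (Fin n → ℤ)))).extremePoints ℝ := by
      refine subset_antisymm (by rintro _ ⟨i, rfl⟩; exact hbext i) fun z hz => ?_
      by_contra hzb
      have hinj : Function.Injective (fun o : Option (Fin (n + 1)) => o.elim z b) := by
        rintro (_ | i) (_ | j) hij
        · rfl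
        · exact absurd ⟨j, hij.symm⟩ hzb
        · exact absurd ⟨i, hij⟩ hzb
        · exact congrArg some (b.ind.injective hij)
      have := card_le_volume hV h0' hinj (by rintro (_ | i); exacts [hz, hbext i])
      rw [← hPV, hvol, ENNReal.ofReal_le_ofReal_iff (by positivity),
        div_le_div_iff_of_pos_right (by positivity)] at this
      simp at this
      linarith
    have hbhull := hrange ▸ hext
    rw [hPV] at hvol ⊢
    refine exists_unimodular_of_volume_le hV h0' b hbhull (fun i => ?_) hvol.le
    have h1 : (0 : Fin n → ℝ) ∈ interior (convexHull ℝ (Set.range b)) := by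
      rw [hbhull]; exact zero_mem_interior_dotPolar hS
    rw [b.interior_convexHull] at h1
    exact h1 i
  · rintro ⟨M, hM, hPM⟩
    refine le_antisymm ?_ hlow
    have hdet : |(Matrix.map M ((↑) : ℤ → ℝ)).det| = 1 := by
      have : (M.map ((↑) : ℤ → ℝ)).det = (M.det : ℝ) := ((Int.castRingHom ℝ).map_det M).symm
      rw [this]
      rcases hM with h | h <;> simp [h]
    rw [hPM, Measure.addHaar_image_linearMap, LinearMap.det_toLin', hdet, ENNReal.ofReal_one,
      one_mul]
    exact volume_simplex_le n
end

section
/- Let P ⊂ ℝ² be an unavoidable convex polygon and let x be a vertex of P. If there exist two distinct u, v ∈ ℤ² such that the lines {y ∈ ℝ² : ⟨u,y⟩ = 1} and {y ∈ ℝ² : ⟨v,y⟩ = 1} both support P at x (i.e., ⟨u,x⟩ = ⟨v,x⟩ = 1 and ⟨u,y⟩ ≤ 1, ⟨v,y⟩ ≤ 1 for all y ∈ P), then x ∈ ℤ². -/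
/-- An integer vector in the half-open triangle spanned by two integer normals of lines
bounding an unavoidable set vanishes. -/
theorem eq_zero_of_add_lt_one {P : Set (Fin 2 → ℝ)}
    (hunav : ∀ m : Fin 2 → ℤ, m ≠ 0 → ∃ y ∈ P, ∑ i, (m i : ℝ) * y i = 1)
    {u v : Fin 2 → ℤ}
    (hu : ∀ y ∈ P, ∑ i, (u i : ℝ) * y i ≤ 1)
    (hv : ∀ y ∈ P, ∑ i, (v i : ℝ) * y i ≤ 1)
    {m : Fin 2 → ℤ} {a b : ℝ} (ha : 0 ≤ a) (hb : 0 ≤ b) (hab : a + b < 1)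
    (hm : ∀ i, (m i : ℝ) = a * u i + b * v i) : m = 0 := by
  by_contra hne
  obtain ⟨y, hy, hy1⟩ := hunav m hne
  have key : ∑ i, (m i : ℝ) * y i
      = a * ∑ i, (u i : ℝ) * y i + b * ∑ i, (v i : ℝ) * y i := by
    simp only [hm, Fin.sum_univ_two]
    ring
  nlinarith [mul_le_mul_of_nonneg_left (hu y hy) ha, mul_le_mul_of_nonneg_left (hv y hy) hb]

/-- If two distinct integer lines through `x` bound an unavoidable set, then every integer
linear form takes an integer value at `x`. -/
theorem exists_int_eq_sum_mul {P : Set (Fin 2 → ℝ)}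
    (hunav : ∀ m : Fin 2 → ℤ, m ≠ 0 → ∃ y ∈ P, ∑ i, (m i : ℝ) * y i = 1)
    {x : Fin 2 → ℝ} {u v : Fin 2 → ℤ} (huv : u ≠ v)
    (hu1 : ∑ i, (u i : ℝ) * x i = 1) (hv1 : ∑ i, (v i : ℝ) * x i = 1)
    (hu : ∀ y ∈ P, ∑ i, (u i : ℝ) * y i ≤ 1)
    (hv : ∀ y ∈ P, ∑ i, (v i : ℝ) * y i ≤ 1)
    (m : Fin 2 → ℤ) : ∃ k : ℤ, ∑ i, (m i : ℝ) * x i = k := by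
  simp only [Fin.sum_univ_two] at hu1 hv1
  have hD : (u 0 * v 1 - u 1 * v 0 : ℝ) ≠ 0 := by
    intro h
    have h0 : (u 0 : ℝ) = v 0 := by linear_combination v 0 * hu1 - u 0 * hv1 + x 1 * h
    have h1 : (u 1 : ℝ) = v 1 := by linear_combination v 1 * hu1 - u 1 * hv1 - x 0 * h
    apply huv
    ext i
    fin_cases i
    · exact_mod_cast h0
    · exact_mod_cast h1
  obtain ⟨a, b, hm⟩ : ∃ a b : ℝ, ∀ i, (m i : ℝ) = a * u i + b * v i := by
    refine ⟨(m 0 * v 1 - m 1 * v 0) / (u 0 * v 1 - u 1 * v 0),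
      (u 0 * m 1 - u 1 * m 0) / (u 0 * v 1 - u 1 * v 0), Fin.forall_fin_two.2 ⟨?_, ?_⟩⟩ <;>
    · rw [div_mul_eq_mul_div, div_mul_eq_mul_div, ← add_div, eq_div_iff hD]
      ring
  have hmx : ∑ i, (m i : ℝ) * x i = a + b := by
    simp only [Fin.sum_univ_two, hm]
    linear_combination a * hu1 + b * hv1
  have ha := Int.floor_add_fract a
  have hb := Int.floor_add_fract b
  rcases lt_trichotomy (Int.fract a + Int.fract b) 1 with h | h | h
  · have hz := eq_zero_of_add_lt_one hunav hu hv (m := fun i => m i - ⌊a⌋ * u i - ⌊b⌋ * v i)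
      (Int.fract_nonneg a) (Int.fract_nonneg b) h (fun i => by
        push_cast
        rw [hm i]
        linear_combination (-u i : ℝ) * ha - v i * hb)
    have hi : ∀ i, (m i : ℝ) = ⌊a⌋ * u i + ⌊b⌋ * v i := fun i => by
      have := congrFun hz i
      simp only [Pi.zero_apply] at this
      exact_mod_cast (by linarith : m i = ⌊a⌋ * u i + ⌊b⌋ * v i)
    refine ⟨⌊a⌋ + ⌊b⌋, ?_⟩
    simp only [Fin.sum_univ_two, hi]
    push_cast
    linear_combination (⌊a⌋ : ℝ) * hu1 + ⌊b⌋ * hv1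
  · refine ⟨⌊a⌋ + ⌊b⌋ + 1, ?_⟩
    rw [hmx]
    push_cast
    linarith
  · have hz := eq_zero_of_add_lt_one hunav hu hv
      (m := fun i => (⌊a⌋ + 1) * u i + (⌊b⌋ + 1) * v i - m i)
      (a := 1 - Int.fract a) (b := 1 - Int.fract b)
      (by linarith [Int.fract_lt_one a]) (by linarith [Int.fract_lt_one b]) (by linarith)
      (fun i => by
        push_cast
        rw [hm i]
        linear_combination (u i : ℝ) * ha + v i * hb)
    have hi : ∀ i, (m i : ℝ) = (⌊a⌋ + 1) * u i + (⌊b⌋ + 1) * v i := fun i => by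
      have := congrFun hz i
      simp only [Pi.zero_apply] at this
      exact_mod_cast (by linarith : m i = (⌊a⌋ + 1) * u i + (⌊b⌋ + 1) * v i)
    refine ⟨⌊a⌋ + 1 + (⌊b⌋ + 1), ?_⟩
    simp only [Fin.sum_univ_two, hi]
    push_cast
    linear_combination (⌊a⌋ + 1 : ℝ) * hu1 + (⌊b⌋ + 1) * hv1


/-- If two distinct integer lines support an unavoidable convex polygon
`P ⊆ ℝ²` at a vertex `x`, then `x` is an integer point. -/
theorem stmt_17 (S : Finset (Fin 2 → ℝ)) (P : Set (Fin 2 → ℝ))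
    (hP : P = convexHull ℝ (S : Set (Fin 2 → ℝ)))
    (hint : (interior P).Nonempty)
    (hunav : ∀ m : Fin 2 → ℤ, m ≠ 0 → ∃ y ∈ P, ∑ i, (m i : ℝ) * y i = 1)
    (x : Fin 2 → ℝ) (hx : x ∈ Set.extremePoints ℝ P)
    (u v : Fin 2 → ℤ) (huv : u ≠ v)
    (hu1 : ∑ i, (u i : ℝ) * x i = 1) (hv1 : ∑ i, (v i : ℝ) * x i = 1)
    (hu : ∀ y ∈ P, ∑ i, (u i : ℝ) * y i ≤ 1)
    (hv : ∀ y ∈ P, ∑ i, (v i : ℝ) * y i ≤ 1) :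
    ∃ m : Fin 2 → ℤ, x = fun i => (m i : ℝ) := by
  choose m hm using fun j =>
    exists_int_eq_sum_mul hunav huv hu1 hv1 hu hv (Pi.single j 1)
  refine ⟨m, funext fun j => ?_⟩
  rw [← hm j]
  simp [Pi.single_apply]
end
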